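/- There exist absolute constants c, C > 0 such that, with probability 1 − o(1) for a random pair (g,h) ∈ Sym(n) × Sym(n), the following holds with G = ⟨g,h⟩ and S = {g, h, g⁻¹, h⁻¹}: for every function f : G → ℝ with Σ_{x∈G} f(x) = 0 one has Σ_{x∈G} f(x)·(f(x) − (1/|S|)·Σ_{s∈S} f(xs)) ≥ (1/(C·n³·(log n)^c))·Σ_{x∈G} f(x)². Equivalently, the spectral gap λ₀ − λ₁ of the normalized adjacency operator 𝒜f(x) = (1/|S|)Σ_{s∈S} f(xs) of the Cayley graph Γ(G,S) is at least 1/(C·n³·(log n)^c). -/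

import Mathlib

open Equiv Finset
open scoped Classical

/-- The finite generating set `S = {g, h, g⁻¹, h⁻¹}`. -/
noncomputable def genSet {n : ℕ} (g h : Perm (Fin n)) : Finset (Perm (Fin n)) :=
  {g, h, g⁻¹, h⁻¹}

/-- The subgroup `G = ⟨g, h⟩` as a finset. -/
noncomputable def grpFinset {n : ℕ} (g h : Perm (Fin n)) : Finset (Perm (Fin n)) :=
  Finset.univ.filter (· ∈ Subgroup.closure ({g, h} : Set (Perm (Fin n))))

section WordBall
variable {Γ : Type*} [Group Γ]

/-- Elements that are products of at most `L` elements of `S`. -/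
def wordBall (S : Finset Γ) (L : ℕ) : Set Γ :=
  {x | ∃ l : List Γ, l.length ≤ L ∧ (∀ s ∈ l, s ∈ S) ∧ l.prod = x}

lemma wordBall_mono {S : Finset Γ} {L M : ℕ} (h : L ≤ M) : wordBall S L ⊆ wordBall S M := by
  rintro x ⟨l, hl, hs, rfl⟩
  exact ⟨l, hl.trans h, hs, rfl⟩

lemma one_mem_wordBall (S : Finset Γ) (L : ℕ) : (1 : Γ) ∈ wordBall S L :=
  ⟨[], by simp, by simp, by simp⟩

lemma mem_wordBall_one {S : Finset Γ} {s : Γ} (hs : s ∈ S) : s ∈ wordBall S 1 :=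
  ⟨[s], by simp, by simpa using hs, by simp⟩

lemma mul_mem_wordBall {S : Finset Γ} {L M : ℕ} {x y : Γ} (hx : x ∈ wordBall S L)
    (hy : y ∈ wordBall S M) : x * y ∈ wordBall S (L + M) := by
  obtain ⟨l, hl, hs, rfl⟩ := hx
  obtain ⟨m, hm, ht, rfl⟩ := hy
  refine ⟨l ++ m, by simp; omega, ?_, by simp⟩
  intro s h
  rcases List.mem_append.1 h with h | h
  exacts [hs s h, ht s h]

lemma inv_mem_wordBall {S : Finset Γ} (hS : ∀ s ∈ S, s⁻¹ ∈ S) {L : ℕ} {x : Γ}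
    (hx : x ∈ wordBall S L) : x⁻¹ ∈ wordBall S L := by
  obtain ⟨l, hl, hs, rfl⟩ := hx
  refine ⟨(l.map (·⁻¹)).reverse, by simpa using hl, ?_, (List.prod_inv_reverse l).symm⟩
  intro s h
  simp only [List.mem_reverse, List.mem_map] at h
  obtain ⟨a, ha, rfl⟩ := h
  exact hS a (hs a ha)

lemma pow_mem_wordBall {S : Finset Γ} {L : ℕ} {x : Γ} (hx : x ∈ wordBall S L) (k : ℕ) :
    x ^ k ∈ wordBall S (k * L) := by
  induction k with
  | zero => simpa using one_mem_wordBall S 0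
  | succ k ih =>
    rw [pow_succ, Nat.succ_mul]
    exact mul_mem_wordBall ih hx

end WordBall

lemma genSet_inv_mem {n : ℕ} {g h : Perm (Fin n)} : ∀ s ∈ genSet g h, s⁻¹ ∈ genSet g h := by
  intro s hs
  simp only [genSet, Finset.mem_insert, Finset.mem_singleton] at hs ⊢
  rcases hs with rfl | rfl | rfl | rfl <;> simp

lemma genSet_subset_closure {n : ℕ} {g h s : Perm (Fin n)} (hs : s ∈ genSet g h) :
    s ∈ Subgroup.closure ({g, h} : Set (Perm (Fin n))) := by
  have hg : g ∈ Subgroup.closure ({g, h} : Set (Perm (Fin n))) :=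
    Subgroup.subset_closure (by simp)
  have hh : h ∈ Subgroup.closure ({g, h} : Set (Perm (Fin n))) :=
    Subgroup.subset_closure (by simp)
  simp only [genSet, Finset.mem_insert, Finset.mem_singleton] at hs
  rcases hs with rfl | rfl | rfl | rfl
  exacts [hg, hh, inv_mem hg, inv_mem hh]

lemma wordBall_subset_closure {n : ℕ} {g h x : Perm (Fin n)} {L : ℕ}
    (hx : x ∈ wordBall (genSet g h) L) :
    x ∈ Subgroup.closure ({g, h} : Set (Perm (Fin n))) := by
  obtain ⟨l, -, hs, rfl⟩ := hx
  exact list_prod_mem fun s h => genSet_subset_closure (hs s h)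

section Cost
variable {Γ : Type*} [Group Γ] [Fintype Γ]

/-- The squared displacement of `f` under right translation by `x`. -/
noncomputable def rightCost (f : Γ → ℝ) (x : Γ) : ℝ := ∑ y, (f (y * x) - f y) ^ 2

lemma rightCost_nonneg (f : Γ → ℝ) (x : Γ) : 0 ≤ rightCost f x :=
  Finset.sum_nonneg fun _ _ => sq_nonneg _

lemma rightCost_shift (f : Γ → ℝ) (x z : Γ) :
    ∑ y, (f (y * z * x) - f (y * z)) ^ 2 = rightCost f x :=
  Fintype.sum_equiv (Equiv.mulRight z) _ _ fun _ => rfl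

lemma rightCost_list_prod_le {S : Finset Γ} {f : Γ → ℝ} {E : ℝ}
    (hE : ∀ s ∈ S, rightCost f s ≤ E) (l : List Γ) (hl : ∀ s ∈ l, s ∈ S) :
    rightCost f l.prod ≤ (l.length : ℝ) ^ 2 * E := by
  induction l with
  | nil => simp [rightCost]
  | cons s l ih =>
    have h1 : rightCost f s ≤ E := hE s (hl s (by simp))
    have h2 := ih fun x hx => hl x (by simp [hx])
    rcases Nat.eq_zero_or_pos l.length with h0 | h0
    · obtain rfl := List.length_eq_zero_iff.1 h0
      simpa using h1
    have hm : (0 : ℝ) < l.length := by exact_mod_cast h0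
    set m : ℝ := (l.length : ℝ) with hmdef
    have key : rightCost f (s * l.prod) ≤ (1 + 1 / m) * rightCost f l.prod +
        (1 + m) * rightCost f s := by
      rw [← rightCost_shift f l.prod s]
      unfold rightCost
      rw [Finset.mul_sum, Finset.mul_sum, ← Finset.sum_add_distrib]
      refine Finset.sum_le_sum fun y _ => ?_
      rw [← mul_assoc]
      set a := f (y * s * l.prod) - f (y * s)
      set b := f (y * s) - f y
      have : f (y * s * l.prod) - f y = a + b := by simp only [a, b]; ring
      rw [this]
      have h3 : 0 ≤ (a - m * b) ^ 2 / m := by positivity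
      have h4 : (a - m * b) ^ 2 / m = a ^ 2 / m - 2 * a * b + m * b ^ 2 := by
        field_simp; ring
      have h5 : (1 + 1 / m) * a ^ 2 = a ^ 2 + a ^ 2 / m := by ring
      nlinarith
    rw [List.prod_cons, List.length_cons]
    push_cast
    rw [← hmdef]
    calc _ ≤ _ := key
      _ ≤ (1 + 1 / m) * (m ^ 2 * E) + (1 + m) * E := by gcongr
      _ = (m + 1) ^ 2 * E := by field_simp; ring

lemma rightCost_wordBall_le {S : Finset Γ} {f : Γ → ℝ} {E : ℝ} (hE0 : 0 ≤ E)
    (hE : ∀ s ∈ S, rightCost f s ≤ E) {L : ℕ} {x : Γ} (hx : x ∈ wordBall S L) :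
    rightCost f x ≤ (L : ℝ) ^ 2 * E := by
  obtain ⟨l, hl, hs, rfl⟩ := hx
  refine (rightCost_list_prod_le hE l hs).trans ?_
  gcongr

/-- The average of `f` over the right translates by elements of `H`. -/
noncomputable def rightAvg (H : Finset Γ) (f : Γ → ℝ) (x : Γ) : ℝ :=
  (∑ π ∈ H, f (x * π)) / (H.card : ℝ)

lemma sum_mul_rightAvg {H : Finset Γ} (hH : H.Nonempty) (f F : Γ → ℝ)
    (hF : ∀ x, ∀ π ∈ H, F (x * π) = F x) : ∑ x, rightAvg H f x * F x = ∑ x, f x * F x := by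
  have hc : (H.card : ℝ) ≠ 0 := by exact_mod_cast hH.card_pos.ne'
  have : ∀ π ∈ H, ∑ x, f (x * π) * F x = ∑ x, f x * F x := by
    intro π hπ
    refine Fintype.sum_equiv (Equiv.mulRight π) _ _ fun x => ?_
    simp [hF x π hπ]
  simp only [rightAvg, div_mul_eq_mul_div]
  rw [← Finset.sum_div, div_eq_iff hc]
  simp only [Finset.sum_mul]
  rw [Finset.sum_comm, Finset.sum_congr rfl this]
  rw [Finset.sum_const, nsmul_eq_mul, mul_comm, Finset.sum_mul]

lemma rightAvg_mul_of_mem (K : Subgroup Γ) (f : Γ → ℝ) (x π : Γ) (hπ : π ∈ K) :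
    rightAvg (univ.filter (· ∈ K)) f (x * π) = rightAvg (univ.filter (· ∈ K)) f x := by
  unfold rightAvg
  congr 1
  refine Finset.sum_equiv (Equiv.mulLeft π) ?_ ?_
  · intro i
    simp [K.mul_mem_cancel_left hπ]
  · intro i _
    simp [mul_assoc]

lemma rightAvg_step {H K : Subgroup Γ} (hHK : H ≤ K) (f : Γ → ℝ) {Λ : ℝ}
    {J : Type*} (A : Finset J) (t : J → Γ) (hA : A.Nonempty)
    (hsum : ∀ F : Γ → ℝ, ∑ π ∈ univ.filter (· ∈ K), F π =
      ∑ j ∈ A, ∑ π ∈ univ.filter (· ∈ H), F (π * t j))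
    (ht : ∀ j ∈ A, rightCost f (t j) ≤ Λ) :
    ∑ x, rightAvg (univ.filter (· ∈ H)) f x ^ 2 - ∑ x, rightAvg (univ.filter (· ∈ K)) f x ^ 2
      ≤ Λ := by
  set HF : Finset Γ := univ.filter (· ∈ H) with hHF
  set KF : Finset Γ := univ.filter (· ∈ K) with hKF
  have hHne : HF.Nonempty := ⟨1, by simp [hHF, H.one_mem]⟩
  have hKne : KF.Nonempty := ⟨1, by simp [hKF, K.one_mem]⟩
  have hHc : (0 : ℝ) < HF.card := by exact_mod_cast hHne.card_pos
  have hAc : (0 : ℝ) < A.card := by exact_mod_cast hA.card_pos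
  have e1 : ∑ x, rightAvg HF f x * rightAvg KF f x = ∑ x, f x * rightAvg KF f x :=
    sum_mul_rightAvg hHne f _ fun x π hπ => rightAvg_mul_of_mem K f x π (hHK (by simpa [hHF] using hπ))
  have e2 : ∑ x, rightAvg KF f x * rightAvg KF f x = ∑ x, f x * rightAvg KF f x :=
    sum_mul_rightAvg hKne f _ fun x π hπ => rightAvg_mul_of_mem K f x π (by simpa [hKF] using hπ)
  have e3 : ∑ x, rightAvg HF f x ^ 2 - ∑ x, rightAvg KF f x ^ 2 =
      ∑ x, (rightAvg KF f x - rightAvg HF f x) ^ 2 := by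
    have : ∀ x, (rightAvg KF f x - rightAvg HF f x) ^ 2 = rightAvg HF f x ^ 2 -
      2 * (rightAvg HF f x * rightAvg KF f x) + rightAvg KF f x * rightAvg KF f x := by
      intro x; ring
    simp only [this, Finset.sum_add_distrib, Finset.sum_sub_distrib, ← Finset.mul_sum]
    rw [e1]
    have : ∑ x, rightAvg KF f x ^ 2 = ∑ x, rightAvg KF f x * rightAvg KF f x := by
      simp only [sq]
    rw [this, e2]; ring
  have hcard : (KF.card : ℝ) = A.card * HF.card := by
    have := hsum fun _ => 1
    simpa using this
  have e4 : ∀ x, (rightAvg KF f x - rightAvg HF f x) ^ 2 ≤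
      (∑ j ∈ A, ∑ π ∈ HF, (f (x * π * t j) - f (x * π)) ^ 2) / (A.card * HF.card) := by
    intro x
    have : rightAvg KF f x - rightAvg HF f x =
        (∑ j ∈ A, ∑ π ∈ HF, (f (x * π * t j) - f (x * π))) / (A.card * HF.card) := by
      unfold rightAvg
      rw [hsum, hcard]
      simp only [Finset.sum_sub_distrib, ← mul_assoc, Finset.sum_const, nsmul_eq_mul]
      field_simp
    rw [this, div_pow, div_le_div_iff₀ (by positivity) (by positivity), ← Finset.sum_product',
      ← Finset.sum_product']
    have := sq_sum_le_card_mul_sum_sq (s := A ×ˢ HF)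
      (f := fun p => f (x * p.2 * t p.1) - f (x * p.2))
    rw [Finset.card_product] at this
    push_cast at this
    calc _ ≤ ((A.card : ℝ) * HF.card * ∑ p ∈ A ×ˢ HF, (f (x * p.2 * t p.1) - f (x * p.2)) ^ 2) *
          (A.card * HF.card) := by gcongr
      _ = _ := by ring
  rw [e3]
  refine (Finset.sum_le_sum fun x _ => e4 x).trans ?_
  rw [← Finset.sum_div, div_le_iff₀ (by positivity), Finset.sum_comm]
  have : ∀ j ∈ A, ∑ x, ∑ π ∈ HF, (f (x * π * t j) - f (x * π)) ^ 2 ≤ HF.card * Λ := by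
    intro j hj
    rw [Finset.sum_comm]
    simp only [rightCost_shift, Finset.sum_const, nsmul_eq_mul]
    gcongr
    exact ht j hj
  refine (Finset.sum_le_sum this).trans ?_
  simp only [Finset.sum_const, nsmul_eq_mul]
  apply le_of_eq; ring

end Cost

section AltChain
variable {n : ℕ}

/-- Even permutations fixing every point `i` with `k ≤ i`. -/
def altInit (n k : ℕ) : Subgroup (Perm (Fin n)) where
  carrier := {π | Perm.sign π = 1 ∧ ∀ i : Fin n, k ≤ i.val → π i = i}
  one_mem' := by simp
  mul_mem' := by
    rintro a b ⟨ha, ha'⟩ ⟨hb, hb'⟩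
    refine ⟨by simp [ha, hb], fun i hi => ?_⟩
    rw [Perm.mul_apply, hb' i hi, ha' i hi]
  inv_mem' := by
    rintro a ⟨ha, ha'⟩
    refine ⟨by simp [ha], fun i hi => ?_⟩
    rw [Perm.inv_eq_iff_eq, ha' i hi]

lemma mem_altInit {k : ℕ} {π : Perm (Fin n)} :
    π ∈ altInit n k ↔ Perm.sign π = 1 ∧ ∀ i : Fin n, k ≤ i.val → π i = i := Iff.rfl

lemma exists_threeCycle_apply_eq {a j : Fin n} (ha : 2 ≤ a.val) (hj : j.val ≤ a.val) :
    ∃ t : Perm (Fin n), t j = a ∧ t ∈ altInit n (a.val + 1) ∧ (t = 1 ∨ t.IsThreeCycle) := by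
  rcases eq_or_ne j a with rfl | hja
  · exact ⟨1, rfl, Subgroup.one_mem _, Or.inl rfl⟩
  have hn : a.val < n := a.isLt
  obtain ⟨r, hra, hrj⟩ : ∃ r : Fin n, r.val < a.val ∧ r ≠ j := by
    by_cases h0 : j.val = 0
    · refine ⟨⟨1, by omega⟩, by simp; omega, ?_⟩
      intro h; rw [← h] at h0; simp at h0
    · refine ⟨⟨0, by omega⟩, by simp; omega, ?_⟩
      intro h; rw [← h] at h0; simp at h0
  have hra' : r ≠ a := by rintro rfl; omega
  refine ⟨swap j r * swap j a, ?_, ⟨?_, ?_⟩, Or.inr ?_⟩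
  · rw [Perm.mul_apply, swap_apply_left, swap_apply_of_ne_of_ne hja.symm hra'.symm]
  · rw [Perm.sign_mul, Perm.sign_swap hrj.symm, Perm.sign_swap hja]; rfl
  · intro i hi
    have h1 : i ≠ j := by rintro rfl; omega
    have h2 : i ≠ r := by rintro rfl; omega
    have h3 : i ≠ a := by rintro rfl; omega
    rw [Perm.mul_apply, swap_apply_of_ne_of_ne h1 h3, swap_apply_of_ne_of_ne h1 h2]
  · exact Perm.isThreeCycle_swap_mul_swap_same hrj.symm hja hra'

lemma altInit_mono {k m : ℕ} (h : k ≤ m) : altInit n k ≤ altInit n m :=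
  fun _ hπ => ⟨hπ.1, fun i hi => hπ.2 i (h.trans hi)⟩

lemma altInit_two : altInit n 2 = ⊥ := by
  rw [eq_bot_iff]
  rintro π ⟨h1, h2⟩
  rw [Subgroup.mem_bot]
  have hsupp : π.support.card ≤ 2 := by
    have : π.support ⊆ univ.filter fun i : Fin n => i.val < 2 := by
      intro i hi
      rw [Perm.mem_support] at hi
      by_contra hc
      simp only [Finset.mem_filter, Finset.mem_univ, true_and, not_lt] at hc
      exact hi (h2 i hc)
    refine (Finset.card_le_card this).trans ?_
    have : (univ.filter fun i : Fin n => i.val < 2).card ≤ (Finset.range 2).card := by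
      refine Finset.card_le_card_of_injOn (fun i => i.val) ?_ ?_
      · intro i hi; simpa using hi
      · intro i _ j _ h; exact Fin.ext h
    simpa using this
  by_contra hne
  have h3 : π.support.card ≠ 0 := by simpa using hne
  have h4 : π.support.card ≠ 1 := Perm.card_support_ne_one π
  have h5 : π.support.card = 2 := by omega
  rw [Perm.card_support_eq_two] at h5
  rw [h5.sign_eq] at h1
  exact absurd h1 (by decide)

lemma altInit_step (f : Perm (Fin n) → ℝ) {Λ : ℝ} (hΛ : 0 ≤ Λ)
    (h3 : ∀ t : Perm (Fin n), t.IsThreeCycle → rightCost f t ≤ Λ) {k : ℕ} (hk : 2 ≤ k) (hkn : k < n) :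
    ∑ x, rightAvg (univ.filter (· ∈ altInit n k)) f x ^ 2 -
      ∑ x, rightAvg (univ.filter (· ∈ altInit n (k + 1))) f x ^ 2 ≤ Λ := by
  set a : Fin n := ⟨k, hkn⟩ with ha
  have hex : ∀ j : Fin n, ∃ t : Perm (Fin n), j.val ≤ k →
      t j = a ∧ t ∈ altInit n (k + 1) ∧ (t = 1 ∨ t.IsThreeCycle) := by
    intro j
    by_cases hj : j.val ≤ k
    · obtain ⟨t, ht⟩ := exists_threeCycle_apply_eq (a := a) (j := j) hk hj
      exact ⟨t, fun _ => ht⟩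
    · exact ⟨1, fun h => absurd h hj⟩
  choose t ht using hex
  refine rightAvg_step (altInit_mono (Nat.le_succ k)) f (univ.filter fun j : Fin n => j.val ≤ k) t
    ⟨a, by simp [ha]⟩ ?_ ?_
  · intro F
    rw [← Finset.sum_fiberwise_of_maps_to (g := fun π : Perm (Fin n) => π⁻¹ a)
      (t := univ.filter fun j : Fin n => j.val ≤ k)]
    · refine Finset.sum_congr rfl fun j hj => ?_
      have hj' : j.val ≤ k := by simpa using hj
      obtain ⟨hta, htm, -⟩ := ht j hj'
      refine Finset.sum_bij' (fun π _ => π * (t j)⁻¹) (fun π _ => π * t j) ?_ ?_ ?_ ?_ ?_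
      · intro π hπ
        simp only [Finset.mem_filter, Finset.mem_univ, true_and] at hπ ⊢
        have hm := (altInit n (k + 1)).mul_mem hπ.1 ((altInit n (k + 1)).inv_mem htm)
        refine ⟨hm.1, fun i hi => ?_⟩
        rcases hi.lt_or_eq with h | h
        · exact hm.2 i h
        · have : i = a := Fin.ext (by simp [ha, ← h])
          subst this
          have h1 : (t j)⁻¹ a = j := by rw [Perm.inv_eq_iff_eq, hta]
          rw [Perm.mul_apply, h1, ← hπ.2]
          exact π.apply_symm_apply a
      · intro π hπ
        simp only [Finset.mem_filter, Finset.mem_univ, true_and] at hπ ⊢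
        refine ⟨(altInit n (k + 1)).mul_mem (altInit_mono (Nat.le_succ k) hπ) htm, ?_⟩
        rw [Perm.inv_eq_iff_eq, Perm.mul_apply, hta, hπ.2 a le_rfl]
      · intro π _; simp
      · intro π _; simp
      · intro π _; simp
    · intro π hπ
      simp only [Finset.mem_filter, Finset.mem_univ, true_and] at hπ ⊢
      by_contra hc
      push Not at hc
      have h1 := hπ.2 (π⁻¹ a) hc
      rw [show π (π⁻¹ a) = a from π.apply_symm_apply a] at h1
      rw [← h1] at hc
      exact lt_irrefl _ hc
  · intro j hj
    obtain ⟨-, -, h | h⟩ := ht j (by simpa using hj)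
    · rw [h]; simpa [rightCost] using hΛ
    · exact h3 _ h

lemma sum_sq_sub_altAvg_le (f : Perm (Fin n) → ℝ) {Λ : ℝ} (hΛ : 0 ≤ Λ)
    (h3 : ∀ t : Perm (Fin n), t.IsThreeCycle → rightCost f t ≤ Λ) :
    ∑ x, f x ^ 2 - ∑ x, rightAvg (univ.filter (· ∈ alternatingGroup (Fin n))) f x ^ 2 ≤ n * Λ := by
  have hbot : ∀ x, rightAvg (univ.filter (· ∈ altInit n 2)) f x = f x := by
    intro x
    have : (univ.filter (· ∈ altInit n 2)) = ({1} : Finset (Perm (Fin n))) := by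
      ext y; simp [altInit_two]
    simp [rightAvg, this]
  have htop : ∀ k, n ≤ k → altInit n k = alternatingGroup (Fin n) := by
    intro k hk
    ext π
    rw [mem_altInit, Perm.mem_alternatingGroup]
    exact ⟨fun h => h.1, fun h => ⟨h, fun i hi => absurd i.isLt (by omega)⟩⟩
  have main : ∀ k, 2 ≤ k → k ≤ max n 2 → ∑ x, f x ^ 2 -
      ∑ x, rightAvg (univ.filter (· ∈ altInit n k)) f x ^ 2 ≤ (k - 2 : ℕ) * Λ := by
    intro k hk
    induction k, hk using Nat.le_induction with
    | base => intro _; simp [hbot]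
    | succ k hk ih =>
      intro hkn
      have h1 := ih (by omega)
      have h2 := altInit_step f hΛ h3 hk (by omega)
      have : ((k + 1 - 2 : ℕ) : ℝ) = ((k - 2 : ℕ) : ℝ) + 1 := by
        have : k + 1 - 2 = (k - 2) + 1 := by omega
        rw [this]; push_cast; ring
      rw [this]; linarith
  have h := main (max n 2) (le_max_right _ _) le_rfl
  rw [htop _ (le_max_left _ _)] at h
  refine h.trans ?_
  gcongr
  omega

end AltChain

lemma threeCycle_mem_closure {n L : ℕ} {g h : Perm (Fin n)}
    (h3 : ∀ t : Perm (Fin n), t.IsThreeCycle → t ∈ wordBall (genSet g h) L) :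
    alternatingGroup (Fin n) ≤ Subgroup.closure ({g, h} : Set (Perm (Fin n))) := by
  rw [← Perm.closure_three_cycles_eq_alternating, Subgroup.closure_le]
  intro t ht
  exact wordBall_subset_closure (h3 t ht)

lemma genSet_card_le {n : ℕ} (g h : Perm (Fin n)) : (genSet g h).card ≤ 4 := by
  unfold genSet
  exact Finset.card_le_four

/-- The Rayleigh quotient is controlled from below by the total displacement. -/
lemma sum_rightCost_eq {n : ℕ} (g h : Perm (Fin n)) (f : Perm (Fin n) → ℝ) :
    ∑ s ∈ genSet g h, rightCost (fun x => if x ∈ grpFinset g h then f x else 0) s =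
      2 * (genSet g h).card * ∑ x ∈ grpFinset g h,
        f x * (f x - (1 / ((genSet g h).card : ℝ)) * ∑ s ∈ genSet g h, f (x * s)) := by
  set G := grpFinset g h with hG
  set S := genSet g h with hS
  have hc : (S.card : ℝ) ≠ 0 := by
    have : g ∈ S := by simp [hS, genSet]
    exact_mod_cast (Finset.card_pos.2 ⟨g, this⟩).ne'
  set F : Perm (Fin n) → ℝ := fun x => if x ∈ G then f x else 0 with hF
  have hGs : ∀ x, ∀ s ∈ S, (x * s ∈ G ↔ x ∈ G) := by
    intro x s hs
    simp only [hG, grpFinset, Finset.mem_filter, Finset.mem_univ, true_and]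
    exact Subgroup.mul_mem_cancel_right _ (genSet_subset_closure hs)
  have h1 : ∀ s ∈ S, rightCost F s = 2 * ∑ x ∈ G, f x * (f x - f (x * s)) := by
    intro s hs
    have e1 : ∑ x, F (x * s) ^ 2 = ∑ x, F x ^ 2 :=
      Fintype.sum_equiv (Equiv.mulRight s) _ _ fun _ => rfl
    have e2 : rightCost F s = 2 * ∑ x, F x * (F x - F (x * s)) := by
      have : ∀ x, (F (x * s) - F x) ^ 2 = F (x * s) ^ 2 - F x ^ 2 +
        2 * (F x * (F x - F (x * s))) := by intro x; ring
      unfold rightCost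
      simp only [this, Finset.sum_add_distrib, Finset.sum_sub_distrib, ← Finset.mul_sum]
      rw [e1]; ring
    rw [e2]
    congr 1
    rw [← Finset.sum_filter_add_sum_filter_not univ (· ∈ G)]
    have : ∑ x ∈ univ.filter (fun x => x ∉ G), F x * (F x - F (x * s)) = 0 := by
      refine Finset.sum_eq_zero fun x hx => ?_
      have : x ∉ G := by simpa using hx
      simp [hF, this]
    rw [this, add_zero]
    refine Finset.sum_congr (by simp) fun x hx => ?_
    have hx' : x ∈ G := by simpa using hx
    simp [hF, hx', hGs x s hs]
  rw [Finset.sum_congr rfl h1, ← Finset.mul_sum, Finset.sum_comm, mul_assoc]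
  congr 1
  rw [Finset.mul_sum]
  refine Finset.sum_congr rfl fun x _ => ?_
  rw [← Finset.mul_sum, Finset.sum_sub_distrib]
  simp only [Finset.sum_const, nsmul_eq_mul]
  field_simp

lemma sq_altAvg_le {n : ℕ} {g h : Perm (Fin n)} (hA : alternatingGroup (Fin n) ≤
    Subgroup.closure ({g, h} : Set (Perm (Fin n)))) (F : Perm (Fin n) → ℝ)
    (hsupp : ∀ x, x ∉ grpFinset g h → F x = 0) (hsum : ∑ x, F x = 0) {E : ℝ} (hE0 : 0 ≤ E)
    (hE : ∀ s ∈ genSet g h, rightCost F s ≤ E) :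
    ∑ x, rightAvg (univ.filter (· ∈ alternatingGroup (Fin n))) F x ^ 2 ≤ E := by
  set A : Finset (Perm (Fin n)) := univ.filter (· ∈ alternatingGroup (Fin n)) with hAdef
  have hmemA : ∀ x, x ∈ A ↔ Perm.sign x = 1 := by
    intro x; simp [hAdef, Perm.mem_alternatingGroup]
  have hAne : A.Nonempty := ⟨1, by simp [hmemA]⟩
  have hAc : (0 : ℝ) < A.card := by exact_mod_cast hAne.card_pos
  set a := ∑ x ∈ A, F x with ha
  have hav1 : ∀ x, Perm.sign x = 1 → rightAvg A F x = a / A.card := by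
    intro x hx
    unfold rightAvg
    congr 1
    refine Finset.sum_equiv (Equiv.mulLeft x) ?_ ?_
    · intro i; simp [hmemA, hx]
    · intro i _; rfl
  have hb : ∑ x ∈ univ.filter (· ∉ A), F x = -a := by
    have := Finset.sum_filter_add_sum_filter_not univ (· ∈ A) F
    rw [hsum] at this
    simp only [Finset.filter_univ_mem] at this
    linarith
  have hav2 : ∀ x, Perm.sign x = -1 → rightAvg A F x = -a / A.card := by
    intro x hx
    unfold rightAvg
    rw [← hb]
    congr 1
    refine Finset.sum_equiv (Equiv.mulLeft x) ?_ ?_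
    · intro i
      rcases Int.units_eq_one_or (Perm.sign i) with h | h <;> simp [hmemA, hx, h]
    · intro i _; rfl
  have hsq : ∀ x, rightAvg A F x ^ 2 = a ^ 2 / (A.card : ℝ) ^ 2 := by
    intro x
    rcases Int.units_eq_one_or (Perm.sign x) with h | h
    · rw [hav1 x h, div_pow]
    · rw [hav2 x h, div_pow, neg_sq]
  by_cases hodd : ∃ s ∈ genSet g h, Perm.sign s = -1
  · obtain ⟨s, hs, hsgn⟩ := hodd
    have h1 : ∑ x ∈ A, F (x * s) = -a := by
      rw [← hb]
      refine Finset.sum_equiv (Equiv.mulRight s) ?_ ?_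
      · intro i
        rcases Int.units_eq_one_or (Perm.sign i) with h | h <;> simp [hmemA, hsgn, h]
      · intro i _; rfl
    have h2 : ∑ x ∈ A, (F (x * s) - F x) = -2 * a := by
      rw [Finset.sum_sub_distrib, h1]; ring
    have h3 : (-2 * a) ^ 2 ≤ A.card * ∑ x ∈ A, (F (x * s) - F x) ^ 2 := by
      rw [← h2]; exact sq_sum_le_card_mul_sum_sq
    have h4 : ∑ x ∈ A, (F (x * s) - F x) ^ 2 ≤ E :=
      (Finset.sum_le_sum_of_subset_of_nonneg (Finset.subset_univ A)
        fun _ _ _ => sq_nonneg _).trans (hE s hs)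
    have h6 : (univ.filter (· ∉ A)).card = A.card := by
      symm
      refine Finset.card_equiv (Equiv.mulRight s) ?_
      intro i
      rcases Int.units_eq_one_or (Perm.sign i) with h | h <;> simp [hmemA, hsgn, h]
    have h5 : ((univ : Finset (Perm (Fin n))).card : ℝ) = 2 * A.card := by
      have := Finset.card_filter_add_card_filter_not (s := (univ : Finset (Perm (Fin n)))) (· ∈ A)
      rw [h6, Finset.filter_univ_mem] at this
      rw [← this]; push_cast; ring
    simp only [hsq, Finset.sum_const, nsmul_eq_mul]
    rw [h5, show 2 * (A.card : ℝ) * (a ^ 2 / (A.card : ℝ) ^ 2) = 2 * a ^ 2 / A.card by field_simp,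
      div_le_iff₀ hAc]
    nlinarith [mul_le_mul_of_nonneg_left h4 hAc.le]
  · have hev : ∀ s ∈ genSet g h, Perm.sign s = 1 := by
      intro s hs
      rcases Int.units_eq_one_or (Perm.sign s) with h | h
      · exact h
      · exact absurd ⟨s, hs, h⟩ hodd
    have hle : Subgroup.closure ({g, h} : Set (Perm (Fin n))) ≤ alternatingGroup (Fin n) := by
      rw [Subgroup.closure_le]
      intro s hs
      refine Perm.mem_alternatingGroup.2 (hev s ?_)
      simp only [Set.mem_insert_iff, Set.mem_singleton_iff] at hs
      rcases hs with rfl | rfl <;> simp [genSet]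
    have ha0 : a = 0 := by
      rw [ha, ← hsum]
      refine Finset.sum_subset (Finset.subset_univ A) fun x _ hx => hsupp x ?_
      intro hxG
      simp only [grpFinset, Finset.mem_filter, Finset.mem_univ, true_and] at hxG
      exact hx (by simpa [hAdef] using hle hxG)
    simp [hsq, ha0, hE0]

/-- If all 3-cycles are short words, then the Poincaré inequality holds. -/
lemma poincare_of_threeCycles {n L : ℕ} {g h : Perm (Fin n)}
    (h3 : ∀ t : Perm (Fin n), t.IsThreeCycle → t ∈ wordBall (genSet g h) L)
    (f : Perm (Fin n) → ℝ) (hf : ∑ x ∈ grpFinset g h, f x = 0) :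
    ∑ x ∈ grpFinset g h, f x ^ 2 ≤ (8 * (n * (L : ℝ) ^ 2 + 1)) * ∑ x ∈ grpFinset g h,
      f x * (f x - (1 / ((genSet g h).card : ℝ)) * ∑ s ∈ genSet g h, f (x * s)) := by
  set F : Perm (Fin n) → ℝ := fun x => if x ∈ grpFinset g h then f x else 0 with hF
  set E := ∑ s ∈ genSet g h, rightCost F s with hE
  have hE0 : 0 ≤ E := Finset.sum_nonneg fun s _ => rightCost_nonneg _ _
  have hEs : ∀ s ∈ genSet g h, rightCost F s ≤ E := fun s hs =>
    Finset.single_le_sum (f := fun s => rightCost F s) (fun s _ => rightCost_nonneg _ _) hs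
  have hER := sum_rightCost_eq g h f
  rw [← hF, ← hE] at hER
  clear_value E
  set R := ∑ x ∈ grpFinset g h,
      f x * (f x - (1 / ((genSet g h).card : ℝ)) * ∑ s ∈ genSet g h, f (x * s)) with hR
  have hc4 : ((genSet g h).card : ℝ) ≤ 4 := by exact_mod_cast genSet_card_le g h
  have hcpos : (0 : ℝ) < (genSet g h).card := by
    exact_mod_cast Finset.card_pos.2 ⟨g, by simp [genSet]⟩
  have hR0 : 0 ≤ R := by
    by_contra hneg
    push Not at hneg
    nlinarith
  have hE8 : E ≤ 8 * R := by rw [hER]; nlinarith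
  have hsum : ∑ x, F x = 0 := by
    rw [← hf, hF]; simp
  have hsq : ∑ x, F x ^ 2 = ∑ x ∈ grpFinset g h, f x ^ 2 := by
    rw [hF]; simp [ite_pow]
  have h1 := sum_sq_sub_altAvg_le F (Λ := (L : ℝ) ^ 2 * E) (mul_nonneg (sq_nonneg _) hE0)
    fun t ht => rightCost_wordBall_le hE0 hEs (h3 t ht)
  have h2 := sq_altAvg_le (threeCycle_mem_closure h3) F (fun x hx => by simp [hF, hx]) hsum hE0 hEs
  rw [← hsq]
  have : ∑ x, F x ^ 2 ≤ (n * (L : ℝ) ^ 2 + 1) * E := by linarith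
  calc _ ≤ _ := this
    _ ≤ (n * (L : ℝ) ^ 2 + 1) * (8 * R) := by gcongr
    _ = _ := by ring

section Commutator
variable {α : Type*} [Fintype α] [DecidableEq α]

omit [Fintype α] [DecidableEq α] in
lemma commutator_ne_one {σ τ : Perm α} {a : α} (hτ : τ a ≠ a) (hστ : τ (σ a) = σ a) :
    σ⁻¹ * τ⁻¹ * σ * τ ≠ 1 := by
  intro h
  have h1 : σ * τ = τ * σ := by
    have : σ * τ = τ * σ * (σ⁻¹ * τ⁻¹ * σ * τ) := by group
    rw [this, h, mul_one]
  have h2 := congrArg (fun p : Perm α => p a) h1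
  simp only [Perm.mul_apply, hστ] at h2
  exact hτ (σ.injective h2)

lemma commutator_support_card_le (σ τ : Perm α) :
    (σ⁻¹ * τ⁻¹ * σ * τ).support.card ≤ 3 * (σ.support ∩ τ.support).card := by
  set W := σ.support ∩ τ.support with hW
  have hsub : (σ⁻¹ * τ⁻¹ * σ * τ).support ⊆
      W ∪ (W.map (σ⁻¹).toEmbedding ∪ W.map (τ⁻¹).toEmbedding) := by
    intro p hp
    by_contra hc
    simp only [Finset.mem_union, Finset.mem_map_equiv, not_or] at hc
    obtain ⟨h1, h2, h3⟩ := hc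
    have h2' : σ p ∉ W := h2
    have h3' : τ p ∉ W := h3
    rw [Perm.mem_support] at hp
    apply hp
    suffices h : σ (τ p) = τ (σ p) by
      simp only [Perm.mul_apply, h]
      rw [Perm.inv_eq_iff_eq, Perm.inv_eq_iff_eq]
    simp only [hW, Finset.mem_inter, Perm.mem_support, not_and_or, not_not] at h1 h2' h3'
    rcases h1 with h1 | h1
    · rw [h1]
      rcases h3' with h | h
      · exact h
      · rw [τ.injective h, h1]
    · rw [h1]
      rcases h2' with h | h
      · rw [σ.injective h, h1]
      · exact h.symm
  refine (Finset.card_le_card hsub).trans ?_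
  refine (Finset.card_union_le _ _).trans ?_
  have := Finset.card_union_le (W.map (σ⁻¹).toEmbedding) (W.map (τ⁻¹).toEmbedding)
  simp only [Finset.card_map] at this
  omega

lemma isThreeCycle_of_commutator {σ τ : Perm α} (hne : σ⁻¹ * τ⁻¹ * σ * τ ≠ 1)
    (hcard : (σ.support ∩ τ.support).card ≤ 1) : (σ⁻¹ * τ⁻¹ * σ * τ).IsThreeCycle := by
  have h1 := commutator_support_card_le σ τ
  have hs : Perm.sign (σ⁻¹ * τ⁻¹ * σ * τ) = 1 := by
    simp only [Perm.sign_mul, Perm.sign_inv]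
    rcases Int.units_eq_one_or (Perm.sign σ) with h | h <;>
      rcases Int.units_eq_one_or (Perm.sign τ) with h' | h' <;> simp [h, h']
  set γ := σ⁻¹ * τ⁻¹ * σ * τ
  have h3 : γ.support.card ≠ 0 := by simpa using hne
  have h4 : γ.support.card ≠ 1 := Perm.card_support_ne_one γ
  have h5 : γ.support.card ≠ 2 := by
    intro h
    rw [Perm.card_support_eq_two] at h
    rw [h.sign_eq] at hs
    exact absurd hs (by decide)
  rw [← card_support_eq_three_iff]
  omega

lemma IsThreeCycle.eq_of_apply_eq {t : Perm α} (ht : t.IsThreeCycle) {x y : α} (hxy : x ≠ y)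
    (h : t x = y) : t = swap x y * swap y (t y) := by
  have := (ht.eq_swap_mul_swap_iff_mem_support (a := x)).2 (by
    rw [Perm.mem_support, h]; exact hxy.symm)
  rwa [h] at this

omit [Fintype α] in
/-- Combine two three-cycles sharing a point into a prescribed three-cycle. -/
lemma swap_mul_swap_eq_commutator {x y z r s : α} (hxy : x ≠ y) (hyz : y ≠ z) (hxz : x ≠ z)
    (hrx : r ≠ x) (hry : r ≠ y) (hsx : s ≠ x) (hsz : s ≠ z) :
    let a := swap x y * swap y r
    let b := swap x z * swap z s
    swap x y * swap y z = a ∨ swap x y * swap y z = b⁻¹ ∨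
      swap x y * swap y z = b * a⁻¹ * b⁻¹ ∨ swap x y * swap y z = a * b * a⁻¹ * b⁻¹ := by
  intro a b
  by_cases h1 : r = z
  · left; simp [a, h1]
  by_cases h2 : s = y
  · right; left
    simp only [b, h2, mul_inv_rev, swap_inv]
    ext w
    simp only [Perm.mul_apply, swap_apply_def]
    grind
  by_cases h3 : r = s
  · right; right; left
    subst h3
    simp only [a, b, mul_inv_rev, swap_inv]
    ext w
    simp only [Perm.mul_apply, swap_apply_def]
    grind
  · right; right; right
    rw [← mul_left_inj b, ← mul_left_inj a]
    simp only [inv_mul_cancel_right]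
    simp only [a, b]
    ext w
    simp only [Perm.mul_apply, swap_apply_def]
    grind

end Commutator

section Mixing
variable {n : ℕ} {ι : Type*} [Fintype ι]

/-- The family `π` moves ordered pairs of distinct points almost uniformly. -/
def PairMixing (π : ι → Perm (Fin n)) : Prop :=
  ∀ a b c d : Fin n, a ≠ b → c ≠ d →
    |(∑ i, if π i a = c ∧ π i b = d then (1 : ℝ) else 0) - Fintype.card ι / (n * (n - 1))| ≤
      Fintype.card ι / (n * (n - 1)) / n

variable {π : ι → Perm (Fin n)}

lemma sum_point_bounds (hπ : PairMixing π) (hn : 2 ≤ n) (a c : Fin n) :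
    (Fintype.card ι : ℝ) / n * (1 - 1 / n) ≤ ∑ i, (if π i a = c then (1 : ℝ) else 0) ∧
    ∑ i, (if π i a = c then (1 : ℝ) else 0) ≤ (Fintype.card ι : ℝ) / n * (1 + 1 / n) := by
  obtain ⟨b, hb⟩ : ∃ b, b ≠ a := by
    have : Nontrivial (Fin n) := Fin.nontrivial_iff_two_le.2 hn
    exact exists_ne a
  have h1 : ∀ i, (if π i a = c then (1 : ℝ) else 0) =
      ∑ d ∈ univ.erase c, if π i a = c ∧ π i b = d then (1 : ℝ) else 0 := by
    intro i
    by_cases h : π i a = c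
    · have : π i b ∈ univ.erase c := by
        rw [Finset.mem_erase, ← h]
        exact ⟨fun h' => hb ((π i).injective h'), Finset.mem_univ _⟩
      simp only [h, true_and, if_true]
      rw [Finset.sum_ite_eq, if_pos this]
    · simp [h]
  have hn1 : (0 : ℝ) < n - 1 := by
    have : (2 : ℝ) ≤ n := by exact_mod_cast hn
    linarith
  have hn0 : (0 : ℝ) < n := by linarith
  have hcard : ((univ.erase c : Finset (Fin n)).card : ℝ) = n - 1 := by
    rw [Finset.card_erase_of_mem (Finset.mem_univ _), Finset.card_univ, Fintype.card_fin]
    push_cast [show 1 ≤ n by omega]; ring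
  rw [Finset.sum_congr rfl fun i _ => h1 i, Finset.sum_comm]
  have hb2 : ∀ d ∈ univ.erase c, |(∑ i, if π i a = c ∧ π i b = d then (1 : ℝ) else 0) -
      Fintype.card ι / (n * (n - 1))| ≤ Fintype.card ι / (n * (n - 1)) / n := fun d hd =>
    hπ a b c d hb.symm (Finset.ne_of_mem_erase hd).symm
  constructor
  · calc _ = ∑ d ∈ univ.erase c, ((Fintype.card ι : ℝ) / (n * (n - 1)) -
          Fintype.card ι / (n * (n - 1)) / n) := by
          rw [Finset.sum_const, nsmul_eq_mul, hcard]; field_simp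
      _ ≤ _ := Finset.sum_le_sum fun d hd => by linarith [(abs_le.1 (hb2 d hd)).1]
  · calc _ ≤ ∑ d ∈ univ.erase c, ((Fintype.card ι : ℝ) / (n * (n - 1)) +
          Fintype.card ι / (n * (n - 1)) / n) :=
          Finset.sum_le_sum fun d hd => by linarith [(abs_le.1 (hb2 d hd)).2]
      _ = _ := by rw [Finset.sum_const, nsmul_eq_mul, hcard]; field_simp

/-- The number of points of `X` mapped into `X`. -/
noncomputable def overlap (X : Finset (Fin n)) (u : Perm (Fin n)) : ℕ :=
  (X.filter fun b => u b ∈ X).card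

/-- The number of points of the support `X` of `σ` that lie in `u X` and leave it under `σ`. -/
noncomputable def leaving (σ u : Perm (Fin n)) : ℕ :=
  (σ.support.filter fun b => u b ∈ σ.support ∧ u⁻¹ (σ (u b)) ∉ σ.support).card

lemma leaving_le_overlap (σ u : Perm (Fin n)) : leaving σ u ≤ overlap σ.support u :=
  Finset.card_le_card fun b hb => by
    simp only [Finset.mem_filter] at hb ⊢
    exact ⟨hb.1, hb.2.1⟩

lemma sum_overlap_eq (X : Finset (Fin n)) (u : Perm (Fin n)) :
    (overlap X u : ℝ) = ∑ b ∈ X, ∑ a ∈ X, if u b = a then (1 : ℝ) else 0 := by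
  unfold overlap
  rw [Finset.card_filter]
  push_cast
  refine Finset.sum_congr rfl fun b _ => ?_
  rw [Finset.sum_ite_eq]

lemma sum_overlap_bounds (hπ : PairMixing π) (hn : 2 ≤ n) (X : Finset (Fin n)) :
    (Fintype.card ι : ℝ) * (X.card ^ 2 / n) * (1 - 1 / n) ≤ ∑ i, (overlap X (π i) : ℝ) ∧
    ∑ i, (overlap X (π i) : ℝ) ≤ (Fintype.card ι : ℝ) * (X.card ^ 2 / n) * (1 + 1 / n) := by
  have : ∑ i, (overlap X (π i) : ℝ) =
      ∑ b ∈ X, ∑ a ∈ X, ∑ i, if π i b = a then (1 : ℝ) else 0 := by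
    simp only [sum_overlap_eq]
    rw [Finset.sum_comm]
    exact Finset.sum_congr rfl fun b _ => Finset.sum_comm
  rw [this]
  constructor
  · calc _ = ∑ b ∈ X, ∑ a ∈ X, (Fintype.card ι : ℝ) / n * (1 - 1 / n) := by
          simp only [Finset.sum_const, nsmul_eq_mul]; ring
      _ ≤ _ := Finset.sum_le_sum fun b _ => Finset.sum_le_sum fun a _ =>
          (sum_point_bounds hπ hn b a).1
  · calc _ ≤ ∑ b ∈ X, ∑ a ∈ X, (Fintype.card ι : ℝ) / n * (1 + 1 / n) :=
          Finset.sum_le_sum fun b _ => Finset.sum_le_sum fun a _ => (sum_point_bounds hπ hn b a).2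
      _ = _ := by simp only [Finset.sum_const, nsmul_eq_mul]; ring

lemma pair_sum_le (hπ : PairMixing π) {a b c d : Fin n} (hab : a ≠ b) (hcd : c ≠ d) :
    (∑ i, if π i a = c ∧ π i b = d then (1 : ℝ) else 0) ≤
      Fintype.card ι / (n * (n - 1)) * (1 + 1 / n) := by
  have := (abs_le.1 (hπ a b c d hab hcd)).2
  calc _ ≤ (Fintype.card ι : ℝ) / (n * (n - 1)) + Fintype.card ι / (n * (n - 1)) / n := by linarith
    _ = _ := by ring

lemma overlap_factorial_le (X : Finset (Fin n)) (u : Perm (Fin n)) :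
    (overlap X u : ℝ) * (overlap X u - 1) ≤
      ∑ p ∈ X.offDiag, ∑ q ∈ X.offDiag, if u p.1 = q.1 ∧ u p.2 = q.2 then (1 : ℝ) else 0 := by
  set A := X.filter fun b => u b ∈ X with hA
  have h1 : (overlap X u : ℝ) * (overlap X u - 1) = (A.offDiag.card : ℝ) := by
    rw [Finset.offDiag_card]
    have : A.card ≤ A.card * A.card := Nat.le_mul_self _
    push_cast [this]
    simp only [overlap, ← hA]; ring
  have h2 : (A.offDiag.card : ℝ) = ∑ p ∈ A.offDiag, 1 := by simp
  rw [h1, h2]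
  have hsub : A.offDiag ⊆ X.offDiag := Finset.offDiag_mono (Finset.filter_subset _ _)
  refine (Finset.sum_le_sum (g := fun p => ∑ q ∈ X.offDiag,
    if u p.1 = q.1 ∧ u p.2 = q.2 then (1 : ℝ) else 0) ?_).trans
    (Finset.sum_le_sum_of_subset_of_nonneg hsub fun p _ _ =>
      Finset.sum_nonneg fun q _ => by split_ifs <;> norm_num)
  intro p hp
  rw [Finset.mem_offDiag] at hp
  simp only [hA, Finset.mem_filter] at hp
  have hq : (u p.1, u p.2) ∈ X.offDiag := by
    rw [Finset.mem_offDiag]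
    exact ⟨hp.1.2, hp.2.1.2, fun h => hp.2.2 (u.injective h)⟩
  refine le_trans ?_ (Finset.single_le_sum (f := fun q : Fin n × Fin n =>
    if u p.1 = q.1 ∧ u p.2 = q.2 then (1 : ℝ) else 0) (fun q _ => by split_ifs <;> norm_num) hq)
  simp

lemma offDiag_real_card (X : Finset (Fin n)) :
    (X.offDiag.card : ℝ) = X.card * (X.card - 1) := by
  rw [Finset.offDiag_card]
  push_cast [Nat.le_mul_self X.card]; ring

lemma sum_overlap_factorial_le (hπ : PairMixing π) (hn : 2 ≤ n) (X : Finset (Fin n)) :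
    ∑ i, (overlap X (π i) : ℝ) * (overlap X (π i) - 1) ≤
      (Fintype.card ι : ℝ) * (X.card ^ 2 / n) ^ 2 * (1 + 1 / n) := by
  have hn2 : (2 : ℝ) ≤ n := by exact_mod_cast hn
  have hn1 : (0 : ℝ) < n - 1 := by linarith
  have hXn : (X.card : ℝ) ≤ n := by
    have := Finset.card_le_univ X
    rw [Fintype.card_fin] at this
    exact_mod_cast this
  calc _ ≤ ∑ i, ∑ p ∈ X.offDiag, ∑ q ∈ X.offDiag,
        (if π i p.1 = q.1 ∧ π i p.2 = q.2 then (1 : ℝ) else 0) :=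
        Finset.sum_le_sum fun i _ => overlap_factorial_le X (π i)
    _ = ∑ p ∈ X.offDiag, ∑ q ∈ X.offDiag, ∑ i,
        (if π i p.1 = q.1 ∧ π i p.2 = q.2 then (1 : ℝ) else 0) := by
        rw [Finset.sum_comm]
        exact Finset.sum_congr rfl fun b _ => Finset.sum_comm
    _ ≤ ∑ p ∈ X.offDiag, ∑ q ∈ X.offDiag,
        (Fintype.card ι : ℝ) / (n * (n - 1)) * (1 + 1 / n) :=
        Finset.sum_le_sum fun p hp => Finset.sum_le_sum fun q hq =>
          pair_sum_le hπ (Finset.mem_offDiag.1 hp).2.2 (Finset.mem_offDiag.1 hq).2.2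
    _ = (Fintype.card ι : ℝ) * (1 + 1 / n) *
        ((X.card : ℝ) ^ 2 * (X.card - 1) ^ 2 / (n * (n - 1))) := by
        simp only [Finset.sum_const, nsmul_eq_mul, offDiag_real_card]; ring
    _ ≤ (Fintype.card ι : ℝ) * (1 + 1 / n) * ((X.card ^ 2 / n) ^ 2) := by
        gcongr
        rw [div_pow, div_le_div_iff₀ (by positivity) (by positivity)]
        rcases Nat.eq_zero_or_pos X.card with h0 | h0
        · simp [h0]
        have h1 : (1 : ℝ) ≤ X.card := by exact_mod_cast h0
        have h2 : ((X.card : ℝ) - 1) * n ≤ X.card * (n - 1) := by nlinarith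
        have h3 : ((X.card : ℝ) - 1) ≤ X.card := by linarith
        have h4 : ((X.card : ℝ) - 1) * (((X.card : ℝ) - 1) * n) ≤
          X.card * (X.card * (n - 1)) := by
          apply mul_le_mul h3 h2 <;> nlinarith
        have : (X.card : ℝ) ^ 2 * (X.card - 1) ^ 2 * n ^ 2 =
          (X.card : ℝ) ^ 2 * n * (((X.card : ℝ) - 1) * (((X.card : ℝ) - 1) * n)) := by ring
        rw [this]
        calc _ ≤ (X.card : ℝ) ^ 2 * n * (X.card * (X.card * (n - 1))) := by gcongr
          _ = _ := by ring
    _ = _ := by ring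

lemma overlap_sub_leaving_le (σ u : Perm (Fin n)) :
    (overlap σ.support u : ℝ) - leaving σ u ≤
      ∑ p ∈ σ.support.offDiag, ∑ a ∈ σ.support,
        if u p.1 = a ∧ u p.2 = σ a then (1 : ℝ) else 0 := by
  set X := σ.support with hX
  set A := X.filter fun b => u b ∈ X ∧ u⁻¹ (σ (u b)) ∈ X with hA
  have h1 : overlap X u = leaving σ u + A.card := by
    unfold overlap leaving
    rw [← Finset.card_filter_add_card_filter_not (fun b => u⁻¹ (σ (u b)) ∉ X),
      Finset.filter_filter, Finset.filter_filter]
    simp only [not_not, ← hX, hA]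
  rw [h1]; push_cast; rw [add_sub_cancel_left]
  have h2 : (A.card : ℝ) = ∑ b ∈ A, 1 := by simp
  rw [h2]
  set e : Fin n → Fin n × Fin n := fun b => (b, u⁻¹ (σ (u b)))
  have hinj : Set.InjOn e A := fun b _ b' _ h => (Prod.ext_iff.1 h).1
  have hmem : ∀ b ∈ A, e b ∈ X.offDiag := by
    intro b hb
    simp only [hA, Finset.mem_filter] at hb
    rw [Finset.mem_offDiag]
    refine ⟨hb.1, hb.2.2, fun h => ?_⟩
    have h3 : u b = σ (u b) := (Perm.eq_inv_iff_eq.1 h)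
    have h4 := hb.2.1
    rw [hX, Perm.mem_support] at h4
    exact h4 h3.symm
  calc ∑ b ∈ A, (1 : ℝ) ≤ ∑ b ∈ A, ∑ a ∈ X,
        (if u (e b).1 = a ∧ u (e b).2 = σ a then (1 : ℝ) else 0) := by
        refine Finset.sum_le_sum fun b hb => ?_
        simp only [hA, Finset.mem_filter] at hb
        refine le_trans ?_ (Finset.single_le_sum (f := fun a : Fin n =>
          if u (e b).1 = a ∧ u (e b).2 = σ a then (1 : ℝ) else 0)
          (fun q _ => by split_ifs <;> norm_num) hb.2.1)
        simp [e]
    _ = ∑ p ∈ A.image e, ∑ a ∈ X,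
        (if u p.1 = a ∧ u p.2 = σ a then (1 : ℝ) else 0) := by
        rw [Finset.sum_image hinj]
    _ ≤ _ := Finset.sum_le_sum_of_subset_of_nonneg
        (Finset.image_subset_iff.2 hmem) fun p _ _ =>
        Finset.sum_nonneg fun q _ => by split_ifs <;> norm_num

lemma sum_leaving_ge (hπ : PairMixing π) (hn : 5 ≤ n) (σ : Perm (Fin n))
    (hσ : 4 * σ.support.card ≤ n) :
    (Fintype.card ι : ℝ) * ((σ.support.card : ℝ) ^ 2 / n) / 2 ≤ ∑ i, (leaving σ (π i) : ℝ) := by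
  set X := σ.support with hX
  have hn5 : (5 : ℝ) ≤ n := by exact_mod_cast hn
  have hn1 : (0 : ℝ) < n - 1 := by linarith
  have hXn : 4 * (X.card : ℝ) ≤ n := by exact_mod_cast hσ
  have h1 : ∑ i, ((overlap X (π i) : ℝ) - leaving σ (π i)) ≤
      (Fintype.card ι : ℝ) * (X.card ^ 2 / n) * (1 / 4 * (1 + 1 / n)) := by
    calc _ ≤ ∑ i, ∑ p ∈ X.offDiag, ∑ a ∈ X,
        (if π i p.1 = a ∧ π i p.2 = σ a then (1 : ℝ) else 0) :=
        Finset.sum_le_sum fun i _ => overlap_sub_leaving_le σ (π i)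
      _ = ∑ p ∈ X.offDiag, ∑ a ∈ X, ∑ i,
        (if π i p.1 = a ∧ π i p.2 = σ a then (1 : ℝ) else 0) := by
        rw [Finset.sum_comm]
        exact Finset.sum_congr rfl fun b _ => Finset.sum_comm
      _ ≤ ∑ p ∈ X.offDiag, ∑ a ∈ X,
        (Fintype.card ι : ℝ) / (n * (n - 1)) * (1 + 1 / n) :=
        Finset.sum_le_sum fun p hp => Finset.sum_le_sum fun a ha =>
          pair_sum_le hπ (Finset.mem_offDiag.1 hp).2.2 (by
            rw [hX, Perm.mem_support] at ha; exact ha.symm)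
      _ = (Fintype.card ι : ℝ) * (X.card ^ 2 / n) * ((X.card - 1) / (n - 1) * (1 + 1 / n)) := by
        simp only [Finset.sum_const, nsmul_eq_mul, offDiag_real_card]; field_simp
      _ ≤ _ := by
        refine mul_le_mul_of_nonneg_left (mul_le_mul_of_nonneg_right ?_ (by positivity))
          (by positivity)
        rw [div_le_iff₀ hn1]; linarith
  have h2 := (sum_overlap_bounds hπ (by omega) X).1
  rw [Finset.sum_sub_distrib] at h1
  have h3 : (1 : ℝ) / n ≤ 1 / 5 := by gcongr
  have h4 : 0 ≤ (Fintype.card ι : ℝ) * (X.card ^ 2 / n) := by positivity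
  nlinarith

end Mixing

section Shrinking
variable {n : ℕ} {ι : Type*} [Fintype ι] {π : ι → Perm (Fin n)}

lemma support_conj_inter_card (σ u : Perm (Fin n)) :
    (σ.support ∩ (u * σ * u⁻¹).support).card = overlap σ.support u := by
  unfold overlap
  symm
  refine Finset.card_bij (fun b _ => u b) ?_ (fun b _ b' _ h => u.injective h) ?_
  · intro b hb
    rw [Finset.mem_filter] at hb
    rw [Finset.mem_inter]
    refine ⟨hb.2, ?_⟩
    rw [Perm.mem_support] at hb ⊢
    simpa using hb.1
  · intro a ha
    rw [Finset.mem_inter] at ha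
    refine ⟨u⁻¹ a, ?_, u.apply_symm_apply a⟩
    rw [Finset.mem_filter]
    have h2 := ha.2
    rw [Perm.mem_support, Perm.mul_apply, Perm.mul_apply] at h2
    refine ⟨?_, by rw [show u (u⁻¹ a) = a from u.apply_symm_apply a]; exact ha.1⟩
    rw [Perm.mem_support]
    intro h
    rw [h] at h2
    exact h2 (u.apply_symm_apply a)

lemma commutator_conj_ne_one {σ u : Perm (Fin n)} (h : 0 < leaving σ u) :
    σ⁻¹ * (u * σ * u⁻¹)⁻¹ * σ * (u * σ * u⁻¹) ≠ 1 := by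
  obtain ⟨b, hb⟩ := Finset.card_pos.1 h
  rw [Finset.mem_filter] at hb
  obtain ⟨h1, -, h3⟩ := hb
  refine commutator_ne_one (a := u b) ?_ ?_
  · rw [Perm.mem_support] at h1
    simpa using h1
  · rw [Perm.notMem_support] at h3
    rw [Perm.mul_apply, Perm.mul_apply, h3]
    exact u.apply_symm_apply _

lemma commutator_conj_mem_wordBall {S : Finset (Perm (Fin n))} (hS : ∀ s ∈ S, s⁻¹ ∈ S)
    {σ u : Perm (Fin n)} {ℓ D : ℕ} (hσ : σ ∈ wordBall S ℓ) (hu : u ∈ wordBall S D) :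
    σ⁻¹ * (u * σ * u⁻¹)⁻¹ * σ * (u * σ * u⁻¹) ∈ wordBall S (4 * ℓ + 4 * D) := by
  have hτ := mul_mem_wordBall (mul_mem_wordBall hu hσ) (inv_mem_wordBall hS hu)
  have := mul_mem_wordBall (mul_mem_wordBall (mul_mem_wordBall (inv_mem_wordBall hS hσ)
    (inv_mem_wordBall hS hτ)) hσ) hτ
  exact wordBall_mono (by omega) this

lemma card_pos_of_ne_one {σ : Perm (Fin n)} (h : σ ≠ 1) : 0 < σ.support.card := by
  rw [Finset.card_pos]
  by_contra hc
  rw [Finset.not_nonempty_iff_eq_empty, Perm.support_eq_empty_iff] at hc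
  exact h hc

lemma exists_leaving_overlap_le [Nonempty ι] (hπ : PairMixing π) (hn : 5 ≤ n) {σ : Perm (Fin n)}
    (hσ : 4 * σ.support.card ≤ n) (hσ1 : σ ≠ 1) :
    ∃ i, 0 < leaving σ (π i) ∧
      (overlap σ.support (π i) : ℝ) ≤ 7 / 6 * (σ.support.card ^ 2 / n) + 100 := by
  by_contra hcon
  push Not at hcon
  set X := σ.support with hX
  have hk0 : (0 : ℝ) < X.card := by exact_mod_cast card_pos_of_ne_one hσ1
  have hn5 : (5 : ℝ) ≤ n := by exact_mod_cast hn
  have hXn : 4 * (X.card : ℝ) ≤ n := by exact_mod_cast hσ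
  set μ : ℝ := (X.card : ℝ) ^ 2 / n with hμ
  have hμ0 : 0 < μ := by positivity
  set c : ℝ := (Fintype.card ι : ℝ) with hc
  have hc0 : 0 < c := by rw [hc]; exact_mod_cast Fintype.card_pos
  have hY := sum_leaving_ge hπ hn σ hσ
  rw [← hX, ← hμ, ← hc] at hY
  obtain ⟨hZ1, hZ2⟩ := sum_overlap_bounds hπ (by omega) X
  have hZZ := sum_overlap_factorial_le hπ (by omega) X
  rw [← hμ, ← hc] at hZ1 hZ2 hZZ
  have hμn : μ / n ≤ 1 / 16 := by
    rw [hμ, div_div, div_le_div_iff₀ (by positivity) (by norm_num)]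
    nlinarith
  have hvar : ∑ i, ((overlap X (π i) : ℝ) - μ) ^ 2 ≤ 2 * c * μ := by
    have : ∀ i, ((overlap X (π i) : ℝ) - μ) ^ 2 = (overlap X (π i) : ℝ) * (overlap X (π i) - 1) +
        (1 - 2 * μ) * overlap X (π i) + μ ^ 2 := by intro i; ring
    simp only [this, Finset.sum_add_distrib, ← Finset.mul_sum, Finset.sum_const, Finset.card_univ,
      nsmul_eq_mul, ← hc]
    have e1 : (1 : ℝ) / n ≤ 1 / 5 := by gcongr
    have e2 : c * μ * (1 + 1 / n) = c * μ + c * (μ / n) := by ring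
    have e3 : c * μ ^ 2 * (1 + 1 / n) = c * μ ^ 2 + c * μ * (μ / n) := by ring
    have e4 : c * μ * (1 - 1 / n) = c * μ - c * (μ / n) := by ring
    have e5 : c * (μ / n) = c * μ * (1 / n) := by ring
    rw [e2] at hZ2; rw [e3] at hZZ; rw [e4] at hZ1
    set Z := ∑ i, (overlap X (π i) : ℝ)
    have e6 : c * μ * (1 / n) ≤ c * μ * (1 / 5) := by gcongr
    have e7 : c * μ * (μ / n) ≤ c * μ * (1 / 16) := by gcongr
    have e8 : μ * (c * μ - c * (μ / n)) ≤ μ * Z := mul_le_mul_of_nonneg_left hZ1 hμ0.le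
    have e9 : μ * (c * (μ / n)) = c * μ * (μ / n) := by ring
    nlinarith
  set κ : ℝ := μ / 6 + 100 with hκ
  have hκ0 : 0 < κ := by positivity
  have hpt : ∀ i, (leaving σ (π i) : ℝ) ≤ (1 / 10) * ((overlap X (π i) : ℝ) - μ) ^ 2 := by
    intro i
    rcases Nat.eq_zero_or_pos (leaving σ (π i)) with h0 | h0
    · rw [h0]; push_cast; positivity
    have h1 := hcon i h0
    have h2 : (leaving σ (π i) : ℝ) ≤ overlap X (π i) := by
      exact_mod_cast leaving_le_overlap σ (π i)
    set d := (overlap X (π i) : ℝ) - μ with hd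
    have h3 : κ < d := by rw [hd, hκ]; linarith
    have h4 : (overlap X (π i) : ℝ) = μ + d := by rw [hd]; ring
    rw [h4] at h2
    have h5 : μ ≤ 6 * d := by linarith
    have h6 : 100 ≤ d := by linarith
    nlinarith
  have := Finset.sum_le_sum fun i (_ : i ∈ univ) => hpt i
  rw [← Finset.mul_sum] at this
  nlinarith [mul_pos hc0 hμ0]

lemma exists_leaving_overlap_one [Nonempty ι] (hπ : PairMixing π) (hn : 5 ≤ n) {σ : Perm (Fin n)}
    (hσ : 4 * σ.support.card ≤ n) (hσ2 : 4 * σ.support.card ^ 2 ≤ n) (hσ1 : σ ≠ 1) :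
    ∃ i, 0 < leaving σ (π i) ∧ overlap σ.support (π i) ≤ 1 := by
  by_contra hcon
  push Not at hcon
  set X := σ.support with hX
  have hk0 : (0 : ℝ) < X.card := by exact_mod_cast card_pos_of_ne_one hσ1
  have hn5 : (5 : ℝ) ≤ n := by exact_mod_cast hn
  have hXn : 4 * (X.card : ℝ) ^ 2 ≤ n := by exact_mod_cast hσ2
  set μ : ℝ := (X.card : ℝ) ^ 2 / n with hμ
  have hμ0 : 0 < μ := by positivity
  have hμ4 : μ ≤ 1 / 4 := by
    rw [hμ, div_le_div_iff₀ (by positivity) (by norm_num)]; linarith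
  set c : ℝ := (Fintype.card ι : ℝ) with hc
  have hc0 : 0 < c := by rw [hc]; exact_mod_cast Fintype.card_pos
  have hY := sum_leaving_ge hπ hn σ hσ
  have hZZ := sum_overlap_factorial_le hπ (by omega) X
  rw [← hX, ← hμ, ← hc] at hY
  rw [← hμ, ← hc] at hZZ
  have hpt : ∀ i, (leaving σ (π i) : ℝ) ≤ (overlap X (π i) : ℝ) * (overlap X (π i) - 1) := by
    intro i
    have h2 : (leaving σ (π i) : ℝ) ≤ overlap X (π i) := by
      exact_mod_cast leaving_le_overlap σ (π i)
    rcases Nat.eq_zero_or_pos (leaving σ (π i)) with h0 | h0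
    · rw [h0]; push_cast
      rcases Nat.eq_zero_or_pos (overlap X (π i)) with h1 | h1
      · rw [h1]; simp
      · have : (1 : ℝ) ≤ overlap X (π i) := by exact_mod_cast h1
        nlinarith
    have h1 := hcon i h0
    have : (2 : ℝ) ≤ overlap X (π i) := by exact_mod_cast h1
    nlinarith
  have h1 := Finset.sum_le_sum fun i (_ : i ∈ univ) => hpt i
  have e1 : (1 : ℝ) / n ≤ 1 / 5 := by gcongr
  have e2 : c * μ ^ 2 * (1 + 1 / n) ≤ c * μ ^ 2 * (1 + 1 / 5) := by gcongr
  have e3 : c * μ ^ 2 ≤ c * μ * (1 / 4) := by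
    rw [sq, ← mul_assoc]; gcongr
  nlinarith [mul_pos hc0 hμ0]

/-- One commutator step: the support shrinks quadratically. -/
lemma shrink_step [Nonempty ι] (hπ : PairMixing π) (hn : 5 ≤ n) {S : Finset (Perm (Fin n))}
    (hS : ∀ s ∈ S, s⁻¹ ∈ S) {D : ℕ} (hD : ∀ i, π i ∈ wordBall S D) {σ : Perm (Fin n)} {ℓ : ℕ}
    (hσℓ : σ ∈ wordBall S ℓ) (hσ : 4 * σ.support.card ≤ n) (hσ1 : σ ≠ 1) :
    ∃ σ' ∈ wordBall S (4 * ℓ + 4 * D), σ' ≠ 1 ∧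
      (σ'.support.card : ℝ) ≤ 7 / 2 * (σ.support.card ^ 2 / n) + 300 := by
  obtain ⟨i, h1, h2⟩ := exists_leaving_overlap_le hπ hn hσ hσ1
  refine ⟨_, commutator_conj_mem_wordBall hS hσℓ (hD i), commutator_conj_ne_one h1, ?_⟩
  have h3 := commutator_support_card_le σ (π i * σ * (π i)⁻¹)
  rw [support_conj_inter_card] at h3
  have h4 : ((σ⁻¹ * (π i * σ * (π i)⁻¹)⁻¹ * σ * (π i * σ * (π i)⁻¹)).support.card : ℝ) ≤
    3 * overlap σ.support (π i) := by exact_mod_cast h3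
  linarith

lemma shrink_iterate [Nonempty ι] (hπ : PairMixing π) (hn : 19200 ≤ n) {S : Finset (Perm (Fin n))}
    (hS : ∀ s ∈ S, s⁻¹ ∈ S) {D : ℕ} (hD : ∀ i, π i ∈ wordBall S D) {σ : Perm (Fin n)} {ℓ : ℕ}
    (hσℓ : σ ∈ wordBall S ℓ) (hσ : 4 * σ.support.card ≤ n) (hσ1 : σ ≠ 1) (j : ℕ) :
    ∃ σ' : Perm (Fin n), ∃ m, σ' ∈ wordBall S m ∧ m + 2 * D ≤ 4 ^ (j + 1) * (ℓ + 2 * D) ∧ σ' ≠ 1 ∧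
      4 * (σ'.support.card : ℝ) / n ≤ max ((15 / 16 : ℝ) ^ 2 ^ j) (√(9600 / n)) := by
  have hn' : (19200 : ℝ) ≤ n := by exact_mod_cast hn
  have hn0 : (0 : ℝ) < n := by linarith
  set M := √(9600 / n) with hM
  have hM2 : M ^ 2 = 9600 / n := Real.sq_sqrt (by positivity)
  have hM0 : 0 ≤ M := Real.sqrt_nonneg _
  have hM1 : M ^ 2 ≤ 1 / 2 := by rw [hM2, div_le_iff₀ hn0]; linarith
  have hM1' : M ≤ 1 := by nlinarith
  have conv : ∀ k k' : ℝ, k' ≤ 7 / 2 * (k ^ 2 / n) + 300 →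
      4 * k' / n ≤ 7 / 8 * (4 * k / n) ^ 2 + 1 / 8 * M ^ 2 := by
    intro k k' h
    rw [hM2]
    have : 7 / 8 * (4 * k / n) ^ 2 + 1 / 8 * (9600 / n) = 4 * (7 / 2 * (k ^ 2 / n) + 300) / n := by
      field_simp; ring
    rw [this]; gcongr
  induction j with
  | zero =>
    obtain ⟨σ', h1, h2, h3⟩ := shrink_step hπ (by omega) hS hD hσℓ hσ hσ1
    refine ⟨σ', _, h1, by simp; omega, h2, ?_⟩
    refine (conv _ _ h3).trans (le_max_of_le_left ?_)
    have hk : 4 * (σ.support.card : ℝ) / n ≤ 1 := by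
      rw [div_le_one hn0]; exact_mod_cast hσ
    have hk0 : 0 ≤ 4 * (σ.support.card : ℝ) / n := by positivity
    norm_num
    nlinarith
  | succ j ih =>
    obtain ⟨σ', m, h1, h2, h3, h4⟩ := ih
    set β := (15 / 16 : ℝ) ^ 2 ^ j with hβ
    have hβ0 : 0 ≤ β := by positivity
    have hβ1 : β ≤ 1 := pow_le_one₀ (by norm_num) (by norm_num)
    have hmax1 : max β M ≤ 1 := max_le hβ1 hM1'
    have h5 : 4 * σ'.support.card ≤ n := by
      have := h4.trans hmax1
      rw [div_le_one hn0] at this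
      exact_mod_cast this
    obtain ⟨σ'', g1, g2, g3⟩ := shrink_step hπ (by omega) hS hD h1 h5 h3
    refine ⟨σ'', _, g1, ?_, g2, ?_⟩
    · rw [pow_succ]; nlinarith
    · refine (conv _ _ g3).trans ?_
      have hk0 : 0 ≤ 4 * (σ'.support.card : ℝ) / n := by positivity
      rw [show (15 / 16 : ℝ) ^ 2 ^ (j + 1) = β ^ 2 by rw [pow_succ, pow_mul]]
      have e1 : (4 * (σ'.support.card : ℝ) / n) ^ 2 ≤ (max β M) ^ 2 := by gcongr
      rcases le_total β M with h | h
      · rw [max_eq_right h] at e1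
        exact le_max_of_le_right (by nlinarith)
      · rw [max_eq_left h] at e1
        exact le_max_of_le_left (by nlinarith)

lemma exists_threeCycle_mem_wordBall [Nonempty ι] (hπ : PairMixing π) (hn : 23040000 ≤ n)
    {S : Finset (Perm (Fin n))} (hS : ∀ s ∈ S, s⁻¹ ∈ S) {D : ℕ} (hD : ∀ i, π i ∈ wordBall S D)
    {σ : Perm (Fin n)} {ℓ J : ℕ} (hσℓ : σ ∈ wordBall S ℓ) (hσ : 4 * σ.support.card ≤ n)
    (hσ1 : σ ≠ 1) (hJ : (15 / 16 : ℝ) ^ 2 ^ J ≤ 1 / n) :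
    ∃ t ∈ wordBall S (4 ^ (J + 3) * (ℓ + 2 * D)), t.IsThreeCycle := by
  have hn' : (23040000 : ℝ) ≤ n := by exact_mod_cast hn
  have hn0 : (0 : ℝ) < n := by linarith
  obtain ⟨σ', m, h1, h2, h3, h4⟩ := shrink_iterate hπ (by omega) hS hD hσℓ hσ hσ1 J
  have h5 : 4 * (σ'.support.card : ℝ) / n ≤ √(9600 / n) := by
    refine h4.trans (max_le (hJ.trans ?_) le_rfl)
    refine Real.le_sqrt_of_sq_le ?_
    rw [div_pow, one_pow, div_le_div_iff₀ (by positivity) hn0]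
    nlinarith
  have hk0 : 0 ≤ 4 * (σ'.support.card : ℝ) / n := by positivity
  have h6 : (4 * (σ'.support.card : ℝ) / n) ^ 2 ≤ 9600 / n := by
    calc _ ≤ √(9600 / n) ^ 2 := by gcongr
      _ = _ := Real.sq_sqrt (by positivity)
  have h7 : (σ'.support.card : ℝ) ^ 2 / n ≤ 600 := by
    have : (4 * (σ'.support.card : ℝ) / n) ^ 2 = 16 * ((σ'.support.card : ℝ) ^ 2 / n) / n := by
      field_simp; ring
    rw [this] at h6
    have := (div_le_div_iff_of_pos_right hn0).1 h6
    linarith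
  have h8 : 4 * σ'.support.card ≤ n := by
    rw [div_le_iff₀ hn0] at h7
    have : 4 * (σ'.support.card : ℝ) ≤ n := by
      by_contra hc
      push Not at hc
      nlinarith
    exact_mod_cast this
  obtain ⟨σ2, g1, g2, g3⟩ := shrink_step hπ (by omega) hS hD h1 h8 h3
  have g4 : (σ2.support.card : ℝ) ≤ 2400 := by linarith
  have g5 : σ2.support.card ≤ 2400 := by exact_mod_cast g4
  obtain ⟨i, k1, k2⟩ := exists_leaving_overlap_one hπ (by omega) (σ := σ2) (by omega)
    (by nlinarith) g2
  refine ⟨_, ?_, isThreeCycle_of_commutator (commutator_conj_ne_one k1) ?_⟩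
  · refine wordBall_mono ?_ (commutator_conj_mem_wordBall hS g1 (hD i))
    rw [show J + 3 = (J + 1) + 2 by ring, pow_add]
    nlinarith
  · rw [support_conj_inter_card]; exact k2

lemma exists_pair_map [Nonempty ι] (hπ : PairMixing π) (hn : 2 ≤ n) {a b c d : Fin n}
    (hab : a ≠ b) (hcd : c ≠ d) : ∃ i, π i a = c ∧ π i b = d := by
  by_contra hcon
  have h1 := hπ a b c d hab hcd
  rw [Finset.sum_eq_zero fun i _ => if_neg fun h => hcon ⟨i, h⟩] at h1
  have hn' : (2 : ℝ) ≤ n := by exact_mod_cast hn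
  have hn1 : (0 : ℝ) < n - 1 := by linarith
  have hpos : 0 < (Fintype.card ι : ℝ) / (n * (n - 1)) := by
    have : (0 : ℝ) < Fintype.card ι := by exact_mod_cast Fintype.card_pos
    positivity
  rw [zero_sub, abs_neg, abs_of_pos hpos, le_div_iff₀ (by linarith)] at h1
  nlinarith

/-- Mixing on pairs together with one short element of small support makes every
three-cycle a short word. -/
lemma threeCycle_mem_wordBall_of_mixing [Nonempty ι] (hπ : PairMixing π) (hn : 23040000 ≤ n)
    {S : Finset (Perm (Fin n))} (hS : ∀ s ∈ S, s⁻¹ ∈ S) {D : ℕ} (hD : ∀ i, π i ∈ wordBall S D)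
    {σ : Perm (Fin n)} {ℓ J : ℕ} (hσℓ : σ ∈ wordBall S ℓ) (hσ : 4 * σ.support.card ≤ n)
    (hσ1 : σ ≠ 1) (hJ : (15 / 16 : ℝ) ^ 2 ^ J ≤ 1 / n) (t : Perm (Fin n)) (ht : t.IsThreeCycle) :
    t ∈ wordBall S (4 * (4 ^ (J + 3) * (ℓ + 2 * D) + 2 * D)) := by
  obtain ⟨t0, ht0, ht0c⟩ := exists_threeCycle_mem_wordBall hπ hn hS hD hσℓ hσ hσ1 hJ
  set L := 4 ^ (J + 3) * (ℓ + 2 * D) + 2 * D with hL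
  have key : ∀ x y : Fin n, x ≠ y → ∃ r, r ≠ x ∧ r ≠ y ∧ swap x y * swap y r ∈ wordBall S L := by
    intro x y hxy
    obtain ⟨p, hp⟩ : ∃ p, t0 p ≠ p := by
      by_contra hc
      push Not at hc
      exact ht0c.ne_one (Perm.ext hc)
    obtain ⟨i, h1, h2⟩ := exists_pair_map hπ (by omega) hp.symm hxy
    set q := π i * t0 * (π i)⁻¹ with hq
    have hqx : q x = y := by
      rw [← h1, ← h2]
      simp [hq]
    have hqc : q.IsThreeCycle := by
      rw [← card_support_eq_three_iff, hq, Perm.card_support_conj]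
      exact ht0c.card_support
    have hqe := IsThreeCycle.eq_of_apply_eq hqc hxy hqx
    have hqy : q y ≠ y := fun h => hxy (q.injective (hqx.trans h.symm))
    have hqxy : q y ≠ x := by
      intro h
      rw [h, swap_comm y x, swap_mul_self] at hqe
      exact hqc.ne_one hqe
    refine ⟨q y, hqxy, hqy, ?_⟩
    rw [← hqe, hq]
    exact wordBall_mono (by omega)
      (mul_mem_wordBall (mul_mem_wordBall (hD i) ht0) (inv_mem_wordBall hS (hD i)))
  obtain ⟨x, hx⟩ : ∃ x, t x ≠ x := by
    by_contra hc
    push Not at hc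
    exact ht.ne_one (Perm.ext hc)
  set y := t x with hy
  have hte := IsThreeCycle.eq_of_apply_eq ht hx.symm hy.symm
  have hyz : y ≠ t y := fun h => hx (t.injective h).symm
  have hxz : x ≠ t y := by
    intro h
    rw [← h, swap_comm y x, swap_mul_self] at hte
    exact ht.ne_one hte
  obtain ⟨r, hrx, hry, ha⟩ := key x y hx.symm
  obtain ⟨s, hsx, hsz, hb⟩ := key x (t y) hxz
  rw [hte]
  have ha' := inv_mem_wordBall hS ha
  have hb' := inv_mem_wordBall hS hb
  rcases swap_mul_swap_eq_commutator hx.symm hyz hxz hrx hry hsx hsz with h | h | h | h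
  · rw [h]; exact wordBall_mono (by omega) ha
  · rw [h]; exact wordBall_mono (by omega) hb'
  · rw [h]; exact wordBall_mono (by omega) (mul_mem_wordBall (mul_mem_wordBall hb ha') hb')
  · rw [h]
    exact wordBall_mono (by omega)
      (mul_mem_wordBall (mul_mem_wordBall (mul_mem_wordBall ha hb) ha') hb')

end Shrinking

section Exposure
variable {κ α : Type*}

/-- An adaptive strategy querying values of a tuple of permutations; each query carries a
target set. -/
inductive QueryTree (κ α : Type*) where
  | leaf : QueryTree κ α
  | node (s : κ) (a : α) (V : Finset α) (next : α → QueryTree κ α) : QueryTree κ α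

namespace QueryTree

variable [DecidableEq α] [DecidableEq κ]

/-- The number of new queries whose answer lies in the target. -/
noncomputable def hits : QueryTree κ α → Finset (κ × α) → (κ → Perm α) → ℕ
  | leaf, _, _ => 0
  | node s a V next, Q, ω =>
    (if (s, a) ∉ Q ∧ ω s a ∈ V then 1 else 0) + hits (next (ω s a)) (insert (s, a) Q) ω

/-- The list `l` bounds the sizes of the target sets along every branch. -/
def Fits : QueryTree κ α → List ℕ → Prop
  | leaf, l => l = []
  | node _ _ V next, l => ∃ v l', l = v :: l' ∧ V.card ≤ v ∧ ∀ b, Fits (next b) l'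

end QueryTree

/-- Elementary symmetric functions of a list of natural numbers. -/
def listEsymm : ℕ → List ℕ → ℕ
  | 0, _ => 1
  | _ + 1, [] => 0
  | c + 1, v :: l => v * listEsymm c l + listEsymm (c + 1) l

lemma listEsymm_le {M : ℕ} (c : ℕ) (l : List ℕ) (h : ∀ v ∈ l, v ≤ M) :
    listEsymm c l ≤ (l.length * M) ^ c := by
  induction l generalizing c with
  | nil => cases c <;> simp [listEsymm]
  | cons v l ih =>
    cases c with
    | zero => simp [listEsymm]
    | succ c =>
      have h1 := ih c fun v hv => h v (by simp [hv])
      have h2 := ih (c + 1) fun v hv => h v (by simp [hv])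
      have h3 := h v (by simp)
      simp only [listEsymm, List.length_cons]
      calc _ ≤ M * (l.length * M) ^ c + (l.length * M) ^ (c + 1) := by gcongr
        _ = (l.length * M) ^ c * ((l.length + 1) * M) := by ring
        _ ≤ ((l.length + 1) * M) ^ c * ((l.length + 1) * M) := by gcongr; omega
        _ = _ := (pow_succ _ _).symm

lemma listEsymm_append_zero (c k : ℕ) (l : List ℕ) :
    listEsymm c (List.replicate k 0 ++ l) = listEsymm c l := by
  induction k with
  | zero => simp
  | succ k ih =>
    rw [List.replicate_succ, List.cons_append]
    cases c with
    | zero => simp [listEsymm]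
    | succ c => simp [listEsymm, ih]

variable [Fintype α] [DecidableEq α] [Fintype κ] [DecidableEq κ]

/-- Tuples of permutations agreeing with `ω₀` on the queries in `Q`. -/
noncomputable def cylinder (ω₀ : κ → Perm α) (Q : Finset (κ × α)) : Finset (κ → Perm α) :=
  univ.filter fun ω => ∀ q ∈ Q, ω q.1 q.2 = ω₀ q.1 q.2

lemma cylinder_empty (ω₀ : κ → Perm α) : cylinder ω₀ ∅ = univ := by
  simp [cylinder]

lemma cylinder_fiber_card_le (ω₀ : κ → Perm α) (Q : Finset (κ × α)) {s : κ} {a : α}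
    (hsa : (s, a) ∉ Q) (b : α) :
    ((cylinder ω₀ Q).filter fun ω => ω s a = b).card * (Fintype.card α - Q.card) ≤
      (cylinder ω₀ Q).card := by
  set C : α → Finset (κ → Perm α) := fun b => (cylinder ω₀ Q).filter fun ω => ω s a = b with hC
  set used : Finset α := (Q.filter fun q => q.1 = s).image fun q => ω₀ q.1 q.2 with hused
  have hempty : ∀ b ∈ used, C b = ∅ := by
    intro b hb
    rw [Finset.eq_empty_iff_forall_notMem]
    intro ω hω
    simp only [hC, Finset.mem_filter, cylinder, Finset.mem_univ, true_and] at hω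
    simp only [hused, Finset.mem_image, Finset.mem_filter] at hb
    obtain ⟨⟨s', a'⟩, ⟨hq, hs⟩, hb⟩ := hb
    simp only at hs hb
    subst hs
    have h1 := hω.1 _ hq
    simp only at h1
    rw [hb, ← hω.2] at h1
    have h2 := (ω s').injective h1
    rw [h2] at hq
    exact hsa hq
  by_cases hb : b ∈ used
  · have := hempty b hb
    simp only [hC] at this
    rw [this]; simp
  have hle : ∀ b' ∈ univ \ used, (C b).card ≤ (C b').card := by
    intro b' hb'
    have hb'' : b' ∉ used := (Finset.mem_sdiff.1 hb').2
    refine Finset.card_le_card_of_injOn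
      (fun ω => Function.update ω s (swap b b' * ω s)) ?_ ?_
    · intro ω hω
      simp only [hC, Finset.coe_filter, cylinder, Finset.mem_filter, Finset.mem_univ, true_and,
        Set.mem_ofPred_eq] at hω ⊢
      refine ⟨?_, by simp [hω.2]⟩
      rintro ⟨s', a'⟩ hq
      have h1 := hω.1 _ hq
      simp only at h1 ⊢
      by_cases hs : s' = s
      · subst hs
        rw [Function.update_self, Perm.mul_apply, h1]
        have hmem : ω₀ s' a' ∈ used := by
          simp only [hused, Finset.mem_image, Finset.mem_filter]
          exact ⟨(s', a'), ⟨hq, rfl⟩, rfl⟩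
        rw [swap_apply_of_ne_of_ne]
        · rintro rfl; exact hb hmem
        · rintro rfl; exact hb'' hmem
      · rw [Function.update_of_ne hs, h1]
    · intro ω _ ω' _ h
      have h0 := congrArg (fun f : κ → Perm α => f s) h
      simp only [Function.update_self, mul_right_inj] at h0
      funext s'
      by_cases hs : s' = s
      · rw [hs, h0]
      · have := congrArg (fun f : κ → Perm α => f s') h
        simpa [Function.update_of_ne hs] using this
  have hsum : ∑ b' ∈ univ \ used, (C b').card ≤ (cylinder ω₀ Q).card := by
    rw [← Finset.card_biUnion]
    · exact Finset.card_le_card (Finset.biUnion_subset.2 fun b' _ => Finset.filter_subset _ _)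
    · intro b1 _ b2 _ hne
      rw [Function.onFun, Finset.disjoint_left]
      intro ω h1 h2
      simp only [hC, Finset.mem_filter] at h1 h2
      exact hne (h1.2.symm.trans h2.2)
  have hcard : Fintype.card α - Q.card ≤ (univ \ used).card := by
    rw [Finset.card_sdiff_of_subset (Finset.subset_univ _), Finset.card_univ]
    have : used.card ≤ Q.card := Finset.card_image_le.trans (Finset.card_filter_le _ _)
    omega
  calc (C b).card * (Fintype.card α - Q.card) ≤ (C b).card * (univ \ used).card := by gcongr
    _ = ∑ b' ∈ univ \ used, (C b).card := by rw [Finset.sum_const, smul_eq_mul, mul_comm]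
    _ ≤ ∑ b' ∈ univ \ used, (C b').card := Finset.sum_le_sum hle
    _ ≤ _ := hsum

/-- Many hits are unlikely. -/
lemma card_hits_le (T : QueryTree κ α) (l : List ℕ) (hT : T.Fits l) (K : ℕ) (Q : Finset (κ × α))
    (hK : Q.card + l.length ≤ K) (ω₀ : κ → Perm α) (c : ℕ) :
    ((cylinder ω₀ Q).filter fun ω => c ≤ T.hits Q ω).card * (Fintype.card α - K) ^ c ≤
      listEsymm c l * (cylinder ω₀ Q).card := by
  induction T generalizing l Q ω₀ c with
  | leaf =>
    cases c with
    | zero => simp [listEsymm]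
    | succ c => simp [QueryTree.hits]
  | node s a V next ih =>
    obtain ⟨v, l', rfl, hv, hnext⟩ := hT
    cases c with
    | zero => simp [listEsymm]
    | succ c =>
    rw [List.length_cons] at hK
    have hfe : ((cylinder ω₀ Q).filter fun ω => c + 1 ≤ (QueryTree.node s a V next).hits Q ω) =
        (cylinder ω₀ Q).filter fun ω => c + 1 ≤ (if (s, a) ∉ Q ∧ ω s a ∈ V then 1 else 0) +
          (next (ω s a)).hits (insert (s, a) Q) ω :=
      Finset.filter_congr fun ω _ => by rw [QueryTree.hits]
    rw [hfe]
    simp only [listEsymm]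
    by_cases hsa : (s, a) ∈ Q
    · have h1 := ih (ω₀ s a) l' (hnext _) Q (by omega) ω₀ (c + 1)
      have h2 : ((cylinder ω₀ Q).filter fun ω => c + 1 ≤
          (if (s, a) ∉ Q ∧ ω s a ∈ V then 1 else 0) +
            (next (ω s a)).hits (insert (s, a) Q) ω) =
          (cylinder ω₀ Q).filter fun ω => c + 1 ≤ (next (ω₀ s a)).hits Q ω := by
        refine Finset.filter_congr fun ω hω => ?_
        simp only [cylinder, Finset.mem_filter, Finset.mem_univ, true_and] at hω
        have := hω _ hsa
        simp only at this
        rw [this, Finset.insert_eq_of_mem hsa]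
        simp [hsa]
      rw [h2]
      refine h1.trans ?_
      gcongr
      exact Nat.le_add_left _ _
    · set n := Fintype.card α with hn
      set C : α → Finset (κ → Perm α) := fun b => (cylinder ω₀ Q).filter fun ω => ω s a = b with hC
      have hfib : ∀ b, (C b).card * (n - K) ≤ (cylinder ω₀ Q).card := fun b =>
        le_trans (Nat.mul_le_mul_left _ (by omega)) (cylinder_fiber_card_le ω₀ Q hsa b)
      have hpart : ∀ (p : (κ → Perm α) → Prop) [DecidablePred p], ((cylinder ω₀ Q).filter p).card =
          ∑ b, ((C b).filter p).card := by
        intro p _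
        rw [Finset.card_eq_sum_card_fiberwise (f := fun ω => ω s a) (t := univ)
          (fun _ _ => Finset.mem_coe.2 (Finset.mem_univ _))]
        refine Finset.sum_congr rfl fun b _ => ?_
        rw [hC, Finset.filter_filter, Finset.filter_filter]
        simp only [and_comm]
      have hcyl : ∀ b, ∀ ω ∈ C b, C b = cylinder ω (insert (s, a) Q) := by
        intro b ω hω
        simp only [hC, cylinder, Finset.mem_filter, Finset.mem_univ, true_and] at hω
        ext ω'
        simp only [hC, cylinder, Finset.mem_filter, Finset.mem_univ, true_and, Finset.mem_insert]
        constructor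
        · rintro ⟨h1, h2⟩ q (rfl | hq)
          · rw [h2, hω.2]
          · rw [h1 q hq, hω.1 q hq]
        · intro h
          refine ⟨fun q hq => ?_, ?_⟩
          · rw [h q (Or.inr hq), hω.1 q hq]
          · rw [← hω.2]; exact h (s, a) (Or.inl rfl)
      have hQ' : (insert (s, a) Q).card + l'.length ≤ K := by
        rw [Finset.card_insert_of_notMem hsa]; omega
      have hin : ∀ b, ∀ d, ((C b).filter fun ω => d ≤ (next b).hits (insert (s, a) Q) ω).card *
          (n - K) ^ d ≤ listEsymm d l' * (C b).card := by
        intro b d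
        rcases (C b).eq_empty_or_nonempty with h0 | ⟨ω, hω⟩
        · simp [h0]
        · rw [hcyl b ω hω]
          exact ih b l' (hnext b) _ hQ' ω d
      have hb : ∀ b, ((C b).filter fun ω => c + 1 ≤ (if (s, a) ∉ Q ∧ ω s a ∈ V then 1 else 0) +
            (next (ω s a)).hits (insert (s, a) Q) ω).card * (n - K) ^ (c + 1) ≤
          (if b ∈ V then listEsymm c l' * (cylinder ω₀ Q).card else 0) +
            listEsymm (c + 1) l' * (C b).card := by
        intro b
        by_cases hbV : b ∈ V
        · have : ((C b).filter fun ω => c + 1 ≤ (if (s, a) ∉ Q ∧ ω s a ∈ V then 1 else 0) +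
            (next (ω s a)).hits (insert (s, a) Q) ω) =
            (C b).filter fun ω => c ≤ (next b).hits (insert (s, a) Q) ω := by
            refine Finset.filter_congr fun ω hω => ?_
            simp only [hC, Finset.mem_filter] at hω
            rw [hω.2, if_pos ⟨hsa, hbV⟩]
            omega
          rw [this, if_pos hbV, pow_succ, ← mul_assoc]
          refine le_trans (le_trans (Nat.mul_le_mul_right _ (hin b c)) ?_) (Nat.le_add_right _ _)
          rw [mul_assoc]
          exact Nat.mul_le_mul_left _ (hfib b)
        · have : ((C b).filter fun ω => c + 1 ≤ (if (s, a) ∉ Q ∧ ω s a ∈ V then 1 else 0) +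
            (next (ω s a)).hits (insert (s, a) Q) ω) =
            (C b).filter fun ω => c + 1 ≤ (next b).hits (insert (s, a) Q) ω := by
            refine Finset.filter_congr fun ω hω => ?_
            simp only [hC, Finset.mem_filter] at hω
            rw [hω.2, if_neg (fun h => hbV h.2), zero_add]
          rw [this, if_neg hbV, zero_add]
          exact hin b (c + 1)
      rw [hpart, Finset.sum_mul]
      refine (Finset.sum_le_sum fun b _ => hb b).trans ?_
      rw [Finset.sum_add_distrib, ← Finset.mul_sum]
      have hCsum : ∑ b, (C b).card = (cylinder ω₀ Q).card := by
        have := hpart fun _ => True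
        simpa using this.symm
      rw [hCsum, add_mul]
      refine Nat.add_le_add_right ?_ _
      rw [← Finset.sum_filter]
      simp only [Finset.filter_univ_mem, Finset.sum_const, smul_eq_mul]
      rw [mul_assoc]
      exact Nat.mul_le_mul_right _ hv

lemma card_hits_univ_le (T : QueryTree κ α) (l : List ℕ) (hT : T.Fits l) (c : ℕ) :
    (univ.filter fun ω : κ → Perm α => c ≤ T.hits ∅ ω).card * (Fintype.card α - l.length) ^ c ≤
      listEsymm c l * Fintype.card (κ → Perm α) := by
  have := card_hits_le T l hT l.length ∅ (by simp) 1 c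
  rwa [cylinder_empty] at this

end Exposure

section Walks
variable {κ α : Type*}

/-- The permutation obtained by reading the word `w` from left to right. -/
def wordPerm (ω : κ → Perm α) : List κ → Perm α
  | [] => 1
  | s :: w => wordPerm ω w * ω s

lemma wordPerm_append (ω : κ → Perm α) (w r : List κ) :
    wordPerm ω (w ++ r) = wordPerm ω r * wordPerm ω w := by
  induction w with
  | nil => simp [wordPerm]
  | cons s w ih => simp [wordPerm, ih, mul_assoc]

variable [DecidableEq α] [DecidableEq κ]

/-- The queries made when following the word `w` from `x`. -/
def walkQueries (ω : κ → Perm α) : List κ → α → Finset (κ × α)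
  | [], _ => ∅
  | s :: w, x => insert (s, x) (walkQueries ω w (ω s x))

/-- The points reached, after at least one step, when following the word `w` from `x`. -/
def walkPoints (ω : κ → Perm α) : List κ → α → Finset α
  | [], _ => ∅
  | s :: w, x => insert (ω s x) (walkPoints ω w (ω s x))

lemma mem_walkQueries {ω : κ → Perm α} {w : List κ} {x : α} {s : κ} {v : α} :
    (s, v) ∈ walkQueries ω w x ↔ ∃ w₁ w₂, w = w₁ ++ s :: w₂ ∧ v = wordPerm ω w₁ x := by
  induction w generalizing x with
  | nil => simp [walkQueries]
  | cons a w ih =>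
    simp only [walkQueries, Finset.mem_insert, Prod.mk.injEq, ih]
    constructor
    · rintro (⟨rfl, rfl⟩ | ⟨w₁, w₂, rfl, rfl⟩)
      · exact ⟨[], w, rfl, rfl⟩
      · exact ⟨a :: w₁, w₂, rfl, rfl⟩
    · rintro ⟨w₁, w₂, h, rfl⟩
      cases w₁ with
      | nil =>
        simp only [List.nil_append, List.cons.injEq] at h
        exact Or.inl ⟨h.1.symm, rfl⟩
      | cons b w₁ =>
        simp only [List.cons_append, List.cons.injEq] at h
        obtain ⟨rfl, rfl⟩ := h
        exact Or.inr ⟨w₁, w₂, rfl, rfl⟩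

omit [DecidableEq κ] in
lemma mem_walkPoints {ω : κ → Perm α} {w : List κ} {x : α} {v : α} :
    v ∈ walkPoints ω w x ↔
      ∃ w₁ s w₂, w = w₁ ++ s :: w₂ ∧ v = ω s (wordPerm ω w₁ x) := by
  induction w generalizing x with
  | nil => simp [walkPoints]
  | cons a w ih =>
    simp only [walkPoints, Finset.mem_insert, ih]
    constructor
    · rintro (rfl | ⟨w₁, s, w₂, rfl, rfl⟩)
      · exact ⟨[], a, w, rfl, rfl⟩
      · exact ⟨a :: w₁, s, w₂, rfl, rfl⟩
    · rintro ⟨w₁, s, w₂, h, rfl⟩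
      cases w₁ with
      | nil =>
        simp only [List.nil_append, List.cons.injEq] at h
        obtain ⟨rfl, rfl⟩ := h
        exact Or.inl rfl
      | cons b w₁ =>
        simp only [List.cons_append, List.cons.injEq] at h
        obtain ⟨rfl, rfl⟩ := h
        exact Or.inr ⟨w₁, s, w₂, rfl, rfl⟩

/-- The strategy following the word `w` from `x`, while recording the visited points in `V` and
using `T V` as the target set, and then continuing with `k`. -/
def walkTree (T : Finset α → Finset α) : List κ → α → Finset α →
    (α → Finset α → QueryTree κ α) → QueryTree κ α
  | [], x, V, k => k x V
  | s :: w, x, V, k => .node s x (T V) fun b => walkTree T w b (insert b V) k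

omit [DecidableEq κ] in
lemma walkTree_fits {T : Finset α → Finset α} {M : ℕ} {l : List ℕ}
    {k : α → Finset α → QueryTree κ α} (w : List κ) (x : α) (V : Finset α)
    (hT : ∀ V' : Finset α, V'.card ≤ V.card + w.length → (T V').card ≤ M)
    (hk : ∀ b (V' : Finset α), V'.card ≤ V.card + w.length → (k b V').Fits l) :
    (walkTree T w x V k).Fits (List.replicate w.length M ++ l) := by
  induction w generalizing x V with
  | nil => simpa [walkTree] using hk x V (by simp)
  | cons s w ih =>
    rw [List.length_cons, List.replicate_succ, List.cons_append]
    refine ⟨M, _, rfl, hT _ (by simp), fun b => ih b _ ?_ ?_⟩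
    · intro V' hV'
      refine hT V' (hV'.trans ?_)
      have := Finset.card_insert_le b V
      simp only [List.length_cons]; omega
    · intro b' V' hV'
      refine hk b' V' (hV'.trans ?_)
      have := Finset.card_insert_le b V
      simp only [List.length_cons]; omega

lemma walkTree_hits_ge (T : Finset α → Finset α) (k : α → Finset α → QueryTree κ α)
    (ω : κ → Perm α) (w : List κ) (x : α) (V : Finset α) (Q : Finset (κ × α)) :
    (k (wordPerm ω w x) (V ∪ walkPoints ω w x)).hits (Q ∪ walkQueries ω w x) ω ≤
      (walkTree T w x V k).hits Q ω := by
  induction w generalizing x V Q with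
  | nil => simp [walkTree, walkQueries, walkPoints, wordPerm]
  | cons s w ih =>
    have := ih (ω s x) (insert (ω s x) V) (insert (s, x) Q)
    simp only [walkTree, walkQueries, walkPoints, wordPerm, Perm.mul_apply, QueryTree.hits]
    rw [Finset.union_insert, Finset.union_insert, ← Finset.insert_union, ← Finset.insert_union]
    omega

/-- Each new query is either a hit or discovers a new point. -/
lemma walkTree_hits (k : α → Finset α → QueryTree κ α)
    (ω : κ → Perm α) (w : List κ) (x : α) (V : Finset α) (Q : Finset (κ × α))
    (hQV : ∀ q ∈ Q, ω q.1 q.2 ∈ V) :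
    (∀ q ∈ Q ∪ walkQueries ω w x, ω q.1 q.2 ∈ V ∪ walkPoints ω w x) ∧
    (walkTree id w x V k).hits Q ω + (V ∪ walkPoints ω w x).card + Q.card =
      (k (wordPerm ω w x) (V ∪ walkPoints ω w x)).hits (Q ∪ walkQueries ω w x) ω +
        V.card + (Q ∪ walkQueries ω w x).card := by
  induction w generalizing x V Q with
  | nil => simpa [walkTree, walkQueries, walkPoints, wordPerm] using hQV
  | cons s w ih =>
    have := ih (ω s x) (insert (ω s x) V) (insert (s, x) Q) (by
      intro q hq
      rcases Finset.mem_insert.1 hq with rfl | hq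
      · exact Finset.mem_insert_self _ _
      · exact Finset.mem_insert_of_mem (hQV q hq))
    simp only [walkTree, walkQueries, walkPoints, wordPerm, Perm.mul_apply, QueryTree.hits]
    rw [Finset.union_insert, Finset.union_insert, ← Finset.insert_union, ← Finset.insert_union]
    refine ⟨this.1, ?_⟩
    have h2 := this.2
    by_cases hq : (s, x) ∈ Q
    · rw [if_neg (fun h => h.1 hq)]
      have hv := hQV _ hq
      simp only at hv
      rw [Finset.insert_eq_of_mem hq, Finset.insert_eq_of_mem hv] at h2 ⊢
      omega
    · by_cases hv : ω s x ∈ V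
      · rw [if_pos ⟨hq, hv⟩]
        rw [Finset.card_insert_of_notMem hq] at h2
        rw [Finset.insert_eq_of_mem hv] at h2 ⊢
        omega
      · rw [if_neg (fun h => hv h.2)]
        rw [Finset.card_insert_of_notMem hq, Finset.card_insert_of_notMem hv] at h2
        omega

variable [Fintype α] [Fintype κ]

omit [Fintype α] in
/-- A handshake argument: if every point of `V` is incident to at least two half-edges of the
edge set `Q`, and one to at least three, then `V` has fewer elements than `Q`. -/
lemma card_lt_of_halfEdges (ω : κ → Perm α) (Q : Finset (κ × α)) (V : Finset α)
    (h2 : ∀ v ∈ V, 2 ≤ (univ.filter fun s => (s, v) ∈ Q).card +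
      (univ.filter fun s => (s, (ω s)⁻¹ v) ∈ Q).card)
    {e : α} (he : e ∈ V) (h3 : 3 ≤ (univ.filter fun s => (s, e) ∈ Q).card +
      (univ.filter fun s => (s, (ω s)⁻¹ e) ∈ Q).card) : V.card < Q.card := by
  have hout : ∑ v ∈ V, (univ.filter fun s => (s, v) ∈ Q).card ≤ Q.card := by
    rw [← Finset.card_sigma]
    refine Finset.card_le_card_of_injOn (fun p => (p.2, p.1)) ?_ ?_
    · rintro ⟨v, s⟩ h
      simpa using (Finset.mem_filter.1 (Finset.mem_sigma.1 h).2).2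
    · rintro ⟨v, s⟩ _ ⟨v', s'⟩ _ h
      simp only [Prod.mk.injEq] at h
      rw [h.1, h.2]
  have hin : ∑ v ∈ V, (univ.filter fun s => (s, (ω s)⁻¹ v) ∈ Q).card ≤ Q.card := by
    rw [← Finset.card_sigma]
    refine Finset.card_le_card_of_injOn (fun p => (p.2, (ω p.2)⁻¹ p.1)) ?_ ?_
    · rintro ⟨v, s⟩ h
      simpa using (Finset.mem_filter.1 (Finset.mem_sigma.1 h).2).2
    · rintro ⟨v, s⟩ _ ⟨v', s'⟩ _ h
      simp only [Prod.mk.injEq] at h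
      obtain ⟨rfl, h⟩ := h
      rw [(ω s)⁻¹.injective h]
  have hlt : ∑ v ∈ V, 2 < ∑ v ∈ V, ((univ.filter fun s => (s, v) ∈ Q).card +
      (univ.filter fun s => (s, (ω s)⁻¹ v) ∈ Q).card) :=
    Finset.sum_lt_sum h2 ⟨e, he, h3⟩
  rw [Finset.sum_add_distrib, Finset.sum_const, smul_eq_mul] at hlt
  omega

end Walks

section Closing
variable {κ α : Type*} [DecidableEq α] [DecidableEq κ]

/-- Follow `w`, `w'` from `x` and from `y`, every visited point being a target. -/
def collisionTree (w w' : List κ) (x y : α) : QueryTree κ α :=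
  walkTree id w x {x, y} fun _ V => walkTree id w' x V fun _ V =>
    walkTree id w y V fun _ V => walkTree id w' y V fun _ _ => .leaf

/-- Follow `w` and `v ++ [s]` from `x` and from `y`, the only targets being the endpoints of the
walks along `w` for the last steps of the walks along `v ++ [s]`. -/
def closingTree (w v : List κ) (s : κ) (x y : α) : QueryTree κ α :=
  walkTree (fun _ => ∅) w x ∅ fun e _ => walkTree (fun _ => ∅) w y ∅ fun e' _ =>
    walkTree (fun _ => ∅) v x ∅ fun a _ => .node s a {e} fun _ =>
      walkTree (fun _ => ∅) v y ∅ fun b _ => .node s b {e'} fun _ => .leaf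

omit [DecidableEq κ] in
lemma collisionTree_fits {q : ℕ} {w w' : List κ} (hw : w.length = q) (hw' : w'.length = q)
    (x y : α) : (collisionTree w w' x y).Fits (List.replicate (4 * q) (4 * q + 2)) := by
  have h0 : ({x, y} : Finset α).card ≤ 2 := Finset.card_le_two
  have hl : List.replicate (4 * q) (4 * q + 2) =
      List.replicate w.length (4 * q + 2) ++ (List.replicate w'.length (4 * q + 2) ++
        (List.replicate w.length (4 * q + 2) ++ (List.replicate w'.length (4 * q + 2) ++ []))) := by
    rw [hw, hw', List.append_nil, ← List.replicate_add, ← List.replicate_add,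
      ← List.replicate_add]
    congr 1; omega
  rw [hl]
  refine walkTree_fits _ _ _ (fun V' h => by simp only [id]; omega) fun b V₁ h₁ => ?_
  refine walkTree_fits _ _ _ (fun V' h => by simp only [id]; omega) fun b V₂ h₂ => ?_
  refine walkTree_fits _ _ _ (fun V' h => by simp only [id]; omega) fun b V₃ h₃ => ?_
  exact walkTree_fits _ _ _ (fun V' h => by simp only [id]; omega) fun b V₄ h₄ => rfl

omit [DecidableEq κ] in
lemma closingTree_fits {q : ℕ} {w v : List κ} (hw : w.length = q) (s : κ)
    (x y : α) : (closingTree w v s x y).Fits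
      (List.replicate q 0 ++ (List.replicate q 0 ++ (List.replicate v.length 0 ++
        1 :: (List.replicate v.length 0 ++ 1 :: [])))) := by
  rw [← hw]
  refine walkTree_fits _ _ _ (fun V' _ => by simp) fun b V₁ h₁ => ?_
  refine walkTree_fits _ _ _ (fun V' _ => by simp) fun b V₂ h₂ => ?_
  refine walkTree_fits _ _ _ (fun V' _ => by simp) fun b V₃ h₃ => ?_
  refine ⟨1, _, rfl, by simp, fun b => ?_⟩
  refine walkTree_fits _ _ _ (fun V' _ => by simp) fun b V₃ h₃ => ?_
  exact ⟨1, _, rfl, by simp, fun b => rfl⟩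

lemma closingTree_hits (ω : κ → Perm α) {w v : List κ} {s : κ} {x y : α}
    (hx : wordPerm ω w x = wordPerm ω (v ++ [s]) x)
    (hy : wordPerm ω w y = wordPerm ω (v ++ [s]) y)
    (hfx : (s, wordPerm ω v x) ∉ walkQueries ω w x ∪ walkQueries ω w y ∪ walkQueries ω v x)
    (hfy : (s, wordPerm ω v y) ∉ insert (s, wordPerm ω v x)
      (walkQueries ω w x ∪ walkQueries ω w y ∪ walkQueries ω v x) ∪ walkQueries ω v y) :
    2 ≤ (closingTree w v s x y).hits ∅ ω := by
  rw [wordPerm_append] at hx hy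
  simp only [wordPerm, Perm.mul_apply, Perm.one_apply] at hx hy
  unfold closingTree
  refine le_trans ?_ (walkTree_hits_ge _ _ _ _ _ _ _)
  refine le_trans ?_ (walkTree_hits_ge _ _ _ _ _ _ _)
  refine le_trans ?_ (walkTree_hits_ge _ _ _ _ _ _ _)
  rw [QueryTree.hits, if_pos ⟨by simpa using hfx, by simp [hx]⟩]
  have : 1 ≤ (QueryTree.node s (wordPerm ω v y) {wordPerm ω w y} fun _ => .leaf).hits
      (insert (s, wordPerm ω v x) (∅ ∪ walkQueries ω w x ∪ walkQueries ω w y ∪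
        walkQueries ω v x) ∪ walkQueries ω v y) ω := by
    rw [QueryTree.hits, if_pos ⟨by simpa using hfy, by simp [hy]⟩]
    omega
  have := this.trans (walkTree_hits_ge (fun _ => ∅) (fun b _ => .node s b {wordPerm ω w y}
    fun _ => .leaf) ω v y ∅ _)
  omega

variable [Fintype α] [Fintype κ]

omit [Fintype α] in
/-- If two words with different first and last letters agree at two points, then either there
are at least three collisions or the walks close up at their very last steps. -/
lemma collision_or_closing (ω : κ → Perm α) {u u' v v' : List κ} {a a' s s' : κ} {x y : α}
    (hxy : x ≠ y) (haa : a ≠ a') (hss : s ≠ s') (hw : a :: u = v ++ [s])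
    (hw' : a' :: u' = v' ++ [s'])
    (hx : wordPerm ω (v ++ [s]) x = wordPerm ω (v' ++ [s']) x)
    (hy : wordPerm ω (v ++ [s]) y = wordPerm ω (v' ++ [s']) y) :
    3 ≤ (collisionTree (v ++ [s]) (v' ++ [s']) x y).hits ∅ ω ∨
      2 ≤ (closingTree (v ++ [s]) v' s' x y).hits ∅ ω := by
  set w := v ++ [s] with hwd
  set w' := v' ++ [s'] with hwd'
  set Q := walkQueries ω w x ∪ walkQueries ω w' x ∪ walkQueries ω w y ∪ walkQueries ω w' y with hQ
  set V : Finset α := {x, y} ∪ walkPoints ω w x ∪ walkPoints ω w' x ∪ walkPoints ω w y ∪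
    walkPoints ω w' y with hV
  have hcount : (collisionTree w w' x y).hits ∅ ω + V.card = 2 + Q.card := by
    have h1 := walkTree_hits (fun _ V => walkTree id w' x V fun _ V =>
      walkTree id w y V fun _ V => walkTree id w' y V fun _ _ => .leaf) ω w x {x, y} ∅ (by simp)
    have h2 := walkTree_hits (fun _ V =>
      walkTree id w y V fun _ V => walkTree id w' y V fun _ _ => .leaf) ω w' x _ _ h1.1
    have h3 := walkTree_hits (fun _ V => walkTree id w' y V fun _ _ => .leaf) ω w y _ _ h2.1
    have h4 := walkTree_hits (fun _ _ => .leaf) ω w' y _ _ h3.1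
    have hc : ({x, y} : Finset α).card = 2 := Finset.card_pair hxy
    have h1 := h1.2
    have h2 := h2.2
    have h3 := h3.2
    have h4 := h4.2
    rw [show QueryTree.leaf.hits _ ω = 0 from rfl] at h4
    simp only [Finset.card_empty, Finset.empty_union] at h1 h2 h3 h4
    unfold collisionTree
    rw [hQ, hV]
    omega
  by_contra hcon
  push Not at hcon
  obtain ⟨hc3, hc2⟩ := hcon
  have hVQ : ¬ V.card < Q.card := by omega
  have hQz : ∀ z, z = x ∨ z = y → walkQueries ω w z ⊆ Q ∧ walkQueries ω w' z ⊆ Q := by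
    rintro z (rfl | rfl) <;> constructor <;> intro q hq <;>
      simp only [hQ, Finset.mem_union, hq, true_or, or_true]
  have hend : ∀ z, z = x ∨ z = y → wordPerm ω w z = wordPerm ω w' z := by
    rintro z (rfl | rfl)
    exacts [hx, hy]
  have hlast : ∀ (v₀ : List κ) (s₀ : κ) z, ω s₀ (wordPerm ω v₀ z) = wordPerm ω (v₀ ++ [s₀]) z := by
    intro v₀ s₀ z
    simp [wordPerm_append, wordPerm]
  -- incident half-edges
  have hin2 : ∀ z, z = x ∨ z = y →
      2 ≤ (univ.filter fun t => (t, (ω t)⁻¹ (wordPerm ω w z)) ∈ Q).card := by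
    intro z hz
    refine Finset.one_lt_card.2 ⟨s, ?_, s', ?_, hss⟩
    · rw [Finset.mem_filter]
      refine ⟨Finset.mem_univ _, (hQz z hz).1 (mem_walkQueries.2 ⟨v, [], hwd, ?_⟩)⟩
      rw [hwd, ← hlast]; simp
    · rw [Finset.mem_filter]
      refine ⟨Finset.mem_univ _, (hQz z hz).2 (mem_walkQueries.2 ⟨v', [], hwd', ?_⟩)⟩
      rw [hend z hz, hwd', ← hlast]; simp
  have hout2 : ∀ z, z = x ∨ z = y → 2 ≤ (univ.filter fun t => (t, z) ∈ Q).card := by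
    intro z hz
    refine Finset.one_lt_card.2 ⟨a, ?_, a', ?_, haa⟩
    · rw [Finset.mem_filter]
      exact ⟨Finset.mem_univ _, (hQz z hz).1 (mem_walkQueries.2 ⟨[], u, hw.symm, rfl⟩)⟩
    · rw [Finset.mem_filter]
      exact ⟨Finset.mem_univ _, (hQz z hz).2 (mem_walkQueries.2 ⟨[], u', hw'.symm, rfl⟩)⟩
  have hpt : ∀ z, z = x ∨ z = y → ∀ w₀, w₀ = w ∨ w₀ = w' → ∀ p ∈ walkPoints ω w₀ z,
      2 ≤ (univ.filter fun t => (t, p) ∈ Q).card +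
        (univ.filter fun t => (t, (ω t)⁻¹ p) ∈ Q).card := by
    intro z hz w₀ hw₀ p hp
    obtain ⟨w₁, t, w₂, hw₁, rfl⟩ := mem_walkPoints.1 hp
    have hsub : walkQueries ω w₀ z ⊆ Q := by
      rcases hw₀ with rfl | rfl
      exacts [(hQz z hz).1, (hQz z hz).2]
    cases w₂ with
    | nil =>
      have : ω t (wordPerm ω w₁ z) = wordPerm ω w z := by
        rw [hlast, ← hw₁]
        rcases hw₀ with rfl | rfl
        exacts [rfl, (hend z hz).symm]
      rw [this]
      exact (hin2 z hz).trans (Nat.le_add_left _ _)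
    | cons t' w₂ =>
      have h1 : 0 < (univ.filter fun t' => (t', ω t (wordPerm ω w₁ z)) ∈ Q).card := by
        refine Finset.card_pos.2 ⟨t', Finset.mem_filter.2 ⟨Finset.mem_univ _, hsub ?_⟩⟩
        exact mem_walkQueries.2 ⟨w₁ ++ [t], w₂, by simp [hw₁], hlast _ _ _⟩
      have h2 : 0 < (univ.filter fun t' => (t', (ω t')⁻¹ (ω t (wordPerm ω w₁ z))) ∈ Q).card := by
        refine Finset.card_pos.2 ⟨t, Finset.mem_filter.2 ⟨Finset.mem_univ _, hsub ?_⟩⟩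
        exact mem_walkQueries.2 ⟨w₁, t' :: w₂, hw₁, by simp⟩
      omega
  have hdeg : ∀ p ∈ V, 2 ≤ (univ.filter fun t => (t, p) ∈ Q).card +
        (univ.filter fun t => (t, (ω t)⁻¹ p) ∈ Q).card := by
    intro p hp
    simp only [hV, Finset.mem_union, Finset.mem_insert, Finset.mem_singleton] at hp
    rcases hp with (((hp | hp) | hp) | hp) | hp
    · exact (hout2 p hp).trans (Nat.le_add_right _ _)
    · exact hpt x (Or.inl rfl) w (Or.inl rfl) p hp
    · exact hpt x (Or.inl rfl) w' (Or.inr rfl) p hp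
    · exact hpt y (Or.inr rfl) w (Or.inl rfl) p hp
    · exact hpt y (Or.inr rfl) w' (Or.inr rfl) p hp
  have hdeg3 : ∀ z, z = x ∨ z = y → ∀ t, (t, wordPerm ω w z) ∉ Q := by
    intro z hz t ht
    have h1 : 0 < (univ.filter fun t => (t, wordPerm ω w z) ∈ Q).card :=
      Finset.card_pos.2 ⟨t, Finset.mem_filter.2 ⟨Finset.mem_univ _, ht⟩⟩
    have h2 := hin2 z hz
    refine hVQ (card_lt_of_halfEdges ω Q V hdeg (e := wordPerm ω w z) ?_ (by omega))
    have : wordPerm ω w z ∈ walkPoints ω w z :=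
      mem_walkPoints.2 ⟨v, s, [], hwd, by rw [hlast]⟩
    rcases hz with rfl | rfl <;> simp only [hV, Finset.mem_union, this, true_or, or_true]
  -- a query leading to an endpoint is a last query
  have hfinal : ∀ z, z = x ∨ z = y → ∀ z', z' = x ∨ z' = y → ∀ v₀ s₀, 
      (v₀ ++ [s₀] = w ∨ v₀ ++ [s₀] = w') → (s', wordPerm ω v' z) ∈ walkQueries ω (v₀ ++ [s₀]) z' →
      s₀ = s' ∧ wordPerm ω v' z = wordPerm ω v₀ z' ∧ 
        (s', wordPerm ω v' z) ∉ walkQueries ω v₀ z' := by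
    intro z hz z' hz' v₀ s₀ hv₀ hq
    have hsub : walkQueries ω (v₀ ++ [s₀]) z' ⊆ Q := by
      rcases hv₀ with h | h <;> rw [h]
      exacts [(hQz z' hz').1, (hQz z' hz').2]
    have key : ∀ w₁ w₂, v₀ ++ [s₀] = w₁ ++ s' :: w₂ → wordPerm ω v' z = wordPerm ω w₁ z' →
        w₂ = [] := by
      intro w₁ w₂ hw₁ hv
      cases w₂ with
      | nil => rfl
      | cons t w₂ =>
        exfalso
        refine hdeg3 z hz t (hsub (mem_walkQueries.2 ⟨w₁ ++ [s'], w₂, by simp [hw₁], ?_⟩))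
        rw [hend z hz, hwd', ← hlast, ← hlast, hv]
    obtain ⟨w₁, w₂, hw₁, hv⟩ := mem_walkQueries.1 hq
    have h0 := key w₁ w₂ hw₁ hv
    subst h0
    have h1 := List.append_inj' hw₁ rfl
    refine ⟨by simpa using h1.2, by rw [hv, h1.1], fun hmem => ?_⟩
    obtain ⟨w₃, w₄, hw₃, hv₃⟩ := mem_walkQueries.1 hmem
    have := key w₃ (w₄ ++ [s₀]) (by simp [hw₃]) hv₃
    simp at this
  have hnot : ∀ z, z = x ∨ z = y → ∀ z', z' = x ∨ z' = y →
      (s', wordPerm ω v' z) ∉ walkQueries ω w z' := fun z hz z' hz' hq =>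
    hss (hfinal z hz z' hz' v s (Or.inl rfl) hq).1
  have hmono : ∀ z, walkQueries ω v' z ⊆ walkQueries ω w' z := by
    rintro z ⟨t, p⟩ hq
    obtain ⟨w₁, w₂, hw₁, hp⟩ := mem_walkQueries.1 hq
    exact mem_walkQueries.2 ⟨w₁, w₂ ++ [s'], by simp [hwd', hw₁], hp⟩
  have hnot' : ∀ z, z = x ∨ z = y → ∀ z', z' = x ∨ z' = y →
      (s', wordPerm ω v' z) ∉ walkQueries ω v' z' := fun z hz z' hz' hq =>
    (hfinal z hz z' hz' v' s' (Or.inr rfl) (hmono _ hq)).2.2 hq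
  have hX : x = x ∨ x = y := Or.inl rfl
  have hY : y = x ∨ y = y := Or.inr rfl
  refine absurd (closingTree_hits ω hx hy ?_ ?_) (not_le.2 hc2)
  · simp only [Finset.mem_union, not_or]
    exact ⟨⟨hnot x hX x hX, hnot x hX y hY⟩, hnot' x hX x hX⟩
  · simp only [Finset.mem_union, Finset.mem_insert, not_or, Prod.mk.injEq, true_and]
    refine ⟨⟨fun h => hxy ((wordPerm ω v').injective h).symm, 
      ⟨hnot y hY x hX, hnot y hY y hY⟩, hnot' y hY x hX⟩, hnot' y hY y hY⟩

/-- Two words with different first and last letters rarely agree at two points. -/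
lemma card_agree_le {q : ℕ} {u u' v v' : List κ} {a a' s s' : κ} {x y : α}
    (hxy : x ≠ y) (haa : a ≠ a') (hss : s ≠ s') (hw : a :: u = v ++ [s])
    (hw' : a' :: u' = v' ++ [s']) (hq : v.length + 1 = q) (hq' : v'.length + 1 = q) {m : ℕ} 
    (hm : q ≤ m) (hmn : 4 * m < Fintype.card α) :
    ((univ.filter fun ω : κ → Perm α => wordPerm ω (v ++ [s]) x = wordPerm ω (v' ++ [s']) x ∧
      wordPerm ω (v ++ [s]) y = wordPerm ω (v' ++ [s']) y).card : ℝ) ≤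
      (1 / ((Fintype.card α : ℝ) - 4 * m) ^ 2 +
        (4 * m * (4 * m + 2)) ^ 3 / ((Fintype.card α : ℝ) - 4 * m) ^ 3) *
        Fintype.card (κ → Perm α) := by
  set Ω := Fintype.card (κ → Perm α) with hΩ
  set n := Fintype.card α with hn
  have hsub : (univ.filter fun ω : κ → Perm α =>
      wordPerm ω (v ++ [s]) x = wordPerm ω (v' ++ [s']) x ∧
      wordPerm ω (v ++ [s]) y = wordPerm ω (v' ++ [s']) y) ⊆
      (univ.filter fun ω => 3 ≤ (collisionTree (v ++ [s]) (v' ++ [s']) x y).hits ∅ ω) ∪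
      (univ.filter fun ω => 2 ≤ (closingTree (v ++ [s]) v' s' x y).hits ∅ ω) := by
    intro ω hω
    simp only [Finset.mem_union, Finset.mem_filter, Finset.mem_univ, true_and] at hω ⊢
    exact collision_or_closing ω hxy haa hss hw hw' hω.1 hω.2
  have hcard := (Finset.card_le_card hsub).trans (Finset.card_union_le _ _)
  have hl : (v ++ [s]).length = q := by simp [hq]
  have hl' : (v' ++ [s']).length = q := by simp [hq']
  have h1 := card_hits_univ_le _ _ (collisionTree_fits hl hl' x y) 3
  have h2 := card_hits_univ_le _ _ (closingTree_fits (v := v') hl s' x y) 2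
  have e1 : listEsymm 3 (List.replicate (4 * q) (4 * q + 2)) ≤ (4 * m * (4 * m + 2)) ^ 3 := by
    refine (listEsymm_le (M := 4 * q + 2) 3 _ ?_).trans ?_
    · intro b hb
      rw [List.eq_of_mem_replicate hb]
    · rw [List.length_replicate]; gcongr
  have e2 : listEsymm 2 (List.replicate q 0 ++ (List.replicate q 0 ++ (List.replicate v'.length 0 ++
        1 :: (List.replicate v'.length 0 ++ 1 :: [])))) = 1 := by
    rw [listEsymm_append_zero, listEsymm_append_zero, listEsymm_append_zero]
    simp only [listEsymm, listEsymm_append_zero]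
  rw [e2, one_mul, ← hΩ, ← hn] at h2
  rw [← hΩ, ← hn, List.length_replicate] at h1
  have h1' := h1.trans (Nat.mul_le_mul_right _ e1)
  have hpos : (0 : ℝ) < (n : ℝ) - 4 * m := by
    have : ((4 * m : ℕ) : ℝ) < n := by exact_mod_cast hmn
    push_cast at this; linarith
  have hsubn : ∀ k, k ≤ 4 * m → ((n : ℝ) - 4 * m) ≤ ((n - k : ℕ) : ℝ) := by
    intro k hk
    have : n ≤ (n - k) + 4 * m := by omega
    have : (n : ℝ) ≤ ((n - k : ℕ) : ℝ) + 4 * m := by exact_mod_cast this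
    linarith
  have hb : ∀ (c k N₀ B : ℕ), k ≤ 4 * m → N₀ * (n - k) ^ c ≤ B * Ω →
      (N₀ : ℝ) ≤ (B : ℝ) / ((n : ℝ) - 4 * m) ^ c * Ω := by
    intro c k N₀ B hk h
    rw [div_mul_eq_mul_div, le_div_iff₀ (pow_pos hpos c)]
    have : (N₀ : ℝ) * ((n - k : ℕ) : ℝ) ^ c ≤ B * Ω := by exact_mod_cast h
    refine le_trans (mul_le_mul_of_nonneg_left ?_ (Nat.cast_nonneg _)) this
    exact pow_le_pow_left₀ hpos.le (hsubn k hk) c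
  have r1 := hb 3 (4 * q) _ _ (by omega) h1'
  have r2 := hb 2 _ _ 1 ?_ (h2.trans_eq (one_mul _).symm)
  swap
  · simp only [List.length_append, List.length_replicate, List.length_cons, List.length_nil]
    omega
  have hcard' := (Nat.cast_le (α := ℝ)).2 hcard
  push_cast at hcard' r1 r2
  rw [add_mul]
  linarith

end Closing

section TransitionError
variable {ι ι' β : Type*} [Fintype ι] [Fintype ι'] [Fintype β] [DecidableEq β]

/-- The probability that a random member of the family `π` maps `t` to `t'`. -/
noncomputable def transProb (π : ι → Perm β) (t t' : β) : ℝ :=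
  (∑ i, if π i t = t' then (1 : ℝ) else 0) / Fintype.card ι

/-- The squared Frobenius distance of the transition matrix of `π` to the uniform one. -/
noncomputable def transErr (π : ι → Perm β) : ℝ :=
  ∑ t, ∑ t', (transProb π t t' - 1 / Fintype.card β) ^ 2

lemma transErr_nonneg (π : ι → Perm β) : 0 ≤ transErr π :=
  Finset.sum_nonneg fun _ _ => Finset.sum_nonneg fun _ _ => sq_nonneg _

lemma transProb_sum_right [Nonempty ι] (π : ι → Perm β) (t : β) : ∑ t', transProb π t t' = 1 := by
  have : (Fintype.card ι : ℝ) ≠ 0 := by positivity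
  unfold transProb
  rw [← Finset.sum_div, Finset.sum_comm]
  simp [this]

lemma transProb_sum_left [Nonempty ι] (π : ι → Perm β) (t' : β) : ∑ t, transProb π t t' = 1 := by
  have : (Fintype.card ι : ℝ) ≠ 0 := by positivity
  have h : ∀ i, ∑ t, (if π i t = t' then (1 : ℝ) else 0) = 1 := by
    intro i
    rw [Finset.sum_eq_single ((π i).symm t')]
    · simp
    · intro b _ hb
      rw [if_neg]
      rintro rfl
      simp at hb
    · simp
  unfold transProb
  rw [← Finset.sum_div, Finset.sum_comm]
  simp [h, this]

lemma transErr_eq [Nonempty ι] [Nonempty β] (π : ι → Perm β) :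
    transErr π = (∑ i, ∑ j, ((univ.filter fun t => π i t = π j t).card : ℝ)) /
      (Fintype.card ι : ℝ) ^ 2 - 1 := by
  have hβ : (Fintype.card β : ℝ) ≠ 0 := by positivity
  have h1 : ∀ t, ∑ t', (transProb π t t' - 1 / Fintype.card β) ^ 2 =
      ∑ t', transProb π t t' ^ 2 - 1 / Fintype.card β := by
    intro t
    simp only [sub_sq, Finset.sum_add_distrib, Finset.sum_sub_distrib, mul_assoc]
    rw [← Finset.mul_sum, ← Finset.sum_mul, transProb_sum_right]
    simp only [Finset.sum_const, Finset.card_univ, nsmul_eq_mul]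
    field_simp
    ring
  have h2 : ∀ t, ∑ t', transProb π t t' ^ 2 =
      (∑ i, ∑ j, if π i t = π j t then (1 : ℝ) else 0) / (Fintype.card ι : ℝ) ^ 2 := by
    intro t
    simp only [transProb, div_pow]
    rw [← Finset.sum_div]
    congr 1
    simp only [sq, Finset.sum_mul_sum]
    rw [Finset.sum_comm]
    refine Finset.sum_congr rfl fun i _ => ?_
    rw [Finset.sum_comm]
    refine Finset.sum_congr rfl fun j _ => ?_
    rw [Finset.sum_eq_single (π i t)]
    · simp [eq_comm]
    · intro b _ hb
      rw [if_neg (Ne.symm hb), zero_mul]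
    · simp
  unfold transErr
  simp only [h1, h2]
  rw [Finset.sum_sub_distrib, ← Finset.sum_div, Finset.sum_comm]
  simp only [Finset.sum_const, Finset.card_univ, nsmul_eq_mul]
  rw [mul_one_div_cancel hβ]
  congr 2
  refine Finset.sum_congr rfl fun i _ => ?_
  rw [Finset.sum_comm]
  refine Finset.sum_congr rfl fun j _ => ?_
  simp

lemma transProb_mul (π : ι → Perm β) (ρ : ι' → Perm β) (t t' : β) :
    transProb (fun p : ι × ι' => π p.1 * ρ p.2) t t' =
      ∑ s, transProb ρ t s * transProb π s t' := by
  simp only [transProb, div_mul_div_comm]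
  rw [← Finset.sum_div, Fintype.card_prod, Nat.cast_mul, mul_comm (Fintype.card ι : ℝ)]
  congr 1
  rw [Fintype.sum_prod_type_right]
  simp only [Finset.sum_mul_sum]
  refine Eq.trans (Finset.sum_congr rfl fun j _ => ?_) Finset.sum_comm
  refine Eq.trans ?_ Finset.sum_comm
  refine Finset.sum_congr rfl fun i _ => ?_
  rw [Finset.sum_eq_single (ρ j t)]
  · rw [if_pos rfl, one_mul]; rfl
  · intro b _ hb
    rw [if_neg (Ne.symm hb), zero_mul]
  · simp

lemma transErr_mul_le [Nonempty ι] [Nonempty ι'] [Nonempty β] (π : ι → Perm β)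
    (ρ : ι' → Perm β) : transErr (fun p : ι × ι' => π p.1 * ρ p.2) ≤ transErr ρ * transErr π := by
  have hβ : (Fintype.card β : ℝ) ≠ 0 := by positivity
  have h : ∀ t t', transProb (fun p : ι × ι' => π p.1 * ρ p.2) t t' - 1 / Fintype.card β =
      ∑ s, (transProb ρ t s - 1 / Fintype.card β) * (transProb π s t' - 1 / Fintype.card β) := by
    intro t t'
    simp only [sub_mul, mul_sub, Finset.sum_sub_distrib]
    rw [← Finset.sum_mul, ← Finset.mul_sum, transProb_sum_right, transProb_sum_left,
      transProb_mul]
    simp only [Finset.sum_const, Finset.card_univ, nsmul_eq_mul]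
    field_simp
    ring
  calc _ = ∑ t, ∑ t', (∑ s, (transProb ρ t s - 1 / Fintype.card β) *
        (transProb π s t' - 1 / Fintype.card β)) ^ 2 := by
        unfold transErr
        simp only [h]
    _ ≤ ∑ t, ∑ t', (∑ s, (transProb ρ t s - 1 / Fintype.card β) ^ 2) *
          ∑ s, (transProb π s t' - 1 / Fintype.card β) ^ 2 :=
        Finset.sum_le_sum fun t _ => Finset.sum_le_sum fun t' _ =>
          Finset.sum_mul_sq_le_sq_mul_sq _ _ _
    _ = _ := by
        unfold transErr
        rw [← Finset.sum_mul_sum]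
        congr 1
        exact Finset.sum_comm

end TransitionError

section Pairs
variable {α : Type*} [Fintype α] [DecidableEq α]

/-- Ordered pairs of distinct elements. -/
abbrev DistinctPair (α : Type*) := {p : α × α // p.1 ≠ p.2}

/-- The action of a permutation on ordered pairs of distinct elements. -/
def pairPerm (σ : Perm α) : Perm (DistinctPair α) :=
  (Equiv.prodCongr σ σ).subtypeEquiv fun p => by simp

omit [Fintype α] [DecidableEq α] in
lemma pairPerm_mul (σ τ : Perm α) : pairPerm (σ * τ) = pairPerm σ * pairPerm τ := by
  ext p <;> rfl

omit [Fintype α] [DecidableEq α] in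
lemma pairPerm_eq_iff (σ τ : Perm α) (p q : DistinctPair α) :
    pairPerm σ p = pairPerm τ q ↔ σ p.1.1 = τ q.1.1 ∧ σ p.1.2 = τ q.1.2 := by
  rw [Subtype.ext_iff, Prod.ext_iff]; rfl

lemma card_distinctPair : Fintype.card (DistinctPair α) =
    Fintype.card α * (Fintype.card α - 1) := by
  rw [Fintype.card_subtype, Nat.mul_sub, mul_one]
  exact Finset.offDiag_card (univ : Finset α) ▸ (by congr 1; ext; simp)

/-- Iterated squaring of a family of permutations makes its action on pairs equidistributed. -/
lemma exists_family_transErr_le {ι : Type} [Fintype ι] [Nonempty ι] [Nonempty (DistinctPair α)]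
    {S : Finset (Perm α)} {D : ℕ} (π : ι → Perm α) (hπ : ∀ i, π i ∈ wordBall S D) {δ : ℝ}
    (hδ : transErr (fun i => pairPerm (π i)) ≤ δ) (k : ℕ) :
    ∃ (ι' : Type) (_ : Fintype ι') (_ : Nonempty ι') (π' : ι' → Perm α),
      (∀ i, π' i ∈ wordBall S (2 ^ k * D)) ∧ 
        transErr (fun i => pairPerm (π' i)) ≤ δ ^ 2 ^ k := by
  induction k with
  | zero => exact ⟨ι, inferInstance, inferInstance, π, by simpa using hπ, by simpa using hδ⟩
  | succ k ih =>
    obtain ⟨ι', _, _, π', h1, h2⟩ := ih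
    refine ⟨ι' × ι', inferInstance, inferInstance, fun p => π' p.1 * π' p.2, fun p => ?_, ?_⟩
    · have := mul_mem_wordBall (h1 p.1) (h1 p.2)
      rwa [← two_mul, ← mul_assoc, ← pow_succ'] at this
    · simp only [pairPerm_mul]
      refine (transErr_mul_le (fun i => pairPerm (π' i)) fun i => pairPerm (π' i)).trans ?_
      rw [pow_succ 2 k, pow_mul, sq]
      exact mul_le_mul h2 h2 (transErr_nonneg _) ((transErr_nonneg _).trans h2)

lemma pairMixing_of_transErr {n : ℕ} (hn : 2 ≤ n) {ι : Type*} [Fintype ι] [Nonempty ι]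
    (π : ι → Perm (Fin n)) (h : transErr (fun i => pairPerm (π i)) ≤ ((n : ℝ)⁻¹ ^ 4) ^ 2) :
    PairMixing π := by
  intro a b c d hab hcd
  have hn2 : (2 : ℝ) ≤ n := by exact_mod_cast hn
  have hι : (0 : ℝ) < Fintype.card ι := by positivity
  have h1 : (transProb (fun i => pairPerm (π i)) ⟨(a, b), hab⟩ ⟨(c, d), hcd⟩ -
      1 / Fintype.card (DistinctPair (Fin n))) ^ 2 ≤ ((n : ℝ)⁻¹ ^ 4) ^ 2 := by
    refine le_trans ?_ h
    refine le_trans (Finset.single_le_sum (f := fun t' => 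
      (transProb (fun i => pairPerm (π i)) ⟨(a, b), hab⟩ t' -
      1 / Fintype.card (DistinctPair (Fin n))) ^ 2) (fun _ _ => sq_nonneg _)
      (Finset.mem_univ _)) ?_
    exact Finset.single_le_sum (f := fun t => ∑ t', 
      (transProb (fun i => pairPerm (π i)) t t' -
      1 / Fintype.card (DistinctPair (Fin n))) ^ 2) 
      (fun _ _ => Finset.sum_nonneg fun _ _ => sq_nonneg _) (Finset.mem_univ _)
  have h2 := abs_le_of_sq_le_sq h1 (by positivity)
  rw [card_distinctPair, Fintype.card_fin] at h2
  have hcast : ((n * (n - 1) : ℕ) : ℝ) = n * (n - 1) := by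
    rw [Nat.cast_mul, Nat.cast_sub (by omega)]; simp
  rw [hcast] at h2
  have h3 : (∑ i, if π i a = c ∧ π i b = d then (1 : ℝ) else 0) =
      transProb (fun i => pairPerm (π i)) ⟨(a, b), hab⟩ ⟨(c, d), hcd⟩ * Fintype.card ι := by
    unfold transProb
    rw [div_mul_cancel₀ _ hι.ne']
    refine Finset.sum_congr rfl fun i _ => ?_
    have := pairPerm_eq_iff (π i) 1 ⟨(a, b), hab⟩ ⟨(c, d), hcd⟩
    have h1 : pairPerm (1 : Perm (Fin n)) = 1 := rfl
    rw [h1] at this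
    simp only [Perm.one_apply] at this
    simp only [this]
  rw [h3]
  have hpos : (0 : ℝ) < n * (n - 1) := by nlinarith
  have e : transProb (fun i => pairPerm (π i)) ⟨(a, b), hab⟩ ⟨(c, d), hcd⟩ * Fintype.card ι -
      (Fintype.card ι : ℝ) / (n * (n - 1)) =
      (transProb (fun i => pairPerm (π i)) ⟨(a, b), hab⟩ ⟨(c, d), hcd⟩ - 1 / (n * (n - 1))) *
        Fintype.card ι := by ring
  rw [e, abs_mul, abs_of_pos hι]
  have e2 : (Fintype.card ι : ℝ) / (n * (n - 1)) / n = 1 / (n * (n - 1) * n) * Fintype.card ι := by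
    field_simp
  rw [e2]
  refine mul_le_mul_of_nonneg_right (h2.trans ?_) hι.le
  rw [inv_pow, ← one_div]
  refine one_div_le_one_div_of_le (by positivity) ?_
  have : (n : ℝ) * (n - 1) * n ≤ n * n * n := by nlinarith
  nlinarith [pow_pos (by linarith : (0 : ℝ) < n) 3]

end Pairs

section WordCollisions

lemma List.exists_first_difference {κ : Type*} (l l' : List κ) (hl : l.length = l'.length)
    (hne : l ≠ l') : ∃ p a u a' u', l = p ++ a :: u ∧ l' = p ++ a' :: u' ∧ a ≠ a' := by
  induction l generalizing l' with
  | nil =>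
    cases l' with
    | nil => exact absurd rfl hne
    | cons => simp at hl
  | cons b l ih =>
    cases l' with
    | nil => simp at hl
    | cons b' l' =>
      by_cases hb : b = b'
      · subst hb
        obtain ⟨p, a, u, a', u', rfl, rfl, h⟩ := ih l' (by simpa using hl)
          (fun h => hne (by rw [h]))
        exact ⟨b :: p, a, u, a', u', rfl, rfl, h⟩
      · exact ⟨[], b, l, b', l', rfl, rfl, hb⟩

variable {κ α : Type*} [DecidableEq α] [DecidableEq κ] [Fintype α] [Fintype κ]

/-- The bound on the probability that two words agree at two points. -/
noncomputable def agreeBound (n m : ℕ) : ℝ :=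
  1 / ((n : ℝ) - 4 * m) ^ 2 + (4 * m * (4 * m + 2)) ^ 3 / ((n : ℝ) - 4 * m) ^ 3

lemma sum_card_agree_le {m : ℕ} (hmn : 4 * m < Fintype.card α) (l l' : List κ)
    (hl : l.length = m) (hl' : l'.length = m) (hne : l ≠ l') :
    ∑ ω : κ → Perm α, ((univ.filter fun t : DistinctPair α =>
      pairPerm (wordPerm ω l) t = pairPerm (wordPerm ω l') t).card : ℝ) ≤
      Fintype.card (DistinctPair α) *
        (agreeBound (Fintype.card α) m * Fintype.card (κ → Perm α)) := by
  obtain ⟨p, a, u, a', u', rfl, rfl, haa⟩ := l.exists_first_difference l' (by rw [hl, hl']) hne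
  have huu : u.length = u'.length := by
    simp only [List.length_append, List.length_cons] at hl hl'; omega
  obtain ⟨r, s, v, s', v', hr, hr', hss⟩ := List.exists_first_difference (a :: u).reverse
    (a' :: u').reverse (by simp [huu]) (fun h => haa (by
      have := List.reverse_injective h
      simpa using (List.cons.inj this).1))
  have e : a :: u = (v.reverse ++ [s]) ++ r.reverse := by
    rw [← List.reverse_reverse (a :: u), hr]; simp
  have e' : a' :: u' = (v'.reverse ++ [s']) ++ r.reverse := by
    rw [← List.reverse_reverse (a' :: u'), hr']; simp
  set w := v.reverse ++ [s] with hw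
  set w' := v'.reverse ++ [s'] with hw'
  have hhead : ∀ {b : κ} {x : List κ} {y : List κ} {z : κ}, b :: x = (y ++ [z]) ++ r.reverse →
      ∃ x', b :: x' = y ++ [z] := by
    intro b x y z h
    cases y with
    | nil =>
      simp only [List.nil_append, List.cons_append, List.cons.injEq] at h
      exact ⟨[], by simp [h.1]⟩
    | cons c y =>
      simp only [List.cons_append, List.cons.injEq] at h
      exact ⟨y ++ [z], by simp [h.1]⟩
  obtain ⟨x, hx⟩ := hhead e
  obtain ⟨x', hx'⟩ := hhead e'
  have hlv : v.length + 1 ≤ m := by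
    have := congrArg List.length e
    simp only [hw, List.length_append, List.length_cons, List.length_nil, List.length_reverse]
      at this hl
    omega
  have hlv' : v'.length = v.length := by
    have h1 := congrArg List.length e
    have h2 := congrArg List.length e'
    simp only [hw, hw', List.length_append, List.length_cons, List.length_nil,
      List.length_reverse] at h1 h2
    omega
  have hcount : ∀ ω : κ → Perm α, (univ.filter fun t : DistinctPair α =>
      pairPerm (wordPerm ω (p ++ a :: u)) t = pairPerm (wordPerm ω (p ++ a' :: u')) t).card ≤
      (univ.filter fun t : DistinctPair α =>
        pairPerm (wordPerm ω w) t = pairPerm (wordPerm ω w') t).card := by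
    intro ω
    refine Finset.card_le_card_of_injOn (pairPerm (wordPerm ω p)) ?_
      (fun _ _ _ _ h => (pairPerm (wordPerm ω p)).injective h)
    intro t ht
    simp only [Finset.coe_filter, Finset.mem_univ, true_and, Set.mem_ofPred_eq] at ht ⊢
    rw [e, e', wordPerm_append ω p, wordPerm_append ω p, wordPerm_append ω w,
      wordPerm_append ω w', pairPerm_mul, pairPerm_mul, pairPerm_mul, pairPerm_mul] at ht
    simp only [Perm.mul_apply] at ht
    exact (pairPerm _).injective ht
  calc _ ≤ ∑ ω : κ → Perm α, ((univ.filter fun t : DistinctPair α =>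
        pairPerm (wordPerm ω w) t = pairPerm (wordPerm ω w') t).card : ℝ) :=
        Finset.sum_le_sum fun ω _ => by exact_mod_cast hcount ω
    _ = ∑ t : DistinctPair α, ((univ.filter fun ω : κ → Perm α =>
        wordPerm ω w t.1.1 = wordPerm ω w' t.1.1 ∧
          wordPerm ω w t.1.2 = wordPerm ω w' t.1.2).card : ℝ) := by
        simp only [Finset.card_filter, pairPerm_eq_iff]
        push_cast
        exact Finset.sum_comm
    _ ≤ ∑ t : DistinctPair α, agreeBound (Fintype.card α) m * Fintype.card (κ → Perm α) :=
        Finset.sum_le_sum fun t _ => card_agree_le t.2 haa hss hx hx' (q := v.length + 1) (by simp)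
          (by simp [hlv']) hlv hmn
    _ = _ := by rw [Finset.sum_const, Finset.card_univ, nsmul_eq_mul]

/-- The mean square distance to uniformity of the action of random words on pairs. -/
lemma sum_transErr_le {m : ℕ} (hmn : 4 * m < Fintype.card α) [Nonempty (DistinctPair α)]
    [Nonempty κ] :
    ∑ ω : κ → Perm α, transErr (fun u : Fin m → κ => pairPerm (wordPerm ω (List.ofFn u))) ≤
      Fintype.card (κ → Perm α) * (Fintype.card (DistinctPair α) *
        (agreeBound (Fintype.card α) m + 1 / (Fintype.card κ : ℝ) ^ m) - 1) := by
  set Ω : ℝ := ((Fintype.card (κ → Perm α) : ℕ) : ℝ) with hΩ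
  set N : ℝ := ((Fintype.card (DistinctPair α) : ℕ) : ℝ) with hN
  set W : ℝ := (Fintype.card κ : ℝ) ^ m with hW
  have hW' : (Fintype.card (Fin m → κ) : ℝ) = W := by simp [hW]
  have hWpos : 0 < W := by rw [hW]; positivity
  have hb : 0 ≤ agreeBound (Fintype.card α) m := by
    have : (0 : ℝ) ≤ (Fintype.card α : ℝ) - 4 * m := by
      have : ((4 * m : ℕ) : ℝ) < Fintype.card α := by exact_mod_cast hmn
      push_cast at this; linarith
    unfold agreeBound
    positivity
  simp only [transErr_eq, hW']
  rw [Finset.sum_sub_distrib, ← Finset.sum_div, Finset.sum_comm]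
  have h1 : ∀ u : Fin m → κ, ∑ ω : κ → Perm α, ∑ u' : Fin m → κ,
      ((univ.filter fun t : DistinctPair α => pairPerm (wordPerm ω (List.ofFn u)) t =
        pairPerm (wordPerm ω (List.ofFn u')) t).card : ℝ) ≤
      Ω * N + W * (N * (agreeBound (Fintype.card α) m * Ω)) := by
    intro u
    rw [Finset.sum_comm, ← Finset.add_sum_erase _ _ (Finset.mem_univ u)]
    refine add_le_add ?_ ?_
    · simp [hΩ, hN, -Fintype.card_pi, -Fintype.card_subtype_compl]
    · calc _ ≤ ∑ u' ∈ univ.erase u, N * (agreeBound (Fintype.card α) m * Ω) :=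
            Finset.sum_le_sum fun u' hu' => sum_card_agree_le hmn _ _ (by simp) (by simp)
              (fun h => Finset.ne_of_mem_erase hu' (List.ofFn_injective h).symm)
        _ ≤ ∑ u' : Fin m → κ, N * (agreeBound (Fintype.card α) m * Ω) := by
            refine Finset.sum_le_sum_of_subset_of_nonneg (Finset.erase_subset _ _) fun _ _ _ => ?_
            positivity
        _ = _ := by rw [Finset.sum_const, Finset.card_univ, nsmul_eq_mul, hW']
  have h2 : (∑ u : Fin m → κ, ∑ ω : κ → Perm α, ∑ u' : Fin m → κ,
      ((univ.filter fun t : DistinctPair α => pairPerm (wordPerm ω (List.ofFn u)) t =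
        pairPerm (wordPerm ω (List.ofFn u')) t).card : ℝ)) / W ^ 2 ≤
      Ω * (N * (agreeBound (Fintype.card α) m + 1 / W)) := by
    rw [div_le_iff₀ (by positivity)]
    refine (Finset.sum_le_sum fun u _ => h1 u).trans_eq ?_
    rw [Finset.sum_const, Finset.card_univ, nsmul_eq_mul, hW']
    field_simp
    ring
  have h3 : ∑ ω : κ → Perm α, (1 : ℝ) = Ω := by
    rw [Finset.sum_const, Finset.card_univ, nsmul_eq_mul, mul_one]
  rw [h3]
  linarith

end WordCollisions

section MixingProbability

lemma agreeBound_estimate {n m : ℕ} (hm : 8 * m ≤ n) (hn : 1 ≤ n) (h2 : n ^ 5 ≤ 2 ^ m) :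
    (n : ℝ) * (n - 1) * (agreeBound n m + 1 / 2 ^ m) - 1 ≤
      (32 * m + 8 * (4 * m * (4 * m + 2)) ^ 3 + 1) / n := by
  have hn' : (1 : ℝ) ≤ n := by exact_mod_cast hn
  have hm' : (8 : ℝ) * m ≤ n := by exact_mod_cast hm
  have hm0 : (0 : ℝ) ≤ m := Nat.cast_nonneg m
  have h2' : (n : ℝ) ^ 5 ≤ 2 ^ m := by exact_mod_cast h2
  unfold agreeBound
  set d : ℝ := (n : ℝ) - 4 * m with hd
  have hd2 : (n : ℝ) / 2 ≤ d := by rw [hd]; linarith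
  have hdpos : 0 < d := by linarith
  set K : ℝ := (4 * m * (4 * m + 2)) ^ 3 with hK
  have hK0 : 0 ≤ K := by positivity
  have hNn : (n : ℝ) * (n - 1) ≤ n ^ 2 := by nlinarith
  have hN0 : (0 : ℝ) ≤ n * (n - 1) := mul_nonneg (by linarith) (by linarith)
  have a1 : (n : ℝ) ^ 2 * (1 / d ^ 2) - 1 ≤ 32 * m / n := by
    rw [mul_one_div, div_sub_one (by positivity), div_le_div_iff₀ (by positivity) (by linarith)]
    have : (n : ℝ) ^ 2 - d ^ 2 ≤ 8 * m * n := by rw [hd]; nlinarith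
    have h4 : (n : ℝ) ^ 2 ≤ 4 * d ^ 2 := by nlinarith
    nlinarith
  have a2 : (n : ℝ) ^ 2 * (K / d ^ 3) ≤ 8 * K / n := by
    rw [mul_div_assoc', div_le_div_iff₀ (by positivity) (by linarith)]
    have : (n : ℝ) ^ 3 ≤ 8 * d ^ 3 := by
      have := pow_le_pow_left₀ (by linarith) hd2 3
      rw [div_pow] at this; linarith
    nlinarith
  have a3 : (n : ℝ) ^ 2 * (1 / 2 ^ m) ≤ 1 / n := by
    rw [mul_one_div, div_le_div_iff₀ (by positivity) (by linarith)]
    calc (n : ℝ) ^ 2 * (n : ℝ) = (n : ℝ) ^ 3 := by ring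
      _ ≤ (n : ℝ) ^ 5 := pow_le_pow_right₀ hn' (by norm_num)
      _ ≤ _ := by rw [one_mul]; exact h2'
  calc _ ≤ (n : ℝ) ^ 2 * (1 / d ^ 2 + K / d ^ 3 + 1 / 2 ^ m) - 1 := by
        gcongr
    _ = ((n : ℝ) ^ 2 * (1 / d ^ 2) - 1) + n ^ 2 * (K / d ^ 3) + n ^ 2 * (1 / 2 ^ m) := by ring
    _ ≤ 32 * m / n + 8 * K / n + 1 / n := by linarith
    _ = _ := by ring

/-- The length of the words used for mixing. -/
def mixLength (n : ℕ) : ℕ := 5 * (Nat.log 2 n + 1)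

lemma mixLength_le {n : ℕ} (hn : 1 ≤ n) : (mixLength n : ℝ) ≤ 245 * (n : ℝ) ^ (1 / 24 : ℝ) := by
  have hn' : (1 : ℝ) ≤ n := by exact_mod_cast hn
  have h1 : (Nat.log 2 n : ℝ) * Real.log 2 ≤ Real.log n := by
    rw [← Real.log_pow]
    refine Real.log_le_log (by positivity) ?_
    exact_mod_cast Nat.pow_log_le_self 2 (by omega)
  have h2 := Real.log_two_gt_d9
  have h3 := Real.log_le_rpow_div (x := n) (by linarith) (ε := 1 / 24) (by norm_num)
  have h4 : (1 : ℝ) ≤ (n : ℝ) ^ (1 / 24 : ℝ) := Real.one_le_rpow hn' (by norm_num)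
  have h5 : (Nat.log 2 n : ℝ) ≤ 2 * Real.log n := by
    have : (0 : ℝ) ≤ Nat.log 2 n := Nat.cast_nonneg _
    nlinarith
  unfold mixLength
  push_cast
  linarith

/-- With high probability the words of logarithmic length in two random permutations contain a
family which mixes pairs of points. -/
theorem exists_pairMixing_of_random {ε : ℝ} (hε : 0 < ε) : ∃ N : ℕ, ∀ n : ℕ, N ≤ n →
    ((univ.filter fun p : Perm (Fin n) × Perm (Fin n) => 
      ¬ ∃ (ι : Type) (_ : Fintype ι) (_ : Nonempty ι) (π : ι → Perm (Fin n)),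
        PairMixing π ∧ ∀ i, π i ∈ wordBall (genSet p.1 p.2) (16 * mixLength n)).card : ℝ) ≤
      ε * (n.factorial : ℝ) ^ 2 := by
  obtain ⟨N₀, hN₀⟩ := Filter.eventually_atTop.1 
    (((tendsto_rpow_atTop (show (0 : ℝ) < 1 / 4 by norm_num)).comp
      tendsto_natCast_atTop_atTop).eventually_ge_atTop 
        (max 1960 ((32 * 245 + 8 * (980 * 982) ^ 3 + 1) / ε)))
  refine ⟨max N₀ 2, fun n hn => ?_⟩
  have hn2 : 2 ≤ n := (le_max_right _ _).trans hn
  have hbig := hN₀ n ((le_max_left _ _).trans hn)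
  simp only [Function.comp] at hbig
  set m := mixLength n with hm
  set s : ℝ := (n : ℝ) ^ (1 / 24 : ℝ) with hs
  have hn1 : (1 : ℝ) ≤ n := by exact_mod_cast (by omega : 1 ≤ n)
  have hs1 : 1 ≤ s := Real.one_le_rpow hn1 (by norm_num)
  have hs6 : (n : ℝ) ^ (1 / 4 : ℝ) = s ^ 6 := by
    rw [hs, ← Real.rpow_natCast, ← Real.rpow_mul (by linarith)]; norm_num
  have hs12 : √(n : ℝ) = s ^ 12 := by
    rw [Real.sqrt_eq_rpow, hs, ← Real.rpow_natCast, ← Real.rpow_mul (by linarith)]; norm_num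
  have hs24 : (n : ℝ) = s ^ 24 := by
    rw [hs, ← Real.rpow_natCast, ← Real.rpow_mul (by linarith)]; norm_num
  rw [hs6] at hbig
  have hb1 := (le_max_left _ _).trans hbig
  have hb2 := (le_max_right _ _).trans hbig
  rw [div_le_iff₀ hε] at hb2
  have hms : (m : ℝ) ≤ 245 * s := mixLength_le (by omega)
  have hmn : 8 * m ≤ n := by
    have : (8 * m : ℝ) ≤ n := by
      calc (8 * m : ℝ) ≤ 1960 * s := by linarith
        _ ≤ s ^ 6 * s := by gcongr
        _ = s ^ 7 := by ring
        _ ≤ s ^ 24 := pow_le_pow_right₀ hs1 (by norm_num)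
        _ = n := hs24.symm
    exact_mod_cast this
  have hm2 : n ^ 5 ≤ 2 ^ m := by
    rw [hm, mixLength, mul_comm, pow_mul]
    exact Nat.pow_le_pow_left (Nat.lt_pow_succ_log_self (by norm_num) n).le 5
  have hnp : Nonempty (DistinctPair (Fin n)) :=
    ⟨⟨(⟨0, by omega⟩, ⟨1, by omega⟩), by simp⟩⟩
  set δ : ℝ := (√(n : ℝ))⁻¹ with hδ
  have hδpos : 0 < δ := by rw [hδ]; positivity
  -- the mean
  have hmean := sum_transErr_le (κ := Bool) (α := Fin n) (m := m) (by simp; omega)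
  have hcard : Fintype.card (Bool → Perm (Fin n)) = n.factorial ^ 2 := by
    rw [Fintype.card_fun, Fintype.card_perm, Fintype.card_fin, Fintype.card_bool]
  have hcast : ((n * (n - 1) : ℕ) : ℝ) = n * (n - 1) := by
    rw [Nat.cast_mul, Nat.cast_sub (by omega)]; simp
  rw [hcard, card_distinctPair, Fintype.card_fin, hcast, Fintype.card_bool] at hmean
  push_cast at hmean
  have hest := agreeBound_estimate hmn (by omega) hm2
  have hnum : (32 * m + 8 * (4 * m * (4 * m + 2)) ^ 3 + 1 : ℝ) ≤
      (32 * 245 + 8 * (980 * 982) ^ 3 + 1) * s ^ 6 := by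
    have h0 : (0 : ℝ) ≤ m := Nat.cast_nonneg m
    have h1 : (4 * m * (4 * m + 2) : ℝ) ≤ (980 * s) * (982 * s) := by
      exact mul_le_mul (by linarith) (by linarith) (by linarith) (by linarith)
    have h2 : (4 * m * (4 * m + 2) : ℝ) ^ 3 ≤ ((980 * s) * (982 * s)) ^ 3 := by gcongr
    have h3 : s ≤ s ^ 6 := le_self_pow₀ hs1 (by norm_num)
    have h4 : 1 ≤ s ^ 6 := one_le_pow₀ hs1
    have h5 : ((980 * s) * (982 * s)) ^ 3 = (980 * 982) ^ 3 * s ^ 6 := by ring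
    rw [h5] at h2
    linarith
  have hmean2 : ∑ ω : Bool → Perm (Fin n),
      transErr (fun u : Fin m → Bool => pairPerm (wordPerm ω (List.ofFn u))) ≤
      (n.factorial : ℝ) ^ 2 * (ε * δ) := by
    refine hmean.trans (mul_le_mul_of_nonneg_left (hest.trans ?_) (by positivity))
    rw [div_le_iff₀ (by linarith), hδ, hs12, hs24]
    refine hnum.trans ?_
    calc _ ≤ (s ^ 6 * ε) * s ^ 6 := by gcongr
      _ = _ := by field_simp
  have hmarkov : ((univ.filter fun ω : Bool → Perm (Fin n) => ¬ 
      transErr (fun u : Fin m → Bool => pairPerm (wordPerm ω (List.ofFn u))) ≤ δ).card : ℝ) ≤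
      ε * (n.factorial : ℝ) ^ 2 := by
    have h1 : ((univ.filter fun ω : Bool → Perm (Fin n) => ¬ 
      transErr (fun u : Fin m → Bool => pairPerm (wordPerm ω (List.ofFn u))) ≤ δ).card : ℝ) * δ ≤
      ∑ ω : Bool → Perm (Fin n),
        transErr (fun u : Fin m → Bool => pairPerm (wordPerm ω (List.ofFn u))) := by
      rw [← nsmul_eq_mul, ← Finset.sum_const]
      refine (Finset.sum_le_sum fun ω hω => ?_).trans
        (Finset.sum_le_sum_of_subset_of_nonneg (Finset.filter_subset _ _) 
          fun _ _ _ => transErr_nonneg _)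
      exact (not_le.1 (Finset.mem_filter.1 hω).2).le
    have h2 := h1.trans hmean2
    rw [← mul_assoc] at h2
    have := le_of_mul_le_mul_right h2 hδpos
    linarith
  refine le_trans ?_ hmarkov
  refine Nat.cast_le.2 (Finset.card_le_card_of_injOn (fun p b => cond b p.1 p.2) ?_ ?_)
  · intro p hp
    simp only [Finset.coe_filter, Finset.mem_univ, true_and, Set.mem_ofPred_eq] at hp ⊢
    intro hle
    apply hp
    have hword : ∀ l : List Bool, wordPerm (fun b => cond b p.1 p.2) l ∈
        wordBall (genSet p.1 p.2) l.length := by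
      intro l
      induction l with
      | nil => exact one_mem_wordBall _ _
      | cons b l ih =>
        rw [wordPerm, List.length_cons]
        refine mul_mem_wordBall ih (mem_wordBall_one ?_)
        cases b <;> simp [genSet]
    obtain ⟨ι, i1, i2, π, h1, h2⟩ := exists_family_transErr_le (S := genSet p.1 p.2)
      (D := m) (fun u : Fin m → Bool => wordPerm (fun b => cond b p.1 p.2) (List.ofFn u))
      (fun u => by simpa using hword (List.ofFn u)) hle 4
    refine ⟨ι, i1, i2, π, pairMixing_of_transErr hn2 π (h2.trans_eq ?_), h1⟩
    have h16 : √(n : ℝ) ^ 16 = (n : ℝ) ^ 8 := by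
      rw [show (16 : ℕ) = 2 * 8 by norm_num, pow_mul, Real.sq_sqrt (by linarith)]
    rw [hδ, show (2 : ℕ) ^ 4 = 16 by norm_num, inv_pow, h16, ← pow_mul, inv_pow]
  · intro p _ p' _ h
    have h1 := congrFun h true
    have h2 := congrFun h false
    exact Prod.ext h1 h2

end MixingProbability

section CycleLength
variable {α β : Type*}

/-- The number of points of the cycle of `π` through `b`. -/
noncomputable def cycleLen [Fintype α] (π : Perm α) (b : α) : ℕ :=
  (univ.filter fun z => π.SameCycle b z).card

lemma cycleLen_congr [Fintype α] [Fintype β] (f : α ≃ β) (π : Perm α) (b : α) :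
    cycleLen (f.permCongr π) (f b) = cycleLen π b := by
  unfold cycleLen
  symm
  refine Finset.card_bij (fun z _ => f z) ?_ (fun _ _ _ _ h => f.injective h) ?_
  · intro z hz
    simp only [mem_filter, mem_univ, true_and] at hz ⊢
    obtain ⟨i, hi⟩ := hz.exists_nat_pow_eq
    refine ⟨i, ?_⟩
    have : f.permCongr π ^ i = f.permCongr (π ^ i) := (map_pow f.permCongrHom π i).symm
    rw [zpow_natCast, this]
    simp [hi]
  · intro y hy
    refine ⟨f.symm y, ?_, by simp⟩
    simp only [mem_filter, mem_univ, true_and] at hy ⊢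
    obtain ⟨i, hi⟩ := hy.exists_nat_pow_eq
    refine ⟨i, ?_⟩
    have : f.permCongr π ^ i = f.permCongr (π ^ i) := (map_pow f.permCongrHom π i).symm
    rw [this] at hi
    rw [zpow_natCast, ← hi]
    simp

lemma cycleLen_pos [Fintype α] (π : Perm α) (b : α) : 1 ≤ cycleLen π b :=
  Finset.card_pos.2 ⟨b, by simp [Perm.SameCycle.refl]⟩

lemma cycleLen_le [Fintype α] (π : Perm α) (b : α) : cycleLen π b ≤ Fintype.card α :=
  Finset.card_le_univ _

lemma sameCycle_swap_mul_optionCongr [Finite α] [DecidableEq α] (e : Perm α) (j z : α) :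
    (swap none (some j) * optionCongr e).SameCycle none (some z) ↔ e.SameCycle j z := by
  set π : Perm (Option α) := swap none (some j) * optionCongr e with hπ
  have hn : π none = some j := by simp [hπ]
  have hs : ∀ y, π (some y) = if e y = j then none else some (e y) := by
    intro y
    simp only [hπ, Perm.mul_apply, optionCongr_apply, Option.map_some]
    split_ifs with h
    · rw [h, swap_apply_right]
    · exact swap_apply_of_ne_of_ne (by simp) (by simpa using h)
  constructor
  · intro h
    obtain ⟨i, hi⟩ := h.exists_nat_pow_eq
    have key : ∀ i : ℕ, ∀ y, (π ^ i) none = some y → e.SameCycle j y := by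
      intro i
      induction i with
      | zero => intro y hy; simp at hy
      | succ i ih =>
        intro y hy
        rw [pow_succ', Perm.mul_apply] at hy
        rcases hx : (π ^ i) none with _ | x
        · rw [hx, hn] at hy
          cases hy
          exact Perm.SameCycle.refl _ _
        · rw [hx, hs] at hy
          split_ifs at hy with h'
          cases hy
          exact Perm.sameCycle_apply_right.2 (ih x hx)
    exact key i z hi
  · intro h
    obtain ⟨i, hi⟩ := h.exists_nat_pow_eq
    have key : ∀ i : ℕ, π.SameCycle none (some ((e ^ i) j)) := by
      intro i
      induction i with
      | zero => exact ⟨1, by simp [hn]⟩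
      | succ i ih =>
        rw [pow_succ', Perm.mul_apply]
        by_cases h' : e ((e ^ i) j) = j
        · rw [h']
          exact ⟨1, by simp [hn]⟩
        · have := hs ((e ^ i) j)
          rw [if_neg h'] at this
          rw [← this]
          exact Perm.sameCycle_apply_right.2 ih
    rw [← hi]
    exact key i

lemma cycleLen_swap_mul_optionCongr [Fintype α] [DecidableEq α] (e : Perm α) (j : α) :
    cycleLen (swap none (some j) * optionCongr e) none = cycleLen e j + 1 := by
  unfold cycleLen
  rw [Finset.card_filter, Fintype.sum_option, if_pos (Perm.SameCycle.refl _ _), Finset.card_filter,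
    add_comm]
  congr 1
  refine Finset.sum_congr rfl fun z _ => ?_
  have := sameCycle_swap_mul_optionCongr e j z
  by_cases h : e.SameCycle j z
  · rw [if_pos h, if_pos (this.2 h)]
  · rw [if_neg h, if_neg (mt this.1 h)]

lemma cycleLen_optionCongr [Fintype α] [DecidableEq α] (e : Perm α) :
    cycleLen (optionCongr e) none = 1 := by
  unfold cycleLen
  rw [Finset.card_eq_one]
  refine ⟨none, ?_⟩
  ext z
  simp only [mem_filter, mem_univ, true_and, mem_singleton]
  constructor
  · intro h
    exact (h.eq_of_left (by simp [Function.IsFixedPt])).symm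
  · rintro rfl
    exact Perm.SameCycle.refl _ _

lemma card_cycleLen_eq_option_le [Fintype α] [DecidableEq α]
    (ih : ∀ (b : α) (k : ℕ),
      (univ.filter fun e : Perm α => cycleLen e b = k).card ≤ (Fintype.card α - 1).factorial)
    (k : ℕ) :
    (univ.filter fun e : Perm (Option α) => cycleLen e none = k).card ≤
      (Fintype.card α).factorial := by
  have h1 : (univ.filter fun e : Perm (Option α) => cycleLen e none = k).card =
      ∑ x : Option α, (univ.filter fun e : Perm α =>
        cycleLen (swap none x * optionCongr e) none = k).card := by
    rw [Finset.card_filter, ← Equiv.sum_comp Perm.decomposeOption.symm, Fintype.sum_prod_type]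
    refine Finset.sum_congr rfl fun x _ => ?_
    rw [Finset.card_filter]
    refine Finset.sum_congr rfl fun e _ => ?_
    simp only [Perm.decomposeOption_symm_apply]
  rw [h1, Fintype.sum_option]
  have hswap : swap (none : Option α) none = 1 := swap_self _
  simp only [hswap, one_mul, cycleLen_optionCongr, cycleLen_swap_mul_optionCongr]
  by_cases hk : k = 1
  · subst hk
    have : ∀ j : α, (univ.filter fun e : Perm α => cycleLen e j + 1 = 1).card = 0 := by
      intro j
      rw [Finset.card_eq_zero, Finset.filter_eq_empty_iff]
      intro e _
      have := cycleLen_pos e j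
      omega
    rw [Finset.sum_eq_zero fun j _ => this j]
    simp [Fintype.card_perm]
  · have h0 : (univ.filter fun e : Perm α => 1 = k).card = 0 := by
      rw [Finset.card_eq_zero, Finset.filter_eq_empty_iff]
      intro e _
      omega
    rw [h0, zero_add]
    calc ∑ j : α, (univ.filter fun e : Perm α => cycleLen e j + 1 = k).card
        ≤ ∑ j : α, (Fintype.card α - 1).factorial := by
          refine Finset.sum_le_sum fun j _ => le_trans (Finset.card_le_card ?_) (ih j (k - 1))
          intro e
          simp only [mem_filter, mem_univ, true_and]
          omega
      _ ≤ _ := by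
          rw [Finset.sum_const, Finset.card_univ, smul_eq_mul]
          rcases Nat.eq_zero_or_pos (Fintype.card α) with h | h
          · simp [h]
          · exact (Nat.mul_factorial_pred h.ne').le

lemma card_cycleLen_eq_congr [Fintype α] [Fintype β] [DecidableEq α] [DecidableEq β]
    (f : α ≃ β) (b : α) (k : ℕ) :
    (univ.filter fun e : Perm β => cycleLen e (f b) = k).card =
      (univ.filter fun e : Perm α => cycleLen e b = k).card := by
  rw [Finset.card_filter, ← Equiv.sum_comp f.permCongr, Finset.card_filter]
  simp only [cycleLen_congr]

/-- Every cycle length is attained at a given point by at most `(|α| - 1)!` permutations. -/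
lemma card_cycleLen_eq_le [Fintype α] [DecidableEq α] (b : α) (k : ℕ) :
    (univ.filter fun e : Perm α => cycleLen e b = k).card ≤ (Fintype.card α - 1).factorial := by
  have main : ∀ (m : ℕ) (b : Fin m) (k : ℕ),
      (univ.filter fun e : Perm (Fin m) => cycleLen e b = k).card ≤ (m - 1).factorial := by
    intro m
    induction m with
    | zero => intro b; exact b.elim0
    | succ m ih =>
      intro b k
      let f : Option (Fin m) ≃ Fin (m + 1) := finSuccEquiv' b |>.symm
      have hf : f none = b := finSuccEquiv'_symm_none b
      have h1 := card_cycleLen_eq_congr f none k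
      rw [hf] at h1
      rw [h1]
      have := card_cycleLen_eq_option_le (α := Fin m) (by simpa using ih) k
      simpa using this
  have h1 := card_cycleLen_eq_congr (Fintype.equivFin α) b k
  rw [← h1]
  exact main _ _ k

lemma card_cycleLen_mem_le [Fintype α] [DecidableEq α] (b : α) (A : Finset ℕ) :
    (univ.filter fun e : Perm α => cycleLen e b ∈ A).card ≤
      A.card * (Fintype.card α - 1).factorial := by
  have : (univ.filter fun e : Perm α => cycleLen e b ∈ A) =
      A.biUnion fun k => univ.filter fun e : Perm α => cycleLen e b = k := by
    ext e; simp
  rw [this]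
  exact Finset.card_biUnion_le_card_mul _ _ _ fun k _ => card_cycleLen_eq_le b k

lemma card_cycleLen_mem [Fintype α] [DecidableEq α] (b : α) (A : Finset ℕ)
    (hA : A ⊆ Finset.Icc 1 (Fintype.card α)) :
    (univ.filter fun e : Perm α => cycleLen e b ∈ A).card =
      A.card * (Fintype.card α - 1).factorial := by
  refine le_antisymm (card_cycleLen_mem_le b A) ?_
  have h1 := card_cycleLen_mem_le b (Finset.Icc 1 (Fintype.card α) \ A)
  have h2 : (univ.filter fun e : Perm α => cycleLen e b ∈ A).card +
      (univ.filter fun e : Perm α => cycleLen e b ∈ Finset.Icc 1 (Fintype.card α) \ A).card =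
        (Fintype.card α).factorial := by
    rw [← Fintype.card_perm, ← Finset.card_univ (α := Perm α),
      ← Finset.card_filter_add_card_filter_not (s := univ) fun e : Perm α => cycleLen e b ∈ A]
    congr 2
    ext e
    simp [cycleLen_le, cycleLen_pos]
  have h3 : (Finset.Icc 1 (Fintype.card α) \ A).card + A.card = Fintype.card α := by
    rw [Finset.card_sdiff_add_card_eq_card hA]; simp
  have h4 : Fintype.card α * (Fintype.card α - 1).factorial = (Fintype.card α).factorial :=
    Nat.mul_factorial_pred (Fintype.card_pos_iff.2 ⟨b⟩).ne'
  nlinarith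

end CycleLength

section CycleVariance
variable {β : Type*} [Fintype β] [DecidableEq β]

noncomputable def pairCount (b x y : β) : ℝ :=
  ((univ.filter fun π : Perm β => π.SameCycle b x ∧ π.SameCycle b y).card : ℝ)

lemma pairCount_apply (b x y : β) (s : Perm β) (hs : s b = b) :
    pairCount b (s x) (s y) = pairCount b x y := by
  unfold pairCount
  congr 1
  have hs' : s⁻¹ b = b := by rw [Perm.inv_eq_iff_eq, hs]
  symm
  refine Finset.card_bij (fun π _ => s * π * s⁻¹) ?_ ?_ ?_
  · intro π hπ
    simp only [mem_filter, mem_univ, true_and] at hπ ⊢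
    rw [Perm.sameCycle_conj, Perm.sameCycle_conj, hs']
    simpa using hπ
  · intro π _ π' _ h
    simpa using h
  · intro π hπ
    simp only [mem_filter, mem_univ, true_and] at hπ
    refine ⟨s⁻¹ * π * s⁻¹⁻¹, ?_, by group⟩
    simp only [mem_filter, mem_univ, true_and]
    rw [Perm.sameCycle_conj, Perm.sameCycle_conj, inv_inv, hs]
    exact hπ

lemma pairCount_comm (b x y : β) : pairCount b x y = pairCount b y x := by
  unfold pairCount
  simp only [and_comm]

lemma pairCount_self_left (b x : β) : pairCount b b x = pairCount b x x := by
  unfold pairCount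
  simp [Perm.SameCycle.refl]

lemma pairCount_nonneg (b x y : β) : 0 ≤ pairCount b x y := Nat.cast_nonneg _

lemma pairCount_le (b x y : β) : pairCount b x y ≤ pairCount b x x := by
  unfold pairCount
  exact_mod_cast Finset.card_le_card fun π => by
    simp only [mem_filter, mem_univ, true_and]; tauto

lemma pairCount_self_le (b x : β) : pairCount b x x ≤ ((Fintype.card β).factorial : ℝ) := by
  unfold pairCount
  rw [← Fintype.card_perm]
  exact_mod_cast Finset.card_le_univ _

lemma pairCount_self_self (b : β) : pairCount b b b = ((Fintype.card β).factorial : ℝ) := by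
  unfold pairCount
  simp [Perm.SameCycle.refl, Finset.card_univ, Fintype.card_perm]

lemma exists_pairCount_eq (b : β) : ∃ a p : ℝ, 0 ≤ p ∧ p ≤ a ∧ a ≤ ((Fintype.card β).factorial : ℝ) ∧
    (∀ x, x ≠ b → pairCount b x x = a) ∧
      ∀ x y, x ≠ b → y ≠ b → x ≠ y → pairCount b x y = p := by
  by_cases h1 : ∃ x, x ≠ b
  swap
  · push Not at h1
    exact ⟨0, 0, le_rfl, le_rfl, Nat.cast_nonneg _, fun x hx => absurd (h1 x) hx,
      fun x y hx => absurd (h1 x) hx⟩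
  obtain ⟨u, hu⟩ := h1
  have hdiag : ∀ x, x ≠ b → pairCount b x x = pairCount b u u := by
    intro x hx
    have := pairCount_apply b u u (swap u x) (swap_apply_of_ne_of_ne hu.symm hx.symm)
    rwa [swap_apply_left] at this
  by_cases h2 : ∃ v, v ≠ b ∧ v ≠ u
  swap
  · push Not at h2
    refine ⟨pairCount b u u, pairCount b u u, pairCount_nonneg _ _ _, le_rfl,
      pairCount_self_le _ _, hdiag, fun x y hx hy hxy => absurd ?_ hxy⟩
    rw [h2 x hx, h2 y hy]
  obtain ⟨v, hv, hvu⟩ := h2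
  refine ⟨pairCount b u u, pairCount b u v, pairCount_nonneg _ _ _, pairCount_le _ _ _,
    pairCount_self_le _ _, hdiag, fun x y hx hy hxy => ?_⟩
  have e1 := pairCount_apply b u v (swap u x) (swap_apply_of_ne_of_ne hu.symm hx.symm)
  rw [swap_apply_left] at e1
  have hvx : swap u x v ≠ x := by
    intro h
    have : swap u x v = swap u x u := by rw [h, swap_apply_left]
    exact hvu ((swap u x).injective this)
  have hvb : swap u x v ≠ b := by
    intro h
    have : swap u x v = swap u x b := by rw [h, swap_apply_of_ne_of_ne hu.symm hx.symm]
    exact hv ((swap u x).injective this)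
  have e2 := pairCount_apply b x (swap u x v) (swap (swap u x v) y)
    (swap_apply_of_ne_of_ne hvb.symm hy.symm)
  rw [swap_apply_left, swap_apply_of_ne_of_ne hvx.symm hxy] at e2
  rw [e2, e1]

/-- The variance of the weight of the cycle through `b`, for a weight of total mass zero. -/
lemma sum_sq_cycleWeight_le (b : β) (d : β → ℝ) (hd : ∑ x, d x = 0) :
    ∑ π : Perm β, (∑ x, if π.SameCycle b x then d x else 0) ^ 2 ≤
      ((Fintype.card β).factorial : ℝ) * ∑ x, d x ^ 2 := by
  have h1 : ∑ π : Perm β, (∑ x, if π.SameCycle b x then d x else 0) ^ 2 =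
      ∑ x, ∑ y, d x * d y * pairCount b x y := by
    simp only [sq, Finset.sum_mul_sum]
    rw [Finset.sum_comm]
    refine Finset.sum_congr rfl fun x _ => ?_
    rw [Finset.sum_comm]
    refine Finset.sum_congr rfl fun y _ => ?_
    unfold pairCount
    rw [Finset.card_filter, Nat.cast_sum, Finset.mul_sum]
    refine Finset.sum_congr rfl fun π _ => ?_
    by_cases hx : π.SameCycle b x <;> by_cases hy : π.SameCycle b y <;> simp [hx, hy]
  obtain ⟨a, p, hp, hpa, haF, hdiag, hoff⟩ := exists_pairCount_eq b
  set F : ℝ := ((Fintype.card β).factorial : ℝ) with hF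
  have h2 : ∀ x y, pairCount b x y = p + (a - p) * (if x = y then 1 else 0) +
      (a - p) * (if x = b then 1 else 0) + (a - p) * (if y = b then 1 else 0) +
        (F - 3 * a + 2 * p) * ((if x = b then 1 else 0) * (if y = b then 1 else 0)) := by
    intro x y
    by_cases hx : x = b
    · by_cases hy : y = b
      · subst hx; subst hy
        rw [pairCount_self_self]; simp; ring
      · subst hx
        rw [pairCount_self_left, hdiag y hy]; simp [hy, Ne.symm hy]
    · by_cases hy : y = b
      · subst hy
        rw [pairCount_comm, pairCount_self_left, hdiag x hx]; simp [hx]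
      · by_cases hxy : x = y
        · subst hxy
          rw [hdiag x hx]; simp [hx]
        · rw [hoff x y hx hy hxy]; simp [hx, hy, hxy]
  have h3 : ∑ x, ∑ y, d x * d y * pairCount b x y =
      (a - p) * ∑ x, d x ^ 2 + (F - 3 * a + 2 * p) * d b ^ 2 := by
    have e : ∀ x, ∑ y, d x * d y * pairCount b x y =
        (p * d x) * (∑ y, d y) + (a - p) * d x ^ 2 +
          ((a - p) * (if x = b then d x else 0)) * (∑ y, d y) + (a - p) * d x * d b +
            (F - 3 * a + 2 * p) * (if x = b then d x * d b else 0) := by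
      intro x
      have t1 : d x ^ 2 = ∑ y, (if x = y then d x * d y else 0) := by
        rw [Finset.sum_ite_eq]; simp [sq]
      have t2 : d b = ∑ y, (if y = b then d y else 0) := by
        rw [Finset.sum_ite_eq']; simp
      have t3 : (if x = b then d x * d b else 0) =
          ∑ y, (if x = b then d x else 0) * (if y = b then d y else 0) := by
        rw [← Finset.mul_sum, ← t2]; split_ifs <;> simp
      rw [t3, t1]
      rw [t2]
      simp only [Finset.mul_sum, ← Finset.sum_add_distrib]
      refine Finset.sum_congr rfl fun y _ => ?_
      rw [h2]
      split_ifs <;> ring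
    simp only [e, hd, mul_zero, add_zero, zero_add, Finset.sum_add_distrib]
    rw [← Finset.mul_sum, ← Finset.sum_mul, ← Finset.mul_sum, hd, ← Finset.mul_sum,
      Finset.sum_ite_eq' univ b fun x => d x * d b]
    rw [if_pos (Finset.mem_univ b)]
    ring
  rw [h1, h3]
  have h4 : d b ^ 2 ≤ ∑ x, d x ^ 2 :=
    Finset.single_le_sum (f := fun x => d x ^ 2) (fun x _ => sq_nonneg _) (Finset.mem_univ b)
  nlinarith [mul_nonneg (by linarith : 0 ≤ F - a + p) (sub_nonneg.2 h4),
    mul_nonneg (by linarith : 0 ≤ 2 * a - p) (sq_nonneg (d b))]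

end CycleVariance

section FirstReturn
variable {α : Type*} [Finite α]

lemma exists_return (θ : Perm α) (B : Finset α) (b : B) : ∃ k, 1 ≤ k ∧ (θ ^ k) b ∈ B :=
  ⟨orderOf θ, orderOf_pos θ, by simp [pow_orderOf_eq_one]⟩

noncomputable def returnTime (θ : Perm α) (B : Finset α) (b : B) : ℕ :=
  Nat.find (exists_return θ B b)

lemma one_le_returnTime (θ : Perm α) (B : Finset α) (b : B) : 1 ≤ returnTime θ B b :=
  (Nat.find_spec (exists_return θ B b)).1

lemma pow_apply_notMem_of_lt_returnTime {θ : Perm α} {B : Finset α} {b : B} {k : ℕ} (hk : 1 ≤ k)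
    (h : k < returnTime θ B b) : (θ ^ k) b ∉ B :=
  fun hB => Nat.find_min (exists_return θ B b) h ⟨hk, hB⟩

noncomputable def firstReturn (θ : Perm α) (B : Finset α) : Perm B :=
  Equiv.ofBijective (fun b => ⟨(θ ^ returnTime θ B b) b, (Nat.find_spec (exists_return θ B b)).2⟩) <| by
    rw [← Finite.injective_iff_bijective]
    have key : ∀ b b' : B, returnTime θ B b ≤ returnTime θ B b' →
        (θ ^ returnTime θ B b) (b : α) = (θ ^ returnTime θ B b') (b' : α) → b = b' := by
      intro b b' hle h
      obtain ⟨j, hj⟩ := Nat.exists_eq_add_of_le hle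
      rw [hj, pow_add, Perm.mul_apply] at h
      have h' := (θ ^ returnTime θ B b).injective h
      rcases Nat.eq_zero_or_pos j with rfl | hpos
      · exact Subtype.ext (by rwa [pow_zero, Perm.one_apply] at h')
      · exfalso
        have := one_le_returnTime θ B b
        exact pow_apply_notMem_of_lt_returnTime hpos (by omega) (h' ▸ b.2)
    intro b b' h
    have h' : (θ ^ returnTime θ B b) (b : α) = (θ ^ returnTime θ B b') (b' : α) :=
      congrArg Subtype.val h
    rcases le_total (returnTime θ B b) (returnTime θ B b') with hle | hle
    · exact key b b' hle h'
    · exact (key b' b hle h'.symm).symm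

omit [Finite α] in
lemma mul_ofSubtype_apply_of_notMem [DecidableEq α] (θ : Perm α) {B : Finset α} (ρ : Perm B) {z : α} (hz : z ∉ B) :
    (θ * Perm.ofSubtype ρ) z = θ z := by
  rw [Perm.mul_apply, Perm.ofSubtype_apply_of_not_mem ρ hz]

lemma mul_ofSubtype_pow_apply [DecidableEq α] (θ : Perm α) {B : Finset α} (ρ : Perm B) (b : B) (j : ℕ)
    (hj : j < returnTime θ B (ρ b)) :
    ((θ * Perm.ofSubtype ρ) ^ (j + 1)) (b : α) = (θ ^ (j + 1)) (ρ b : α) := by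
  induction j with
  | zero => simp [Perm.ofSubtype_apply_coe]
  | succ j ih =>
    rw [pow_succ', Perm.mul_apply, ih (by omega), pow_succ' θ (j + 1), Perm.mul_apply θ]
    refine mul_ofSubtype_apply_of_notMem θ ρ ?_
    exact pow_apply_notMem_of_lt_returnTime (by omega) hj

lemma mul_ofSubtype_pow_returnTime [DecidableEq α] (θ : Perm α) {B : Finset α} (ρ : Perm B) (b : B) :
    ((θ * Perm.ofSubtype ρ) ^ returnTime θ B (ρ b)) (b : α) = (firstReturn θ B * ρ) b := by
  have h1 : 1 ≤ returnTime θ B (ρ b) := one_le_returnTime _ _ _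
  have := mul_ofSubtype_pow_apply θ ρ b (returnTime θ B (ρ b) - 1) (by omega)
  rw [Nat.sub_add_cancel h1] at this
  rw [this]
  rfl

/-- Multiplying by a permutation of `B` acts on cycles meeting `B` as on the induced map. -/
lemma sameCycle_firstReturn [DecidableEq α] (θ : Perm α) {B : Finset α} (ρ : Perm B) (b b' : B) :
    (θ * Perm.ofSubtype ρ).SameCycle (b : α) b' ↔ (firstReturn θ B * ρ).SameCycle b b' := by
  constructor
  · intro h
    obtain ⟨m, hm⟩ := h.exists_nat_pow_eq
    induction m using Nat.strong_induction_on generalizing b with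
    | _ m ih =>
      rcases Nat.eq_zero_or_pos m with rfl | hpos
      · have : b = b' := Subtype.ext (by simpa using hm)
        rw [this]
      · rcases lt_or_ge m (returnTime θ B (ρ b)) with hlt | hge
        · exfalso
          have e := mul_ofSubtype_pow_apply θ ρ b (m - 1) (by omega)
          rw [Nat.sub_add_cancel hpos, hm] at e
          exact pow_apply_notMem_of_lt_returnTime hpos hlt (e ▸ b'.2)
        · have h1 : 1 ≤ returnTime θ B (ρ b) := one_le_returnTime _ _ _
          have e := hm
          rw [← Nat.sub_add_cancel hge, pow_add, Perm.mul_apply, mul_ofSubtype_pow_returnTime] at e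
          have h2 := ih (m - returnTime θ B (ρ b)) (by omega) _ ⟨_, by rw [zpow_natCast, e]⟩ e
          exact Perm.sameCycle_apply_left.1 h2
  · intro h
    obtain ⟨i, hi⟩ := h.exists_nat_pow_eq
    have key : ∀ i : ℕ, (θ * Perm.ofSubtype ρ).SameCycle (b : α) (((firstReturn θ B * ρ) ^ i) b : B) := by
      intro i
      induction i with
      | zero => exact Perm.SameCycle.refl _ _
      | succ i ih =>
        rw [pow_succ', Perm.mul_apply, ← mul_ofSubtype_pow_returnTime]
        exact Perm.sameCycle_pow_right.2 ih
    rw [← hi]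
    exact key i

end FirstReturn

lemma Finset.card_le_of_forall_mem_interval (A : Finset ℕ) {a b : ℝ} (hab : a ≤ b)
    (h : ∀ k ∈ A, a ≤ k ∧ (k : ℝ) ≤ b) : (A.card : ℝ) ≤ b - a + 1 := by
  rcases A.eq_empty_or_nonempty with rfl | hA
  · simp; linarith
  · have h1 : A ⊆ Finset.Icc (A.min' hA) (A.max' hA) := fun k hk =>
      Finset.mem_Icc.2 ⟨A.min'_le k hk, A.le_max' k hk⟩
    have h2 := Finset.card_le_card h1
    rw [Nat.card_Icc] at h2
    have h3 : A.min' hA ≤ A.max' hA := A.min'_le _ (A.max'_mem hA)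
    have h4 : A.card + A.min' hA ≤ A.max' hA + 1 := by omega
    have h5 : (A.card : ℝ) + A.min' hA ≤ A.max' hA + 1 := by exact_mod_cast h4
    have h6 := (h _ (A.min'_mem hA)).1
    have h7 := (h _ (A.max'_mem hA)).2
    linarith

section WeightedCycle
variable {β : Type*} [Fintype β] [DecidableEq β]

/-- The total weight of the cycle of `π` through `b`. -/
noncomputable def cycleWeight (r : β → ℕ) (b : β) (π : Perm β) : ℕ :=
  ∑ x, if π.SameCycle b x then r x else 0

lemma card_cycleWeight_mem_le (r : β → ℕ) (b : β) {t n Z lo hi : ℕ} (hr : ∀ x, r x ≤ t)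
    (hsum : ∑ x, r x + Z = n) (hZ : Z < n) (hlh : lo ≤ hi) {η : ℝ} (hη : 0 < η) :
    ((univ.filter fun π : Perm β => lo ≤ cycleWeight r b π + Z ∧ cycleWeight r b π ≤ hi).card : ℝ) ≤
      ((Fintype.card β).factorial : ℝ) * (t / (η ^ 2 * n) +
        (hi - lo + 2 * η * n + Z) / ((n : ℝ) - Z) + 1 / Fintype.card β) := by
  have hMpos : 0 < Fintype.card β := Fintype.card_pos_iff.2 ⟨b⟩
  set M := Fintype.card β with hM
  have hM' : (0 : ℝ) < M := by exact_mod_cast hMpos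
  have hn : (0 : ℝ) < n := by exact_mod_cast (by omega : 0 < n)
  have hnZ : (0 : ℝ) < (n : ℝ) - Z := sub_pos.2 (by exact_mod_cast hZ)
  have hlh' : (lo : ℝ) ≤ hi := by exact_mod_cast hlh
  have hsum' : ∑ x, (r x : ℝ) = n - Z := by
    have : (∑ x, (r x : ℝ)) + Z = n := by exact_mod_cast hsum
    linarith
  set m : ℝ := (n - Z) / M with hm
  have hmpos : 0 < m := div_pos hnZ hM'
  have hmM : m * M = n - Z := div_mul_cancel₀ _ hM'.ne'
  set d : β → ℝ := fun x => r x - m with hd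
  have hd0 : ∑ x, d x = 0 := by
    simp only [hd, Finset.sum_sub_distrib, hsum', Finset.sum_const, Finset.card_univ, nsmul_eq_mul]
    linarith [hmM]
  have hd2 : ∑ x, d x ^ 2 ≤ t * n := by
    have e1 : ∑ x, d x ^ 2 = ∑ x, (r x : ℝ) ^ 2 - m * (n - Z) := by
      have : ∀ x, d x ^ 2 = (r x : ℝ) ^ 2 - m * r x - m * d x := fun x => by simp only [hd]; ring
      simp only [this, Finset.sum_sub_distrib, ← Finset.mul_sum, hd0, hsum']
      ring
    have e2 : ∑ x, (r x : ℝ) ^ 2 ≤ t * (n - Z) := by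
      rw [← hsum', Finset.mul_sum]
      refine Finset.sum_le_sum fun x _ => ?_
      have : (r x : ℝ) ≤ t := by exact_mod_cast hr x
      rw [sq]
      exact mul_le_mul_of_nonneg_right this (Nat.cast_nonneg _)
    have : 0 ≤ (t : ℝ) * Z := by positivity
    nlinarith [mul_pos hmpos hnZ]
  let dev : Perm β → ℝ := fun π => ∑ x, if π.SameCycle b x then d x else 0
  have hW : ∀ π, (cycleWeight r b π : ℝ) = m * cycleLen π b + dev π := by
    intro π
    simp only [cycleWeight, cycleLen, dev, Finset.card_filter, Nat.cast_sum, Finset.mul_sum,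
      ← Finset.sum_add_distrib]
    refine Finset.sum_congr rfl fun x _ => ?_
    by_cases h : π.SameCycle b x
    · simp [h, hd]
    · simp [h]
  let A : Finset ℕ := (Finset.range (M + 1)).filter fun k =>
    (lo : ℝ) - Z - η * n ≤ m * k ∧ m * k ≤ hi + η * n
  have hA : (A.card : ℝ) ≤ (hi - lo + 2 * η * n + Z) / m + 1 := by
    have := A.card_le_of_forall_mem_interval (a := (lo - Z - η * n) / m) (b := (hi + η * n) / m)
      (by gcongr
          have : 0 < η * n := mul_pos hη hn
          have : (0 : ℝ) ≤ Z := Nat.cast_nonneg _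
          linarith) (by
        intro k hk
        have := (Finset.mem_filter.1 hk).2
        rw [div_le_iff₀ hmpos, le_div_iff₀ hmpos]
        constructor <;> linarith [this.1, this.2])
    have e : (hi - lo + 2 * η * n + Z) / m = (hi + η * n) / m - (lo - Z - η * n) / m := by ring
    rw [e]; exact this
  have hdev : ((univ.filter fun π : Perm β => η * n < |dev π|).card : ℝ) ≤
      (M.factorial : ℝ) * (t / (η ^ 2 * n)) := by
    have e1 := sum_sq_cycleWeight_le b d hd0
    have e2 : ((univ.filter fun π : Perm β => η * n < |dev π|).card : ℝ) * (η * n) ^ 2 ≤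
        ∑ π, dev π ^ 2 := by
      rw [← nsmul_eq_mul]
      refine le_trans (Finset.card_nsmul_le_sum _ (fun π => dev π ^ 2) _ ?_)
        (Finset.sum_le_sum_of_subset_of_nonneg (Finset.filter_subset _ _) fun _ _ _ => sq_nonneg _)
      intro π hπ
      rw [← sq_abs (dev π)]
      have := (Finset.mem_filter.1 hπ).2
      have h0 : 0 < η * n := mul_pos hη hn
      gcongr
    have e3 : ((univ.filter fun π : Perm β => η * n < |dev π|).card : ℝ) * (η * n) ^ 2 ≤
        (M.factorial : ℝ) * (t * n) :=
      e2.trans (e1.trans (mul_le_mul_of_nonneg_left hd2 (Nat.cast_nonneg _)))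
    rw [← le_div_iff₀ (by positivity)] at e3
    refine e3.trans (le_of_eq ?_)
    field_simp
  have hsub : (univ.filter fun π : Perm β => lo ≤ cycleWeight r b π + Z ∧ cycleWeight r b π ≤ hi) ⊆
      (univ.filter fun π : Perm β => η * n < |dev π|) ∪
        univ.filter fun π : Perm β => cycleLen π b ∈ A := by
    intro π hπ
    simp only [mem_filter, mem_univ, true_and, mem_union] at hπ ⊢
    by_contra! hcon
    obtain ⟨hc1, hc2⟩ := hcon
    apply hc2
    refine Finset.mem_filter.2 ⟨Finset.mem_range.2 (Nat.lt_succ_of_le (cycleLen_le _ _)), ?_⟩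
    have h1 : (lo : ℝ) ≤ cycleWeight r b π + Z := by exact_mod_cast hπ.1
    have h2 : (cycleWeight r b π : ℝ) ≤ hi := by exact_mod_cast hπ.2
    rw [hW] at h1 h2
    have := abs_le.1 hc1
    constructor <;> linarith [this.1, this.2]
  have hfact : (M : ℝ) * (M - 1).factorial = M.factorial := by
    exact_mod_cast Nat.mul_factorial_pred hMpos.ne'
  calc ((univ.filter fun π : Perm β =>
        lo ≤ cycleWeight r b π + Z ∧ cycleWeight r b π ≤ hi).card : ℝ)
      ≤ ((univ.filter fun π : Perm β => η * n < |dev π|).card : ℝ) +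
          (univ.filter fun π : Perm β => cycleLen π b ∈ A).card := by
        exact_mod_cast (Finset.card_le_card hsub).trans (Finset.card_union_le _ _)
    _ ≤ (M.factorial : ℝ) * (t / (η ^ 2 * n)) + A.card * (M - 1).factorial := by
        refine add_le_add hdev ?_
        exact_mod_cast card_cycleLen_mem_le b A
    _ ≤ (M.factorial : ℝ) * (t / (η ^ 2 * n)) +
          ((hi - lo + 2 * η * n + Z) / m + 1) * (M - 1).factorial := by gcongr
    _ = _ := by
        rw [← hfact, hm]
        field_simp
        ring

end WeightedCycle

section Retract
variable {α : Type*} [Fintype α] [DecidableEq α]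

/-- The first point of `B` among `z, θ z, …, θ ^ (t - 1) z`. -/
noncomputable def retract (θ : Perm α) (B : Finset α) (t : ℕ) (z : α) : Option B :=
  if h : ∃ i, i < t ∧ (θ ^ i) z ∈ B then some ⟨(θ ^ Nat.find h) z, (Nat.find_spec h).2⟩ else none

omit [Fintype α] in
lemma retract_eq_none_iff {θ : Perm α} {B : Finset α} {t : ℕ} {z : α} :
    retract θ B t z = none ↔ ∀ i < t, (θ ^ i) z ∉ B := by
  unfold retract
  split_ifs with h
  · simp only [false_iff]
    obtain ⟨i, hi⟩ := h
    exact fun h => h i hi.1 hi.2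
  · push Not at h
    exact iff_of_true rfl h

omit [Fintype α] in
lemma exists_of_retract_eq_some {θ : Perm α} {B : Finset α} {t : ℕ} {z : α} {b : B}
    (h : retract θ B t z = some b) :
    ∃ i < t, (θ ^ i) z = b ∧ ∀ j < i, (θ ^ j) z ∉ B := by
  unfold retract at h
  split_ifs at h with h'
  have hspec := Nat.find_spec h'
  have hmin := fun j => Nat.find_min h' (m := j)
  cases h
  exact ⟨_, hspec.1, rfl, fun j hj hB => hmin j hj ⟨hj.trans hspec.1, hB⟩⟩

lemma card_retract_eq_some_le (θ : Perm α) (B : Finset α) (t : ℕ) (b : B) :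
    (univ.filter fun z => retract θ B t z = some b).card ≤ t := by
  have : (univ.filter fun z => retract θ B t z = some b) ⊆
      (Finset.range t).image fun i => (θ ^ i)⁻¹ (b : α) := by
    intro z hz
    obtain ⟨i, hi, h, -⟩ := exists_of_retract_eq_some (Finset.mem_filter.1 hz).2
    refine Finset.mem_image.2 ⟨i, Finset.mem_range.2 hi, ?_⟩
    rw [← h]; simp
  exact (Finset.card_le_card this).trans (Finset.card_image_le.trans (by simp))

lemma sum_card_retract (θ : Perm α) (B : Finset α) (t : ℕ) (P : α → Prop)
    [DecidablePred P] :
    ∑ b : B, (univ.filter fun z => P z ∧ retract θ B t z = some b).card +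
      (univ.filter fun z => P z ∧ retract θ B t z = none).card = (univ.filter fun z => P z).card := by
  have := Finset.card_eq_sum_card_fiberwise (s := univ.filter fun z => P z) (t := univ)
    (f := retract θ B t) (fun _ _ => Finset.mem_coe.2 (Finset.mem_univ _))
  rw [this, Fintype.sum_option, add_comm]
  simp only [Finset.filter_filter]

omit [Fintype α] in
lemma sameCycle_of_retract {θ : Perm α} {B : Finset α} {t : ℕ} {z : α} {b : B}
    (h : retract θ B t z = some b) (ρ : Perm B) : (θ * Perm.ofSubtype ρ).SameCycle (b : α) z := by
  obtain ⟨i, -, h, hj⟩ := exists_of_retract_eq_some h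
  refine Perm.SameCycle.symm ⟨i, ?_⟩
  have key : ∀ j ≤ i, ((θ * Perm.ofSubtype ρ) ^ j) z = (θ ^ j) z := by
    intro j
    induction j with
    | zero => simp
    | succ j ih =>
      intro hji
      rw [pow_succ', Perm.mul_apply, ih (by omega), pow_succ' θ, Perm.mul_apply θ]
      exact mul_ofSubtype_apply_of_notMem θ ρ (hj j (by omega))
  rw [zpow_natCast, key i le_rfl, h]

omit [DecidableEq α] in
lemma cycleLen_eq_of_sameCycle {π : Perm α} {x y : α} (h : π.SameCycle x y) :
    cycleLen π x = cycleLen π y := by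
  unfold cycleLen
  congr 1
  ext z
  simp only [mem_filter, mem_univ, true_and]
  exact ⟨fun hz => h.symm.trans hz, fun hz => h.trans hz⟩

lemma cycleLen_bounds (θ : Perm α) (B : Finset α) (t : ℕ) (ρ : Perm B) (b : B) :
    let r : B → ℕ := fun b => (univ.filter fun z => retract θ B t z = some b).card
    let Z := (univ.filter fun z => ∀ i < t, (θ ^ i) z ∉ B).card
    cycleWeight r b (firstReturn θ B * ρ) ≤ cycleLen (θ * Perm.ofSubtype ρ) b ∧
      cycleLen (θ * Perm.ofSubtype ρ) b ≤ cycleWeight r b (firstReturn θ B * ρ) + Z := by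
  intro r Z
  have h1 := sum_card_retract θ B t fun z => (θ * Perm.ofSubtype ρ).SameCycle (b : α) z
  have h2 : ∑ b' : B, (univ.filter fun z => (θ * Perm.ofSubtype ρ).SameCycle (b : α) z ∧
      retract θ B t z = some b').card = cycleWeight r b (firstReturn θ B * ρ) := by
    refine Finset.sum_congr rfl fun b' _ => ?_
    have hfr := sameCycle_firstReturn θ ρ b b'
    by_cases h : (firstReturn θ B * ρ).SameCycle b b'
    · rw [if_pos h]
      replace h := hfr.2 h
      congr 1
      ext z
      simp only [mem_filter, mem_univ, true_and, and_iff_right_iff_imp]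
      exact fun hz => h.trans (sameCycle_of_retract hz ρ)
    · rw [if_neg h, Finset.card_eq_zero, Finset.filter_eq_empty_iff]
      rintro z - ⟨hz1, hz2⟩
      exact h (hfr.1 (hz1.trans (sameCycle_of_retract hz2 ρ).symm))
  have h3 : (univ.filter fun z => (θ * Perm.ofSubtype ρ).SameCycle (b : α) z ∧
      retract θ B t z = none).card ≤ Z := by
    refine Finset.card_le_card fun z => ?_
    simp only [mem_filter, mem_univ, true_and, retract_eq_none_iff]
    exact fun h => h.2
  have h4 : (univ.filter fun z => (θ * Perm.ofSubtype ρ).SameCycle (b : α) z).card =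
      cycleLen (θ * Perm.ofSubtype ρ) b := by
    unfold cycleLen; congr
  rw [h2, h4] at h1
  omega

/-- Averaging over permutations of `B`: the number of points in cycles of a given size range. -/
lemma sum_card_cycleLen_mem_le (θ : Perm α) (B : Finset α) (t : ℕ) (hB : B.Nonempty)
    {lo hi : ℕ} (hlh : lo ≤ hi) {η : ℝ} (hη : 0 < η) :
    ∑ ρ : Perm B, ((univ.filter fun z => cycleLen (θ * Perm.ofSubtype ρ) z ∈ Finset.Icc lo hi).card : ℝ) ≤
      (B.card.factorial : ℝ) * ((hi - lo) + 2 * η * Fintype.card α +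
        2 * (univ.filter fun z => ∀ i < t, (θ ^ i) z ∉ B).card +
          (Fintype.card α : ℝ) / B.card + t / η ^ 2) := by
  set r : B → ℕ := fun b => (univ.filter fun z => retract θ B t z = some b).card with hr
  set Z := (univ.filter fun z => ∀ i < t, (θ ^ i) z ∉ B).card with hZ
  set n := Fintype.card α with hn
  have hMpos : (0 : ℝ) < B.card := by exact_mod_cast hB.card_pos
  have hnpos : (0 : ℝ) < n := by
    obtain ⟨b, -⟩ := hB
    exact_mod_cast Fintype.card_pos_iff.2 ⟨b⟩
  have hsum : ∑ b, r b + Z = n := by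
    have := sum_card_retract θ B t fun _ => True
    simp only [true_and, retract_eq_none_iff] at this
    rw [hn, ← Finset.card_univ, ← Finset.filter_true (s := univ (α := α)), ← this]
  have hsum' : ∑ b, (r b : ℝ) = n - Z := by
    have : (∑ x, (r x : ℝ)) + Z = n := by exact_mod_cast hsum
    linarith
  have hlh' : (lo : ℝ) ≤ hi := by exact_mod_cast hlh
  let E : B → Perm B → Prop := fun b π => lo ≤ cycleWeight r b π + Z ∧ cycleWeight r b π ≤ hi
  have h1 : ∀ ρ : Perm B,
      ((univ.filter fun z => cycleLen (θ * Perm.ofSubtype ρ) z ∈ Finset.Icc lo hi).card : ℝ) ≤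
        Z + ∑ b, (r b : ℝ) * (if E b (firstReturn θ B * ρ) then 1 else 0) := by
    intro ρ
    have e := sum_card_retract θ B t fun z => cycleLen (θ * Perm.ofSubtype ρ) z ∈ Finset.Icc lo hi
    have e1 : (univ.filter fun z => cycleLen (θ * Perm.ofSubtype ρ) z ∈ Finset.Icc lo hi ∧
        retract θ B t z = none).card ≤ Z := by
      refine Finset.card_le_card fun z => ?_
      simp only [mem_filter, mem_univ, true_and, retract_eq_none_iff]
      exact fun h => h.2
    have e2 : ∀ b : B, (univ.filter fun z => cycleLen (θ * Perm.ofSubtype ρ) z ∈ Finset.Icc lo hi ∧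
        retract θ B t z = some b).card ≤ r b * (if E b (firstReturn θ B * ρ) then 1 else 0) := by
      intro b
      split_ifs with hE
      · rw [mul_one]
        refine Finset.card_le_card fun z => ?_
        simp only [mem_filter, mem_univ, true_and]
        exact fun h => h.2
      · rw [mul_zero, Nat.le_zero, Finset.card_eq_zero, Finset.filter_eq_empty_iff]
        rintro z - ⟨hz1, hz2⟩
        apply hE
        have hb := cycleLen_bounds θ B t ρ b
        rw [← cycleLen_eq_of_sameCycle (sameCycle_of_retract hz2 ρ), Finset.mem_Icc] at hz1
        exact ⟨hz1.1.trans hb.2, hb.1.trans hz1.2⟩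
    have e3 := Finset.sum_le_sum fun b (_ : b ∈ univ) => e2 b
    have e4 : (univ.filter fun z => cycleLen (θ * Perm.ofSubtype ρ) z ∈ Finset.Icc lo hi).card ≤
        Z + ∑ b, r b * (if E b (firstReturn θ B * ρ) then 1 else 0) := by omega
    exact_mod_cast e4
  have h2 : ∀ b, ∑ ρ : Perm B, (if E b (firstReturn θ B * ρ) then (1 : ℝ) else 0) =
      ((univ.filter fun π : Perm B => E b π).card : ℝ) := by
    intro b
    rw [Finset.card_filter]
    push_cast
    exact Equiv.sum_comp (Equiv.mulLeft (firstReturn θ B)) fun π => if E b π then (1 : ℝ) else 0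
  have h3 : ∑ ρ : Perm B,
      ((univ.filter fun z => cycleLen (θ * Perm.ofSubtype ρ) z ∈ Finset.Icc lo hi).card : ℝ) ≤
        (B.card.factorial : ℝ) * Z + ∑ b, (r b : ℝ) * (univ.filter fun π : Perm B => E b π).card := by
    refine (Finset.sum_le_sum fun ρ _ => h1 ρ).trans (le_of_eq ?_)
    rw [Finset.sum_add_distrib, Finset.sum_const, Finset.card_univ, Fintype.card_perm,
      Fintype.card_coe, nsmul_eq_mul, Finset.sum_comm]
    congr 1
    refine Finset.sum_congr rfl fun b _ => ?_
    rw [← Finset.mul_sum, h2]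
  refine h3.trans ?_
  have hZn : Z ≤ n := by omega
  have hX : 0 ≤ (hi - lo : ℝ) + 2 * η * n + Z := by
    have : 0 ≤ η * n := by positivity
    have : (0 : ℝ) ≤ Z := Nat.cast_nonneg _
    linarith
  have hF : (0 : ℝ) ≤ B.card.factorial := Nat.cast_nonneg _
  rcases hZn.lt_or_eq with hlt | heq
  · have hnZ : (0 : ℝ) < (n : ℝ) - Z := sub_pos.2 (by exact_mod_cast hlt)
    have h4 : ∑ b, (r b : ℝ) * (univ.filter fun π : Perm B => E b π).card ≤
        ∑ b, (r b : ℝ) * ((B.card.factorial : ℝ) * (t / (η ^ 2 * n) +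
        (hi - lo + 2 * η * n + Z) / ((n : ℝ) - Z) + 1 / B.card)) := by
      refine Finset.sum_le_sum fun b _ => mul_le_mul_of_nonneg_left ?_ (Nat.cast_nonneg _)
      have := card_cycleWeight_mem_le r b (card_retract_eq_some_le θ B t) hsum hlt hlh hη
      rwa [Fintype.card_coe] at this
    rw [← Finset.sum_mul, hsum'] at h4
    refine (add_le_add le_rfl h4).trans ?_
    have h5 : ((n : ℝ) - Z) * (t / (η ^ 2 * n) + (hi - lo + 2 * η * n + Z) / ((n : ℝ) - Z) +
        1 / B.card) ≤ t / η ^ 2 + (hi - lo + 2 * η * n + Z) + n / B.card := by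
      have e1 : ((n : ℝ) - Z) * (t / (η ^ 2 * n)) ≤ n * (t / (η ^ 2 * n)) := by
        have : (0 : ℝ) ≤ Z := Nat.cast_nonneg _
        gcongr; linarith
      have e2 : (n : ℝ) * (t / (η ^ 2 * n)) = t / η ^ 2 := by field_simp
      have e3 : ((n : ℝ) - Z) * ((hi - lo + 2 * η * n + Z) / ((n : ℝ) - Z)) =
          hi - lo + 2 * η * n + Z := by field_simp
      have e4 : ((n : ℝ) - Z) * (1 / B.card) ≤ n * (1 / B.card) := by
        have : (0 : ℝ) ≤ Z := Nat.cast_nonneg _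
        gcongr; linarith
      have e5 : (n : ℝ) * (1 / B.card) = n / B.card := by ring
      rw [mul_add, mul_add, e3]
      linarith
    nlinarith [mul_le_mul_of_nonneg_left h5 hF]
  · have hr0 : ∀ b, (r b : ℝ) = 0 := by
      intro b
      have : ∑ b, r b = 0 := by omega
      exact_mod_cast Finset.sum_eq_zero_iff.1 this b (Finset.mem_univ b)
    simp only [hr0, zero_mul, Finset.sum_const_zero, add_zero]
    refine mul_le_mul_of_nonneg_left ?_ hF
    have : 0 ≤ (n : ℝ) / B.card + t / η ^ 2 := by positivity
    linarith [(Nat.cast_nonneg Z : (0 : ℝ) ≤ Z)]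

end Retract

section Landing
variable {α : Type*} [DecidableEq α]

/-- Query `h` along the orbit `a ↦ φ (h a)`, with prescribed targets. -/
def landingTree : List (Perm α × Finset α) → α → QueryTree Unit α
  | [], _ => .leaf
  | s :: l, a => .node () a s.2 fun b => landingTree l (s.1 b)

/-- Query `h` along the orbit `a ↦ φ (h a)`, the targets being the answers closing the orbit. -/
def repeatTree : List (Perm α × Finset α) → Finset α → α → QueryTree Unit α
  | [], _, _ => .leaf
  | s :: l, H, a => .node () a ((insert a H).image s.1.symm) fun b => repeatTree l (insert a H) (s.1 b)

def orbitPoints (h : Perm α) : List (Perm α × Finset α) → α → List α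
  | [], _ => []
  | s :: l, a => a :: orbitPoints h l (s.1 (h a))

def landings (h : Perm α) : List (Perm α × Finset α) → α → ℕ
  | [], _ => 0
  | s :: l, a => (if h a ∈ s.2 then 1 else 0) + landings h l (s.1 (h a))

omit [DecidableEq α] in
lemma landingTree_fits (l : List (Perm α × Finset α)) (a : α) :
    (landingTree l a).Fits (l.map fun s => s.2.card) := by
  induction l generalizing a with
  | nil => rfl
  | cons s l ih => exact ⟨_, _, rfl, le_rfl, fun b => ih _⟩

lemma repeatTree_fits (l : List (Perm α × Finset α)) (H : Finset α) (a : α) {K : ℕ}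
    (hK : H.card + l.length ≤ K) : (repeatTree l H a).Fits (List.replicate l.length K) := by
  induction l generalizing a H with
  | nil => rfl
  | cons s l ih =>
    rw [List.length_cons] at hK
    have h1 : (insert a H).card ≤ H.card + 1 := Finset.card_insert_le _ _
    exact ⟨_, _, rfl, Finset.card_image_le.trans (by omega), fun b => ih _ _ (by omega)⟩

lemma landings_le_hits (l : List (Perm α × Finset α)) (a : α) (ω : Unit → Perm α)
    (Q : Finset (Unit × α)) (hnd : (orbitPoints (ω ()) l a).Nodup)
    (hQ : ∀ x ∈ orbitPoints (ω ()) l a, ((), x) ∉ Q) :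
    landings (ω ()) l a ≤ (landingTree l a).hits Q ω := by
  induction l generalizing a Q with
  | nil => exact le_rfl
  | cons s l ih =>
    simp only [orbitPoints, List.nodup_cons, List.mem_cons, forall_eq_or_imp] at hnd hQ
    simp only [landings, landingTree, QueryTree.hits]
    refine add_le_add (by simp [hQ.1]) (ih _ _ hnd.2 fun x hx => ?_)
    rw [Finset.mem_insert, not_or]
    refine ⟨?_, hQ.2 x hx⟩
    rintro h
    have : x = a := congrArg Prod.snd h
    exact hnd.1 (this ▸ hx)

lemma one_le_hits_repeatTree (l : List (Perm α × Finset α)) (H : Finset α) (a : α)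
    (ω : Unit → Perm α) (Q : Finset (Unit × α)) (hQ : ∀ x, ((), x) ∈ Q ↔ x ∈ H) (ha : a ∉ H)
    (hnd : ¬ ((orbitPoints (ω ()) l a).Nodup ∧ ∀ x ∈ orbitPoints (ω ()) l a, x ∉ H)) :
    1 ≤ (repeatTree l H a).hits Q ω := by
  induction l generalizing a Q H with
  | nil => simp [orbitPoints] at hnd
  | cons s l ih =>
    simp only [repeatTree, QueryTree.hits]
    by_cases hm : s.1 (ω () a) ∈ insert a H
    · have : ω () a ∈ (insert a H).image s.1.symm :=
        Finset.mem_image.2 ⟨_, hm, s.1.symm_apply_apply _⟩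
      rw [if_pos ⟨mt (hQ a).1 ha, this⟩]
      omega
    · refine le_trans (ih (insert a H) _ (insert ((), a) Q) ?_ hm ?_) (Nat.le_add_left _ _)
      · intro x
        simp [hQ]
      · rintro ⟨h1, h2⟩
        apply hnd
        simp only [orbitPoints, List.nodup_cons, List.mem_cons, forall_eq_or_imp]
        exact ⟨⟨fun h => h2 a h (Finset.mem_insert_self _ _), h1⟩, ha,
          fun x hx hxH => h2 x hx (Finset.mem_insert_of_mem hxH)⟩

/-- The steps tracing the orbit of `h ^ k * w`, watching for `C` once per application. -/
def orbitSteps (w : Perm α) (C : Finset α) (k : ℕ) : ℕ → List (Perm α × Finset α)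
  | 0 => []
  | T + 1 => List.replicate (k - 1) (1, ∅) ++ (w, C) :: orbitSteps w C k T

omit [DecidableEq α] in
lemma length_orbitSteps (w : Perm α) (C : Finset α) {k : ℕ} (hk : 1 ≤ k) (T : ℕ) :
    (orbitSteps w C k T).length = k * T := by
  induction T with
  | zero => rfl
  | succ T ih => simp [orbitSteps, ih]; rw [mul_add]; omega

omit [DecidableEq α] in
lemma listEsymm_orbitSteps (w : Perm α) (C : Finset α) (k T c : ℕ) :
    listEsymm c ((orbitSteps w C k T).map fun s => s.2.card) ≤ T.choose c * C.card ^ c := by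
  induction T generalizing c with
  | zero => cases c <;> simp [orbitSteps, listEsymm]
  | succ T ih =>
    simp only [orbitSteps, List.map_append, List.map_replicate, Finset.card_empty, List.map_cons]
    rw [listEsymm_append_zero]
    cases c with
    | zero => simp [listEsymm]
    | succ c =>
      simp only [listEsymm]
      have h1 := ih c
      have h2 := ih (c + 1)
      rw [Nat.choose_succ_succ, pow_succ] at *
      nlinarith [Nat.mul_le_mul_left C.card h1]

lemma landings_replicate (h : Perm α) (k : ℕ) (l : List (Perm α × Finset α)) (a : α) :
    landings h (List.replicate k (1, ∅) ++ l) a = landings h l ((h ^ k) a) := by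
  induction k generalizing a with
  | zero => simp
  | succ k ih => simp [List.replicate_succ, landings, ih, pow_succ]

lemma landings_orbitSteps (w h : Perm α) (C : Finset α) {k : ℕ} (hk : 1 ≤ k) (T : ℕ) (z : α)
    (hC : ∀ i, 1 ≤ i → i ≤ T → ((h ^ k * w) ^ i) z ∈ C) :
    T ≤ landings h (orbitSteps w C k T) (w z) := by
  induction T generalizing z with
  | zero => simp
  | succ T ih =>
    simp only [orbitSteps]
    rw [landings_replicate]
    simp only [landings]
    have e : h ((h ^ (k - 1)) (w z)) = (h ^ k * w) z := by
      rw [← Perm.mul_apply, ← pow_succ', Nat.sub_add_cancel hk]; rfl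
    have h1 := hC 1 le_rfl (by omega)
    rw [pow_one] at h1
    rw [e, if_pos h1, add_comm]
    refine Nat.add_le_add_left (ih ((h ^ k * w) z) fun i hi hiT => ?_) 1
    have := hC (i + 1) (by omega) (by omega)
    rwa [pow_succ, Perm.mul_apply] at this

variable [Fintype α]

lemma card_filter_unit (P : Perm α → Prop) [DecidablePred P] :
    (univ.filter fun ω : Unit → Perm α => P (ω ())).card = (univ.filter P).card := by
  refine Finset.card_bij (fun ω _ => ω ()) ?_ ?_ ?_
  · intro ω hω; simpa using hω
  · intro ω _ ω' _ h; funext u; exact h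
  · intro h hh
    exact ⟨fun _ => h, by simpa using hh, rfl⟩

/-- A random `h ^ k * w` rarely keeps the orbit of a point inside a fixed set. -/
lemma card_orbit_mem_le (w : Perm α) (C : Finset α) (z : α) {k T : ℕ} (hk : 1 ≤ k)
    (hK : k * T < Fintype.card α) :
    ((univ.filter fun h : Perm α => ∀ i < T + 1, ((h ^ k * w) ^ i) z ∈ C).card : ℝ) ≤
      ((Fintype.card α).factorial : ℝ) * (((C.card : ℝ) / ((Fintype.card α : ℝ) - k * T)) ^ T +
        ((k : ℝ) * T) ^ 2 / ((Fintype.card α : ℝ) - k * T)) := by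
  set n := Fintype.card α with hn
  set l := orbitSteps w C k T with hl
  have hlen : l.length = k * T := length_orbitSteps w C hk T
  have hpos : (0 : ℝ) < (n : ℝ) - k * T := sub_pos.2 (by exact_mod_cast hK)
  have hcast : (((n - k * T : ℕ) : ℝ)) = (n : ℝ) - k * T := by
    rw [Nat.cast_sub hK.le]; push_cast; ring
  have hF : Fintype.card (Unit → Perm α) = n.factorial := by
    simp [Fintype.card_perm, hn]
  have h1 := card_hits_univ_le (landingTree l (w z)) _ (landingTree_fits l (w z)) T
  have h2 := card_hits_univ_le (repeatTree l ∅ (w z)) _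
    (repeatTree_fits l ∅ (w z) (K := k * T) (by simp [hlen])) 1
  rw [List.length_map, hlen, hF] at h1
  rw [List.length_replicate, hlen, hF, pow_one] at h2
  have h1' := h1.trans (Nat.mul_le_mul_right _ (listEsymm_orbitSteps w C k T T))
  have h2' := h2.trans (Nat.mul_le_mul_right _ (listEsymm_le 1 _
    (M := k * T) (by intro v hv; exact (List.eq_of_mem_replicate hv).le)))
  rw [Nat.choose_self, one_mul] at h1'
  rw [List.length_replicate, pow_one] at h2'
  have hsub : (univ.filter fun ω : Unit → Perm α => ∀ i < T + 1, ((ω () ^ k * w) ^ i) z ∈ C) ⊆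
      (univ.filter fun ω => T ≤ (landingTree l (w z)).hits ∅ ω) ∪
        univ.filter fun ω => 1 ≤ (repeatTree l ∅ (w z)).hits ∅ ω := by
    intro ω hω
    simp only [mem_filter, mem_univ, true_and, mem_union] at hω ⊢
    by_cases hnd : (orbitPoints (ω ()) l (w z)).Nodup
    · left
      refine le_trans ?_ (landings_le_hits l (w z) ω ∅ hnd (by simp))
      exact landings_orbitSteps w (ω ()) C hk T z fun i _ hi => hω i (by omega)
    · right
      exact one_le_hits_repeatTree l ∅ (w z) ω ∅ (by simp) (by simp) fun h => hnd h.1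
  have h3 := (Finset.card_le_card hsub).trans (Finset.card_union_le _ _)
  rw [card_filter_unit fun h : Perm α => ∀ i < T + 1, ((h ^ k * w) ^ i) z ∈ C] at h3
  set A := (univ.filter fun ω => T ≤ (landingTree l (w z)).hits ∅ ω).card
  set A' := (univ.filter fun ω => 1 ≤ (repeatTree l ∅ (w z)).hits ∅ ω).card
  have hA : (A : ℝ) ≤ n.factorial * ((C.card : ℝ) / ((n : ℝ) - k * T)) ^ T := by
    have : (A : ℝ) * ((n - k * T : ℕ) : ℝ) ^ T ≤ (C.card : ℝ) ^ T * n.factorial := by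
      exact_mod_cast h1'
    rw [hcast, ← le_div_iff₀ (by positivity)] at this
    rw [div_pow]
    refine this.trans (le_of_eq ?_)
    ring
  have hA' : (A' : ℝ) ≤ n.factorial * (((k : ℝ) * T) ^ 2 / ((n : ℝ) - k * T)) := by
    have : (A' : ℝ) * ((n - k * T : ℕ) : ℝ) ≤ (k * T * (k * T) : ℕ) * n.factorial := by
      exact_mod_cast h2'
    rw [hcast, ← le_div_iff₀ hpos] at this
    refine this.trans (le_of_eq ?_)
    push_cast
    ring
  rw [mul_add]
  refine le_trans ?_ (add_le_add hA hA')
  exact_mod_cast h3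

/-- The expected number of points whose orbit stays inside `C`. -/
lemma sum_card_orbit_mem_le (w : Perm α) (C : Finset α) {k T : ℕ} (hk : 1 ≤ k)
    (hK : k * T < Fintype.card α) :
    ∑ h : Perm α, ((univ.filter fun z => ∀ i < T + 1, ((h ^ k * w) ^ i) z ∈ C).card : ℝ) ≤
      ((Fintype.card α).factorial : ℝ) * (Fintype.card α *
        (((C.card : ℝ) / ((Fintype.card α : ℝ) - k * T)) ^ T +
        ((k : ℝ) * T) ^ 2 / ((Fintype.card α : ℝ) - k * T))) := by
  have h1 : ∑ h : Perm α, ((univ.filter fun z => ∀ i < T + 1, ((h ^ k * w) ^ i) z ∈ C).card : ℝ) =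
      ∑ z, ((univ.filter fun h : Perm α => ∀ i < T + 1, ((h ^ k * w) ^ i) z ∈ C).card : ℝ) := by
    simp only [Finset.card_filter]
    push_cast
    exact Finset.sum_comm
  rw [h1]
  refine (Finset.sum_le_sum fun z _ => card_orbit_mem_le w C z hk hK).trans (le_of_eq ?_)
  rw [Finset.sum_const, Finset.card_univ, nsmul_eq_mul]
  ring

end Landing

section Resample
variable {α : Type*} [Fintype α] [DecidableEq α]

/-- The points outside the cycle of `w` through `x`. -/
noncomputable def offCycle (w : Perm α) (x : α) : Finset α := univ.filter fun z => ¬ w.SameCycle x z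

lemma mem_offCycle {w : Perm α} {x z : α} : z ∈ offCycle w x ↔ ¬ w.SameCycle x z := by
  simp [offCycle]

lemma card_offCycle_add (w : Perm α) (x : α) : (offCycle w x).card + cycleLen w x = Fintype.card α := by
  have := Finset.card_filter_add_card_filter_not (s := univ) fun z => w.SameCycle x z
  rw [Finset.card_univ] at this
  rw [← this, add_comm]
  unfold offCycle cycleLen
  congr

lemma sameCycle_mul_ofSubtype {w : Perm α} {x : α} {B : Finset α} (hB : offCycle w x = B)
    (ρ : Perm B) (z : α) : (w * Perm.ofSubtype ρ).SameCycle x z ↔ w.SameCycle x z := by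
  have key : ∀ i : ℕ, ((w * Perm.ofSubtype ρ) ^ i) x = (w ^ i) x := by
    intro i
    induction i with
    | zero => rfl
    | succ i ih =>
      rw [pow_succ', Perm.mul_apply, ih, pow_succ' w, Perm.mul_apply w]
      refine mul_ofSubtype_apply_of_notMem w ρ ?_
      rw [← hB, mem_offCycle, not_not]
      exact ⟨i, rfl⟩
  constructor
  · intro h
    obtain ⟨i, hi⟩ := h.exists_nat_pow_eq
    exact ⟨i, by rw [zpow_natCast, ← key, hi]⟩
  · intro h
    obtain ⟨i, hi⟩ := h.exists_nat_pow_eq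
    exact ⟨i, by rw [zpow_natCast, key, hi]⟩

lemma offCycle_mul_ofSubtype {w : Perm α} {x : α} {B : Finset α} (hB : offCycle w x = B)
    (ρ : Perm B) : offCycle (w * Perm.ofSubtype ρ) x = B := by
  subst hB
  ext z
  rw [mem_offCycle, mem_offCycle, sameCycle_mul_ofSubtype rfl]

lemma cycleLen_mul_ofSubtype {w : Perm α} {x : α} {B : Finset α} (hB : offCycle w x = B)
    (ρ : Perm B) : cycleLen (w * Perm.ofSubtype ρ) x = cycleLen w x := by
  have h1 := card_offCycle_add (w * Perm.ofSubtype ρ) x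
  have h2 := card_offCycle_add w x
  rw [offCycle_mul_ofSubtype hB] at h1
  rw [hB] at h2
  omega

lemma sum_resample (F : Perm α → ℝ) (x : α) (B : Finset α) :
    ∑ w ∈ univ.filter (fun w => offCycle w x = B), ∑ ρ : Perm B, F (w * Perm.ofSubtype ρ) =
      (B.card.factorial : ℝ) * ∑ w ∈ univ.filter (fun w => offCycle w x = B), F w := by
  rw [Finset.sum_comm]
  have : ∀ ρ : Perm B, ∑ w ∈ univ.filter (fun w => offCycle w x = B), F (w * Perm.ofSubtype ρ) =
      ∑ w ∈ univ.filter (fun w => offCycle w x = B), F w := by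
    intro ρ
    refine Finset.sum_bij' (fun w _ => w * Perm.ofSubtype ρ) (fun w _ => w * Perm.ofSubtype ρ⁻¹)
      ?_ ?_ ?_ ?_ ?_
    · intro w hw
      simp only [mem_filter, mem_univ, true_and] at hw ⊢
      exact offCycle_mul_ofSubtype hw ρ
    · intro w hw
      simp only [mem_filter, mem_univ, true_and] at hw ⊢
      exact offCycle_mul_ofSubtype hw ρ⁻¹
    · intro w _; rw [map_inv, mul_inv_cancel_right]
    · intro w _; rw [map_inv, inv_mul_cancel_right]
    · intro w _; rfl
  rw [Finset.sum_congr rfl fun ρ _ => this ρ, Finset.sum_const, Finset.card_univ, Fintype.card_perm,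
    Fintype.card_coe, nsmul_eq_mul]

/-- Resampling a permutation outside the cycle of `x`. -/
lemma sum_le_of_resample (F G : Perm α → ℝ) (x : α) (I : Finset ℕ)
    (h : ∀ w, cycleLen w x ∈ I → ∀ B, offCycle w x = B →
      ∑ ρ : Perm B, F (w * Perm.ofSubtype ρ) ≤ (B.card.factorial : ℝ) * G w) :
    ∑ w ∈ univ.filter (fun w => cycleLen w x ∈ I), F w ≤
      ∑ w ∈ univ.filter (fun w => cycleLen w x ∈ I), G w := by
  rw [← Finset.sum_fiberwise _ (fun w => offCycle w x) F,
    ← Finset.sum_fiberwise _ (fun w => offCycle w x) G]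
  refine Finset.sum_le_sum fun B _ => ?_
  by_cases hI : Fintype.card α - B.card ∈ I
  · have e : (univ.filter fun w : Perm α => cycleLen w x ∈ I).filter (fun w => offCycle w x = B) =
        univ.filter fun w => offCycle w x = B := by
      ext w
      simp only [mem_filter, mem_univ, true_and, and_iff_right_iff_imp]
      intro hw
      have := card_offCycle_add w x
      rw [hw] at this
      rwa [show cycleLen w x = Fintype.card α - B.card by omega]
    rw [e]
    have hF : (0 : ℝ) < B.card.factorial := by exact_mod_cast Nat.factorial_pos _
    refine le_of_mul_le_mul_left ?_ hF
    rw [← sum_resample, Finset.mul_sum]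
    refine Finset.sum_le_sum fun w hw => ?_
    rw [← e] at hw
    simp only [mem_filter, mem_univ, true_and] at hw
    exact h w hw.1 B hw.2
  · have e : (univ.filter fun w : Perm α => cycleLen w x ∈ I).filter (fun w => offCycle w x = B) = ∅ := by
      ext w
      simp only [mem_filter, mem_univ, true_and, notMem_empty, iff_false, not_and]
      intro hw1 hw
      have := card_offCycle_add w x
      rw [hw] at this
      rw [show Fintype.card α - B.card = cycleLen w x by omega] at hI
      exact hI hw1
    rw [e]; simp

end Resample

section Order
variable {α : Type*} [Fintype α]

lemma cycleLen_eq_minimalPeriod (π : Perm α) (y : α) : cycleLen π y = Function.minimalPeriod π y := by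
  have h := MulAction.minimalPeriod_eq_card (a := π) (b := y)
  have h' : Function.minimalPeriod (π • · : α → α) y = Function.minimalPeriod π y := rfl
  rw [← h', h]
  unfold cycleLen
  symm
  rw [← Set.toFinset_card]
  congr 1
  ext z
  simp only [Set.mem_toFinset, mem_filter, mem_univ, true_and, MulAction.mem_orbit_iff]
  constructor
  · rintro ⟨⟨_, ⟨i, rfl⟩⟩, h⟩
    exact ⟨i, h⟩
  · rintro ⟨i, h⟩
    exact ⟨⟨π ^ i, i, rfl⟩, h⟩

lemma cycleLen_dvd {π : Perm α} {y : α} {l : ℕ} (h : (π ^ l) y = y) : cycleLen π y ∣ l := by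
  rw [cycleLen_eq_minimalPeriod]
  refine Function.IsPeriodicPt.minimalPeriod_dvd ?_
  rwa [Function.IsPeriodicPt, Function.IsFixedPt, ← Perm.coe_pow]

lemma pow_cycleLen_apply (π : Perm α) {y z : α} (h : π.SameCycle y z) : (π ^ cycleLen π y) z = z := by
  rw [cycleLen_eq_of_sameCycle h, cycleLen_eq_minimalPeriod, Perm.coe_pow]
  exact Function.iterate_minimalPeriod

lemma card_divisors_le_sqrt (l : ℕ) : l.divisors.card ≤ 2 * (l.sqrt + 1) := by
  have : l.divisors ⊆ Finset.range (l.sqrt + 1) ∪ (Finset.range (l.sqrt + 1)).image fun k => l / k := by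
    intro d hd
    rw [Nat.mem_divisors] at hd
    obtain ⟨⟨e, rfl⟩, h0⟩ := hd
    rw [Finset.mem_union, Finset.mem_range, Finset.mem_image]
    by_cases h : d ≤ (d * e).sqrt
    · left; omega
    · right
      have hd : 0 < d := Nat.pos_of_ne_zero (by rintro rfl; simp at h0)
      have he : 0 < e := Nat.pos_of_ne_zero (by rintro rfl; simp at h0)
      refine ⟨e, Finset.mem_range.2 (Nat.lt_succ_of_le ?_), Nat.mul_div_cancel _ he⟩
      rw [Nat.le_sqrt]
      have : d * e < d * d := Nat.sqrt_lt.1 (not_le.1 h)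
      have : e < d := Nat.lt_of_mul_lt_mul_left this
      nlinarith
  refine (Finset.card_le_card this).trans ((Finset.card_union_le _ _).trans ?_)
  have := Finset.card_image_le (s := Finset.range (l.sqrt + 1)) (f := fun k => l / k)
  rw [Finset.card_range] at *
  omega

variable [DecidableEq α]

lemma card_pow_eq_one_le {w : Perm α} {x : α} {B : Finset α} (hB : offCycle w x = B)
    (hne : B.Nonempty) {l : ℕ} (hl : l ≠ 0) :
    (univ.filter fun ρ : Perm B => (w * Perm.ofSubtype ρ) ^ l = 1).card ≤
      2 * (l.sqrt + 1) * (B.card - 1).factorial := by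
  have hwB : ∀ z, w z ∈ B ↔ z ∈ B := by
    intro z
    rw [← hB, mem_offCycle, mem_offCycle, Perm.sameCycle_apply_right]
  obtain ⟨y, hy⟩ := hne
  let R : Perm B := w.subtypePerm hwB
  have hpow : ∀ (ρ : Perm B) (i : ℕ) (b : B),
      ((w * Perm.ofSubtype ρ) ^ i) (b : α) = ((R * ρ) ^ i) b := by
    intro ρ i b
    induction i with
    | zero => rfl
    | succ i ih =>
      rw [pow_succ', Perm.mul_apply, ih, pow_succ' (R * ρ), Perm.mul_apply (R * ρ)]
      simp [R, Perm.ofSubtype_apply_coe]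
  have h1 : (univ.filter fun ρ : Perm B => (w * Perm.ofSubtype ρ) ^ l = 1).card ≤
      (univ.filter fun π : Perm B => cycleLen π ⟨y, hy⟩ ∈ l.divisors).card := by
    refine Finset.card_le_card_of_injOn (fun ρ => R * ρ) ?_ (fun _ _ _ _ h => mul_left_cancel h)
    intro ρ hρ
    have hρ' : (w * Perm.ofSubtype ρ) ^ l = 1 := by simpa using hρ
    have := hpow ρ l ⟨y, hy⟩
    rw [hρ'] at this
    simp only [coe_filter, mem_univ, true_and]
    exact Nat.mem_divisors.2 ⟨cycleLen_dvd (Subtype.ext this.symm), hl⟩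
  have h2 := card_cycleLen_mem_le (⟨y, hy⟩ : B) l.divisors
  rw [Fintype.card_coe] at h2
  exact h1.trans (h2.trans (Nat.mul_le_mul_right _ (card_divisors_le_sqrt l)))

end Order

section LongCycles
variable {α : Type*} [Fintype α] [DecidableEq α]

/-- The number of points on cycles with length in `I`. -/
noncomputable def longCount (I : Finset ℕ) (w : Perm α) : ℕ :=
  (univ.filter fun z => cycleLen w z ∈ I).card

/-- The number of points `z` on cycles with length `l ∈ I` such that `w ^ l = 1`. -/
noncomputable def trivCount (I : Finset ℕ) (w : Perm α) : ℕ :=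
  (univ.filter fun z => cycleLen w z ∈ I ∧ w ^ cycleLen w z = 1).card

/-- The number of points `z` on cycles with length `l ∈ I` such that `w ^ l ≠ 1`. -/
noncomputable def goodCount (I : Finset ℕ) (w : Perm α) : ℕ :=
  (univ.filter fun z => cycleLen w z ∈ I ∧ w ^ cycleLen w z ≠ 1).card

lemma goodCount_add_trivCount (I : Finset ℕ) (w : Perm α) :
    goodCount I w + trivCount I w = longCount I w := by
  unfold goodCount trivCount longCount
  rw [← Finset.card_filter_add_card_filter_not (s := univ.filter fun z => cycleLen w z ∈ I)
    fun z => w ^ cycleLen w z = 1, Finset.filter_filter, Finset.filter_filter, add_comm]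

omit [DecidableEq α] in
lemma longCount_le (I : Finset ℕ) (w : Perm α) : longCount I w ≤ Fintype.card α :=
  Finset.card_le_univ _

omit [DecidableEq α] in
lemma longCount_mul_comm (I : Finset ℕ) (v w : Perm α) : longCount I (v * w) = longCount I (w * v) := by
  unfold longCount
  refine Finset.card_bij (fun z _ => w z) ?_ (fun _ _ _ _ h => w.injective h) ?_
  · intro z hz
    simp only [mem_filter, mem_univ, true_and] at hz ⊢
    have := cycleLen_congr w (v * w) z
    rw [← this] at hz
    convert hz using 2
    ext y; simp
  · intro y hy
    simp only [mem_filter, mem_univ, true_and] at hy ⊢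
    refine ⟨w.symm y, ?_, by simp⟩
    have := cycleLen_congr w (v * w) (w.symm y)
    rw [← this]
    convert hy using 2
    · ext y; simp
    · simp

lemma sum_longCount_mul (I : Finset ℕ) (F : Perm α → ℝ) :
    ∑ w : Perm α, (longCount I w : ℝ) * F w =
      ∑ x : α, ∑ w ∈ univ.filter (fun w : Perm α => cycleLen w x ∈ I), F w := by
  have h : ∀ x : α, ∑ w ∈ univ.filter (fun w : Perm α => cycleLen w x ∈ I), F w =
      ∑ w : Perm α, if cycleLen w x ∈ I then F w else 0 := fun x => Finset.sum_filter _ _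
  rw [Finset.sum_congr rfl fun x _ => h x, Finset.sum_comm]
  refine Finset.sum_congr rfl fun w _ => ?_
  rw [← Finset.sum_filter, Finset.sum_const, nsmul_eq_mul]
  rfl

lemma sum_filter_cycleLen_const {I : Finset ℕ} (hI : I ⊆ Finset.Icc 1 (Fintype.card α)) (c : ℝ) :
    ∑ x : α, ∑ _w ∈ univ.filter (fun w : Perm α => cycleLen w x ∈ I), c =
      ((Fintype.card α).factorial : ℝ) * (I.card * c) := by
  have h : ∀ x : α, ∑ _w ∈ univ.filter (fun w : Perm α => cycleLen w x ∈ I), c =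
      ((I.card * (Fintype.card α - 1).factorial : ℕ) : ℝ) * c := by
    intro x
    rw [Finset.sum_const, card_cycleLen_mem x I hI, nsmul_eq_mul]
  rw [Finset.sum_congr rfl fun x _ => h x, Finset.sum_const, Finset.card_univ, nsmul_eq_mul]
  rcases Nat.eq_zero_or_pos (Fintype.card α) with h0 | h0
  · have : I = ∅ := by
      rw [h0] at hI
      exact Finset.subset_empty.1 (by simpa using hI)
    simp [this]
  · rw [← Nat.mul_factorial_pred h0.ne']
    push_cast
    ring

lemma sum_longCount {I : Finset ℕ} (hI : I ⊆ Finset.Icc 1 (Fintype.card α)) :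
    ∑ w : Perm α, (longCount I w : ℝ) = ((Fintype.card α).factorial : ℝ) * I.card := by
  have h1 := sum_longCount_mul (α := α) I fun _ => 1
  rw [sum_filter_cycleLen_const hI] at h1
  simpa using h1

lemma offCycle_card_pos {w : Perm α} {x : α} {B : Finset α} (hB : offCycle w x = B) {lo hi : ℕ}
    (hw : cycleLen w x ∈ Finset.Icc lo hi) : Fintype.card α - hi ≤ B.card := by
  have := card_offCycle_add w x
  rw [hB] at this
  rw [Finset.mem_Icc] at hw
  omega

lemma sum_trivCount_le {lo hi : ℕ} (hlo : 1 ≤ lo) (hhi : hi < Fintype.card α) :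
    ∑ w : Perm α, (trivCount (Finset.Icc lo hi) w : ℝ) ≤ ((Fintype.card α).factorial : ℝ) *
      ((Finset.Icc lo hi).card * (2 * (((Fintype.card α).sqrt : ℝ) + 1) /
        (Fintype.card α - hi : ℕ))) := by
  have hI : Finset.Icc lo hi ⊆ Finset.Icc 1 (Fintype.card α) := Finset.Icc_subset_Icc hlo hhi.le
  rw [← sum_filter_cycleLen_const hI]
  have h1 : ∑ w : Perm α, (trivCount (Finset.Icc lo hi) w : ℝ) =
      ∑ x : α, ∑ w ∈ univ.filter (fun w : Perm α => cycleLen w x ∈ Finset.Icc lo hi),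
        if w ^ cycleLen w x = 1 then (1 : ℝ) else 0 := by
    have h : ∀ x : α, ∑ w ∈ univ.filter (fun w : Perm α => cycleLen w x ∈ Finset.Icc lo hi),
        (if w ^ cycleLen w x = 1 then (1 : ℝ) else 0) =
        ∑ w : Perm α, if cycleLen w x ∈ Finset.Icc lo hi then
          (if w ^ cycleLen w x = 1 then (1 : ℝ) else 0) else 0 := fun x => Finset.sum_filter _ _
    rw [Finset.sum_congr rfl fun x _ => h x, Finset.sum_comm]
    refine Finset.sum_congr rfl fun w _ => ?_
    unfold trivCount
    rw [Finset.natCast_card_filter]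
    refine Finset.sum_congr rfl fun x _ => ?_
    by_cases h1 : cycleLen w x ∈ Finset.Icc lo hi <;> by_cases h2 : w ^ cycleLen w x = 1 <;> simp [h1, h2]
  rw [h1]
  refine Finset.sum_le_sum fun x _ => ?_
  refine sum_le_of_resample (fun w => if w ^ cycleLen w x = 1 then (1 : ℝ) else 0)
    (fun _ => 2 * (((Fintype.card α).sqrt : ℝ) + 1) / (Fintype.card α - hi : ℕ)) x _ ?_
  intro w hw B hB
  have hB1 := offCycle_card_pos hB hw
  have hBpos : 0 < B.card := by omega
  have h2 := card_pow_eq_one_le hB (Finset.card_pos.1 hBpos) (Nat.pos_iff_ne_zero.1 (cycleLen_pos w x))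
  have h3 : ∑ ρ : Perm B, (if (w * Perm.ofSubtype ρ) ^ cycleLen (w * Perm.ofSubtype ρ) x = 1
      then (1 : ℝ) else 0) =
      ((univ.filter fun ρ : Perm B => (w * Perm.ofSubtype ρ) ^ cycleLen w x = 1).card : ℝ) := by
    rw [Finset.natCast_card_filter]
    refine Finset.sum_congr rfl fun ρ _ => ?_
    rw [cycleLen_mul_ofSubtype hB]
  rw [h3]
  have h4 : (cycleLen w x).sqrt ≤ (Fintype.card α).sqrt := Nat.sqrt_le_sqrt (cycleLen_le w x)
  have h5 : ((univ.filter fun ρ : Perm B => (w * Perm.ofSubtype ρ) ^ cycleLen w x = 1).card : ℝ) ≤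
      2 * (((Fintype.card α).sqrt : ℝ) + 1) * (B.card - 1).factorial := by
    have : (univ.filter fun ρ : Perm B => (w * Perm.ofSubtype ρ) ^ cycleLen w x = 1).card ≤
      2 * ((Fintype.card α).sqrt + 1) * (B.card - 1).factorial :=
      h2.trans (Nat.mul_le_mul_right _ (by omega))
    exact_mod_cast this
  refine h5.trans ?_
  rw [← Nat.mul_factorial_pred hBpos.ne']
  have h6 : (0 : ℝ) < (Fintype.card α - hi : ℕ) := by exact_mod_cast (by omega)
  have h7 : ((Fintype.card α - hi : ℕ) : ℝ) ≤ B.card := by exact_mod_cast hB1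
  rw [Nat.cast_mul]
  rw [← mul_div_assoc, le_div_iff₀ h6]
  have h8 : (0 : ℝ) ≤ 2 * (((Fintype.card α).sqrt : ℝ) + 1) * (B.card - 1).factorial := by positivity
  nlinarith

/-- The error term in the correlation of two long cycle counts. -/
noncomputable def corrError (n m hi k T : ℕ) (η : ℝ) : ℝ :=
  2 * η * n + 2 * (n * (((hi : ℝ) / ((n : ℝ) - k * T)) ^ T + ((k : ℝ) * T) ^ 2 / ((n : ℝ) - k * T))) +
    (n : ℝ) / m + (T + 1) / η ^ 2

lemma sum_longCount_mul_pow_le {lo hi k T : ℕ} (hlo : 1 ≤ lo) (hlh : lo ≤ hi)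
    (hhi : hi < Fintype.card α) (hk : 1 ≤ k) (hK : k * T < Fintype.card α) {η : ℝ} (hη : 0 < η) :
    ∑ h : Perm α, ∑ w : Perm α,
        (longCount (Finset.Icc lo hi) w : ℝ) * longCount (Finset.Icc lo hi) (h ^ k * w) ≤
      ((Fintype.card α).factorial : ℝ) ^ 2 * ((Finset.Icc lo hi).card * ((Finset.Icc lo hi).card +
        corrError (Fintype.card α) (Fintype.card α - hi) hi k T η)) := by
  set n := Fintype.card α with hn
  set I := Finset.Icc lo hi with hIdef
  have hI : I ⊆ Finset.Icc 1 n := Finset.Icc_subset_Icc hlo hhi.le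
  have hIc : ((hi : ℝ) - lo) ≤ I.card := by
    rw [hIdef, Nat.card_Icc]
    have : hi ≤ (hi + 1 - lo) + lo := by omega
    have : (hi : ℝ) ≤ (hi + 1 - lo : ℕ) + (lo : ℝ) := by exact_mod_cast this
    linarith
  have hnk : (0 : ℝ) < (n : ℝ) - k * T := sub_pos.2 (by exact_mod_cast hK)
  have hm : (0 : ℝ) < (n - hi : ℕ) := by exact_mod_cast (by omega)
  have h1 : ∑ h : Perm α, ∑ w : Perm α, (longCount I w : ℝ) * longCount I (h ^ k * w) =
      ∑ x : α, ∑ w ∈ univ.filter (fun w : Perm α => cycleLen w x ∈ I),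
        ∑ h : Perm α, (longCount I (h ^ k * w) : ℝ) := by
    rw [Finset.sum_comm, ← sum_longCount_mul]
    refine Finset.sum_congr rfl fun w _ => ?_
    rw [Finset.mul_sum]
  rw [h1]
  have h2 : ((n.factorial : ℝ)) ^ 2 * (I.card * (I.card + corrError n (n - hi) hi k T η)) =
      ∑ x : α, ∑ w ∈ univ.filter (fun w : Perm α => cycleLen w x ∈ I),
        (n.factorial : ℝ) * (I.card + corrError n (n - hi) hi k T η) := by
    rw [sum_filter_cycleLen_const hI]
    ring
  rw [h2]
  refine Finset.sum_le_sum fun x _ => ?_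
  refine sum_le_of_resample (fun w => ∑ h : Perm α, (longCount I (h ^ k * w) : ℝ))
    (fun _ => (n.factorial : ℝ) * (I.card + corrError n (n - hi) hi k T η)) x I ?_
  intro w hw B hB
  have hB1 := offCycle_card_pos hB hw
  have hBpos : 0 < B.card := by omega
  have hB2 := card_offCycle_add w x
  rw [hB] at hB2
  rw [Finset.sum_comm]
  have h3 : ∀ h : Perm α, ∑ ρ : Perm B, (longCount I (h ^ k * (w * Perm.ofSubtype ρ)) : ℝ) ≤
      (B.card.factorial : ℝ) * ((hi - lo) + 2 * η * n +
        2 * (univ.filter fun z => ∀ i < T + 1, ((h ^ k * w) ^ i) z ∉ B).card + (n : ℝ) / B.card +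
          (T + 1 : ℕ) / η ^ 2) := by
    intro h
    have := sum_card_cycleLen_mem_le (h ^ k * w) B (T + 1) (Finset.card_pos.1 hBpos) hlh hη
    simpa only [mul_assoc, longCount] using this
  refine (Finset.sum_le_sum fun h _ => h3 h).trans ?_
  rw [← Finset.mul_sum]
  refine mul_le_mul_of_nonneg_left ?_ (by positivity)
  have h4 : (Bᶜ.card : ℝ) ≤ hi := by
    rw [Finset.card_compl]
    have := (Finset.mem_Icc.1 hw).2
    exact_mod_cast (by omega : Fintype.card α - B.card ≤ hi)
  have h5 := sum_card_orbit_mem_le w Bᶜ hk hK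
  have h6 : ∑ h : Perm α, ((univ.filter fun z => ∀ i < T + 1, ((h ^ k * w) ^ i) z ∉ B).card : ℝ) ≤
      (n.factorial : ℝ) * (n * (((hi : ℝ) / ((n : ℝ) - k * T)) ^ T +
        ((k : ℝ) * T) ^ 2 / ((n : ℝ) - k * T))) := by
    simp only [Finset.mem_compl] at h5
    refine h5.trans ?_
    gcongr
  have h7 : (n : ℝ) / B.card ≤ (n : ℝ) / (n - hi : ℕ) :=
    div_le_div_of_nonneg_left (by positivity) hm (by exact_mod_cast hB1)
  simp only [Finset.sum_add_distrib, Finset.sum_const, ← Finset.mul_sum, Finset.card_univ,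
    Fintype.card_perm, nsmul_eq_mul]
  rw [← hn]
  unfold corrError
  have hF : (0 : ℝ) < n.factorial := by exact_mod_cast Nat.factorial_pos _
  rw [Nat.cast_add, Nat.cast_one]
  have a1 := mul_le_mul_of_nonneg_left h7 hF.le
  have a2 := mul_le_mul_of_nonneg_left hIc hF.le
  linarith

end LongCycles

/-- A second moment bound for the event that the variables `X i = Y i - W i` all vanish. -/
lemma card_all_zero_mul_sq_le {ι Ω : Type*} [Fintype ι] [DecidableEq ι] [Fintype Ω]
    (X Y W : ι → Ω → ℝ) {n a d e : ℝ} (hX0 : ∀ i ω, 0 ≤ X i ω) (hW0 : ∀ i ω, 0 ≤ W i ω)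
    (hXY : ∀ i ω, X i ω + W i ω = Y i ω) (hYn : ∀ i ω, Y i ω ≤ n) (ha : 0 ≤ a) (he : 0 ≤ e)
    (hY : ∀ i, ∑ ω, Y i ω = Fintype.card Ω * a)
    (hW : ∀ i, ∑ ω, W i ω ≤ Fintype.card Ω * (a * d))
    (hYY : ∀ i j, i ≠ j → ∑ ω, Y i ω * Y j ω ≤ Fintype.card Ω * (a * (a + e)))
    (s : Finset Ω) (hs : ∀ ω ∈ s, ∀ i, X i ω = 0) :
    (s.card : ℝ) * (Fintype.card ι * a) ^ 2 ≤
      Fintype.card Ω * (Fintype.card ι * n ^ 2 + (Fintype.card ι * a) * (Fintype.card ι * e) +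
        2 * d * (Fintype.card ι * a) ^ 2) := by
  set r : ℝ := ((Fintype.card ι : ℕ) : ℝ) with hr
  set P : ℝ := ((Fintype.card Ω : ℕ) : ℝ) with hP
  have hr0 : 0 ≤ r := by rw [hr]; positivity
  have hP0 : 0 ≤ P := by rw [hP]; positivity
  have h1 : (s.card : ℝ) * (r * a) ^ 2 ≤
      ∑ ω, (∑ i, X i ω - r * a) ^ 2 := by
    rw [← nsmul_eq_mul, ← Finset.sum_const]
    refine le_trans ?_ (Finset.sum_le_sum_of_subset_of_nonneg s.subset_univ
      fun ω _ _ => sq_nonneg _)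
    refine Finset.sum_le_sum fun ω hω => ?_
    rw [Finset.sum_eq_zero fun i _ => hs ω hω i]
    simp
  refine h1.trans ?_
  have h2 : ∑ ω, (∑ i, X i ω - r * a) ^ 2 =
      ∑ i, ∑ j, ∑ ω, X i ω * X j ω - 2 * (r * a) * ∑ i, ∑ ω, X i ω + P * (r * a) ^ 2 := by
    have : ∀ ω, (∑ i, X i ω - r * a) ^ 2 =
        ∑ i, ∑ j, X i ω * X j ω - 2 * (r * a) * ∑ i, X i ω + (r * a) ^ 2 := by
      intro ω
      rw [← Finset.sum_mul_sum]
      ring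
    rw [Finset.sum_congr rfl fun ω _ => this ω, Finset.sum_add_distrib, Finset.sum_sub_distrib,
      ← Finset.mul_sum, Finset.sum_const, Finset.card_univ, nsmul_eq_mul, Finset.sum_comm,
      Finset.sum_comm (f := fun ω i => X i ω)]
    have : ∀ i, ∑ ω, ∑ j, X i ω * X j ω = ∑ j, ∑ ω, X i ω * X j ω := fun i => Finset.sum_comm
    rw [Finset.sum_congr rfl fun i _ => this i]
  have h3 : r * (P * a - P * (a * d)) ≤ ∑ i, ∑ ω, X i ω := by
    rw [hr, ← nsmul_eq_mul, ← Finset.card_univ, ← Finset.sum_const]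
    refine Finset.sum_le_sum fun i _ => ?_
    have : ∑ ω, X i ω + ∑ ω, W i ω = ∑ ω, Y i ω := by
      rw [← Finset.sum_add_distrib]
      exact Finset.sum_congr rfl fun ω _ => hXY i ω
    have := hY i
    have := hW i
    linarith
  have hXle : ∀ i ω, X i ω ≤ Y i ω := fun i ω => by have := hXY i ω; have := hW0 i ω; linarith
  have h4 : ∀ i j, ∑ ω, X i ω * X j ω ≤ P * (a * (a + e)) + if i = j then P * n ^ 2 else 0 := by
    intro i j
    by_cases hij : i = j
    · subst hij
      rw [if_pos rfl]
      have : ∑ ω, X i ω * X i ω ≤ ∑ _ω : Ω, n ^ 2 := by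
        refine Finset.sum_le_sum fun ω _ => ?_
        have := hX0 i ω
        have := (hXle i ω).trans (hYn i ω)
        nlinarith
      rw [Finset.sum_const, Finset.card_univ, nsmul_eq_mul] at this
      have : 0 ≤ P * (a * (a + e)) := by positivity
      linarith
    · rw [if_neg hij, add_zero]
      refine le_trans (Finset.sum_le_sum fun ω _ => ?_) (hYY i j hij)
      exact mul_le_mul (hXle i ω) (hXle j ω) (hX0 j ω) ((hX0 i ω).trans (hXle i ω))
  have h5 : ∑ i, ∑ j, ∑ ω, X i ω * X j ω ≤ r * (r * (P * (a * (a + e)))) + r * (P * n ^ 2) := by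
    refine (Finset.sum_le_sum fun i _ => Finset.sum_le_sum fun j _ => h4 i j).trans (le_of_eq ?_)
    simp only [Finset.sum_add_distrib, Finset.sum_const, Finset.card_univ, nsmul_eq_mul,
      Finset.sum_ite_eq, Finset.mem_univ, if_true]
    ring
  rw [h2]
  have h6 := mul_le_mul_of_nonneg_left h3 (by positivity : 0 ≤ 2 * (r * a))
  nlinarith

section LongCyclePairs
variable {α : Type*} [Fintype α] [DecidableEq α]

lemma sum_longCount_pow_mul_pow_le {lo hi T i j r : ℕ} (hlo : 1 ≤ lo) (hlh : lo ≤ hi)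
    (hhi : hi < Fintype.card α) (hi' : i < r) (hj : j < r) (hij : i ≠ j)
    (hK : r * T < Fintype.card α) {η : ℝ} (hη : 0 < η) :
    ∑ p : Perm α × Perm α, (longCount (Finset.Icc lo hi) (p.1 * p.2 ^ i) : ℝ) *
        longCount (Finset.Icc lo hi) (p.1 * p.2 ^ j) ≤
      ((Fintype.card α).factorial : ℝ) ^ 2 * ((Finset.Icc lo hi).card * ((Finset.Icc lo hi).card +
        corrError (Fintype.card α) (Fintype.card α - hi) hi r T η)) := by
  wlog h : i < j generalizing i j
  · have := this hj hi' hij.symm (by omega)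
    rwa [Finset.sum_congr rfl fun p _ => mul_comm _ _] at this
  obtain ⟨k, rfl⟩ := Nat.exists_eq_add_of_lt h
  have hkr : k + 1 ≤ r := by omega
  have hkT : (k + 1) * T ≤ r * T := Nat.mul_le_mul_right _ hkr
  have h1 := sum_longCount_mul_pow_le (α := α) hlo hlh hhi (by omega : 1 ≤ k + 1)
    (lt_of_le_of_lt hkT hK) hη
  have h2 : ∑ p : Perm α × Perm α, (longCount (Finset.Icc lo hi) (p.1 * p.2 ^ i) : ℝ) *
        longCount (Finset.Icc lo hi) (p.1 * p.2 ^ (i + k + 1)) =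
      ∑ h : Perm α, ∑ w : Perm α,
        (longCount (Finset.Icc lo hi) w : ℝ) * longCount (Finset.Icc lo hi) (h ^ (k + 1) * w) := by
    rw [Fintype.sum_prod_type, Finset.sum_comm]
    refine Finset.sum_congr rfl fun h _ => ?_
    rw [← Equiv.sum_comp (Equiv.mulRight (h ^ i)) fun w : Perm α =>
      (longCount (Finset.Icc lo hi) w : ℝ) * longCount (Finset.Icc lo hi) (h ^ (k + 1) * w)]
    refine Finset.sum_congr rfl fun g _ => ?_
    rw [longCount_mul_comm _ (h ^ (k + 1))]
    simp only [Equiv.coe_mulRight, mul_assoc, ← pow_add, add_assoc]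
  rw [h2]
  refine h1.trans ?_
  have hr : (0 : ℝ) < (Fintype.card α : ℝ) - r * T := sub_pos.2 (by exact_mod_cast hK)
  have hkr' : ((k + 1 : ℕ) : ℝ) ≤ r := by exact_mod_cast hkr
  have hk : (0 : ℝ) < (Fintype.card α : ℝ) - (k + 1 : ℕ) * T :=
    sub_pos.2 (by exact_mod_cast lt_of_le_of_lt hkT hK)
  have h0 : 0 ≤ (hi : ℝ) / ((Fintype.card α : ℝ) - (k + 1 : ℕ) * T) := by positivity
  unfold corrError
  gcongr

lemma corrError_nonneg {n m hi k T : ℕ} {η : ℝ} (hη : 0 < η) (hK : k * T < n) :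
    0 ≤ corrError n m hi k T η := by
  have hr : (0 : ℝ) < (n : ℝ) - k * T := sub_pos.2 (by exact_mod_cast hK)
  unfold corrError
  positivity

lemma card_goodCount_eq_zero_mul_sq_le {lo hi T r : ℕ} (hlo : 1 ≤ lo) (hlh : lo ≤ hi)
    (hhi : hi < Fintype.card α) (hK : r * T < Fintype.card α) {η : ℝ} (hη : 0 < η)
    (s : Finset (Perm α × Perm α))
    (hs : ∀ p ∈ s, ∀ i < r, goodCount (Finset.Icc lo hi) (p.1 * p.2 ^ i) = 0) :
    (s.card : ℝ) *
        (r * (Finset.Icc lo hi).card) ^ 2 ≤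
      ((Fintype.card α).factorial : ℝ) ^ 2 * (r * (Fintype.card α : ℝ) ^ 2 +
        (r * (Finset.Icc lo hi).card) *
          (r * corrError (Fintype.card α) (Fintype.card α - hi) hi r T η) +
        2 * (2 * (((Fintype.card α).sqrt : ℝ) + 1) / (Fintype.card α - hi : ℕ)) *
          (r * (Finset.Icc lo hi).card) ^ 2) := by
  have hcard : ((Fintype.card (Perm α × Perm α) : ℕ) : ℝ) = ((Fintype.card α).factorial : ℝ) ^ 2 := by
    rw [Fintype.card_prod, Fintype.card_perm]; push_cast; ring
  have hI : Finset.Icc lo hi ⊆ Finset.Icc 1 (Fintype.card α) := Finset.Icc_subset_Icc hlo hhi.le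
  have hre : ∀ (F : Perm α → ℝ) (i : ℕ), ∑ p : Perm α × Perm α, F (p.1 * p.2 ^ i) =
      ((Fintype.card α).factorial : ℝ) * ∑ w : Perm α, F w := by
    intro F i
    rw [Fintype.sum_prod_type, Finset.sum_comm]
    have : ∀ h : Perm α, ∑ g : Perm α, F (g * h ^ i) = ∑ w : Perm α, F w := fun h =>
      Equiv.sum_comp (Equiv.mulRight (h ^ i)) F
    simp only [this, Finset.sum_const, Finset.card_univ, Fintype.card_perm, nsmul_eq_mul]
  have := card_all_zero_mul_sq_le (ι := Fin r) (Ω := Perm α × Perm α)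
    (fun i p => (goodCount (Finset.Icc lo hi) (p.1 * p.2 ^ (i : ℕ)) : ℝ))
    (fun i p => (longCount (Finset.Icc lo hi) (p.1 * p.2 ^ (i : ℕ)) : ℝ))
    (fun i p => (trivCount (Finset.Icc lo hi) (p.1 * p.2 ^ (i : ℕ)) : ℝ))
    (n := Fintype.card α) (a := (Finset.Icc lo hi).card)
    (d := 2 * (((Fintype.card α).sqrt : ℝ) + 1) / (Fintype.card α - hi : ℕ))
    (e := corrError (Fintype.card α) (Fintype.card α - hi) hi r T η)
    (fun _ _ => Nat.cast_nonneg _) (fun _ _ => Nat.cast_nonneg _)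
    (fun i p => by exact_mod_cast goodCount_add_trivCount _ _)
    (fun i p => by exact_mod_cast longCount_le _ _) (Nat.cast_nonneg _)
    (corrError_nonneg hη hK) ?_ ?_ ?_ s ?_
  · rw [hcard, Fintype.card_fin] at this
    exact this
  · intro i
    rw [hcard, hre (fun w => (longCount (Finset.Icc lo hi) w : ℝ)), sum_longCount hI]
    ring
  · intro i
    rw [hcard, hre (fun w => (trivCount (Finset.Icc lo hi) w : ℝ)), sq, mul_assoc]
    exact mul_le_mul_of_nonneg_left (sum_trivCount_le hlo hhi) (Nat.cast_nonneg _)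
  · intro i j hij
    rw [hcard]
    exact sum_longCount_pow_mul_pow_le hlo hlh hhi i.2 j.2 (fun h => hij (Fin.ext h)) hK hη
  · intro p hp i
    exact_mod_cast hs p hp i i.2

end LongCyclePairs

lemma exists_small_support_of_goodCount {n : ℕ} {g h : Perm (Fin n)} {i r hi : ℕ} (hir : i < r)
    (hgood : goodCount (Finset.Icc (n - n / 4) hi) (g * h ^ i) ≠ 0) :
    ∃ σ ∈ wordBall (genSet g h) (n * r), σ ≠ 1 ∧ 4 * σ.support.card ≤ n := by
  obtain ⟨z, hz⟩ := Finset.card_pos.1 (Nat.pos_of_ne_zero hgood)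
  simp only [mem_filter, mem_univ, true_and, Finset.mem_Icc] at hz
  obtain ⟨⟨hlo, -⟩, hne⟩ := hz
  refine ⟨_, ?_, hne, ?_⟩
  · have h1 : g ∈ wordBall (genSet g h) 1 := mem_wordBall_one (by simp [genSet])
    have h2 : h ∈ wordBall (genSet g h) 1 := mem_wordBall_one (by simp [genSet])
    have h3 := pow_mem_wordBall (mul_mem_wordBall h1 (pow_mem_wordBall h2 i))
      (cycleLen (g * h ^ i) z)
    have h4 : cycleLen (g * h ^ i) z ≤ n := by simpa using cycleLen_le (g * h ^ i) z
    refine wordBall_mono ?_ h3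
    exact Nat.mul_le_mul h4 (by omega)
  · set w := g * h ^ i with hw
    have h1 : (w ^ cycleLen w z).support ⊆ offCycle w z := by
      intro y hy
      rw [mem_offCycle]
      intro hs
      exact Perm.mem_support.1 hy (pow_cycleLen_apply w hs)
    have h2 := Finset.card_le_card h1
    have h3 := card_offCycle_add w z
    rw [Fintype.card_fin] at h3
    omega

/-- The final numerical estimate in the second moment method. -/
lemma secondMoment_numerics {ε : ℝ} (hε : 0 < ε) : ∃ (r T : ℕ) (η : ℝ) (N : ℕ), 0 < η ∧ 0 < r ∧
    ∀ n : ℕ, N ≤ n → 40 ≤ n ∧ r * T < n ∧ ∀ a : ℝ, (n : ℝ) / 6 ≤ a →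
      r * (n : ℝ) ^ 2 + (r * a) * (r * corrError n (n / 20) (n - n / 20) r T η) +
        2 * (2 * ((n.sqrt : ℝ) + 1) / (n / 20 : ℕ)) * (r * a) ^ 2 ≤ ε * (r * a) ^ 2 := by
  obtain ⟨r, hr⟩ := exists_nat_gt (144 / ε)
  have hr0 : (0 : ℝ) < r := lt_trans (by positivity) hr
  obtain ⟨T, hT⟩ := exists_pow_lt_of_lt_one (by positivity : (0 : ℝ) < ε / 96)
    (by norm_num : (24 / 25 : ℝ) < 1)
  set η : ℝ := ε / 96 with hη
  have hη0 : 0 < η := by positivity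
  set K : ℝ := (r : ℝ) * T with hK
  have hK0 : 0 ≤ K := by positivity
  set D : ℝ := 24 * K ^ 2 + 240 + 6 * (T + 1) / η ^ 2 + 320 with hD
  have hD0 : 0 < D := by positivity
  obtain ⟨N1, hN1⟩ := exists_nat_gt ((4 * D / ε) ^ 2)
  refine ⟨r, T, η, N1 + 100 * (r * T + 1), hη0, by exact_mod_cast hr0, fun n hn => ?_⟩
  refine ⟨by omega, by omega, fun a ha => ?_⟩
  have hnK : 100 * (K + 1) ≤ n := by
    rw [hK]; exact_mod_cast (by omega : 100 * (r * T + 1) ≤ n)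
  have hn0 : (0 : ℝ) < n := by linarith
  set s : ℝ := Real.sqrt n with hs
  have hs1 : 1 ≤ s := by rw [hs, Real.one_le_sqrt]; linarith
  have hss : s * s = n := Real.mul_self_sqrt hn0.le
  have hsn : s ≤ n := by rw [← hss]; exact le_mul_of_one_le_left (by linarith) hs1
  have hsD : 4 * D / ε ≤ s := by
    rw [hs]
    refine Real.le_sqrt_of_sq_le (hN1.le.trans ?_)
    exact_mod_cast (by omega : N1 ≤ n)
  have hDs : D / s ≤ ε / 4 := by
    rw [div_le_iff₀ hε] at hsD
    rw [div_le_div_iff₀ (by linarith) (by norm_num)]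
    linarith
  have hsq : (n.sqrt : ℝ) ≤ s := Real.nat_sqrt_le_real_sqrt
  have hm : (n : ℝ) / 40 ≤ (n / 20 : ℕ) := by
    have : n ≤ (n / 20) * 40 := by omega
    have : (n : ℝ) ≤ (n / 20 : ℕ) * 40 := by exact_mod_cast this
    linarith
  have hhi : ((n - n / 20 : ℕ) : ℝ) ≤ 24 / 25 * (n - K) := by
    have : 20 * (n - n / 20) ≤ 19 * n + 20 := by omega
    have : 20 * ((n - n / 20 : ℕ) : ℝ) ≤ 19 * n + 20 := by exact_mod_cast this
    linarith
  have hnK' : (n : ℝ) / 2 ≤ n - K := by linarith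
  have hc : corrError n (n / 20) (n - n / 20) r T η ≤ n * (4 * η + D / (6 * s) - 320 / (6 * s)) := by
    have h1 : ((((n - n / 20 : ℕ) : ℝ) / ((n : ℝ) - r * T)) ^ T) ≤ η := by
      refine le_trans (pow_le_pow_left₀ ?_ ?_ T) hT.le
      · rw [← hK]; exact div_nonneg (Nat.cast_nonneg _) (by linarith)
      · rw [← hK, div_le_iff₀ (by linarith)]; exact hhi
    have h2 : ((r : ℝ) * T) ^ 2 / ((n : ℝ) - r * T) ≤ K ^ 2 * (2 / s) := by
      rw [← hK, div_eq_mul_inv]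
      refine mul_le_mul_of_nonneg_left ?_ (sq_nonneg _)
      rw [inv_eq_one_div, div_le_div_iff₀ (by linarith) (by linarith)]
      linarith
    have h3 : (n : ℝ) / (n / 20 : ℕ) ≤ n * (40 / s) := by
      rw [div_eq_mul_inv]
      refine mul_le_mul_of_nonneg_left ?_ hn0.le
      rw [inv_eq_one_div, div_le_div_iff₀ (by linarith) (by linarith)]
      linarith
    have h4 : ((T : ℝ) + 1) / η ^ 2 ≤ n * ((T + 1) / η ^ 2 * (1 / s)) := by
      have : 1 ≤ n * (1 / s) := by
        rw [mul_one_div, le_div_iff₀ (by linarith)]; linarith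
      have h0 : 0 ≤ ((T : ℝ) + 1) / η ^ 2 := by positivity
      calc ((T : ℝ) + 1) / η ^ 2 ≤ (T + 1) / η ^ 2 * (n * (1 / s)) := le_mul_of_one_le_right h0 this
        _ = _ := by ring
    have h5 : n * (4 * η + D / (6 * s) - 320 / (6 * s)) =
      2 * η * n + 2 * (n * (η + K ^ 2 * (2 / s))) + n * (40 / s) + n * ((T + 1) / η ^ 2 * (1 / s)) := by
      rw [hD]; field_simp; ring
    rw [h5]
    unfold corrError
    have := mul_le_mul_of_nonneg_left (add_le_add h1 h2) hn0.le
    linarith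
  have hδ : 2 * (2 * ((n.sqrt : ℝ) + 1) / (n / 20 : ℕ)) ≤ 320 / s := by
    have hm0 : (0 : ℝ) < (n / 20 : ℕ) := by linarith
    have : 2 * ((n.sqrt : ℝ) + 1) / (n / 20 : ℕ) ≤ 160 / s := by
      rw [div_le_div_iff₀ hm0 (by linarith)]
      have : ((n.sqrt : ℝ) + 1) * s ≤ (2 * s) * s :=
        mul_le_mul_of_nonneg_right (by linarith) (by linarith)
      linarith
    calc _ ≤ 2 * (160 / s) := by linarith
      _ = _ := by ring
  have ha0 : 0 < a := by linarith
  have hra : 0 < r * a := by positivity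
  have e1 : r * (n : ℝ) ^ 2 ≤ ε / 4 * (r * a) ^ 2 := by
    have h1 : (n : ℝ) ^ 2 ≤ 36 * a ^ 2 := by
      calc (n : ℝ) ^ 2 ≤ (6 * a) ^ 2 := pow_le_pow_left₀ hn0.le (by linarith) 2
        _ = _ := by ring
    have h2 : 36 ≤ ε / 4 * r := by
      rw [div_lt_iff₀ hε] at hr; linarith
    calc r * (n : ℝ) ^ 2 ≤ r * (36 * a ^ 2) := by gcongr
      _ ≤ r * (ε / 4 * r * a ^ 2) := by gcongr
      _ = _ := by ring
  have hq : 0 ≤ 4 * η + D / (6 * s) - 320 / (6 * s) := by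
    have : 320 / (6 * s) ≤ D / (6 * s) := by
      gcongr
      have : 0 ≤ 24 * K ^ 2 + 240 + 6 * (T + 1) / η ^ 2 := by positivity
      linarith
    linarith
  have e2 : (r * a) * (r * corrError n (n / 20) (n - n / 20) r T η) ≤
      (24 * η + D / s - 320 / s) * (r * a) ^ 2 := by
    have : corrError n (n / 20) (n - n / 20) r T η ≤ 6 * a * (4 * η + D / (6 * s) - 320 / (6 * s)) :=
      hc.trans (mul_le_mul_of_nonneg_right (by linarith) hq)
    calc _ ≤ (r * a) * (r * (6 * a * (4 * η + D / (6 * s) - 320 / (6 * s)))) := by gcongr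
      _ = _ := by field_simp; ring
  have e3 := mul_le_mul_of_nonneg_right hδ (sq_nonneg (r * a))
  have e4 : (24 * η + D / s) * (r * a) ^ 2 ≤ (ε / 4 + ε / 4) * (r * a) ^ 2 := by
    refine mul_le_mul_of_nonneg_right ?_ (sq_nonneg _)
    rw [hη] at *; linarith
  have e5 : 0 ≤ ε * (r * a) ^ 2 := by positivity
  linarith

/-- Almost every pair of permutations has a short word of small support. -/
lemma exists_small_support_of_random {ε : ℝ} (hε : 0 < ε) : ∃ r N : ℕ, ∀ n, N ≤ n →
    ((univ.filter fun p : Perm (Fin n) × Perm (Fin n) =>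
      ¬ ∃ σ ∈ wordBall (genSet p.1 p.2) (n * r), σ ≠ 1 ∧ 4 * σ.support.card ≤ n).card : ℝ) ≤
        ε * (n.factorial : ℝ) ^ 2 := by
  obtain ⟨r, T, η, N, hη, hr, hN⟩ := secondMoment_numerics hε
  refine ⟨r, N, fun n hn => ?_⟩
  obtain ⟨hn40, hK, hmain⟩ := hN n hn
  have hIc : (Finset.Icc (n - n / 4) (n - n / 20)).card = n - n / 20 + 1 - (n - n / 4) := Nat.card_Icc _ _
  have ha : (n : ℝ) / 6 ≤ (Finset.Icc (n - n / 4) (n - n / 20)).card := by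
    rw [hIc]
    have : n ≤ 6 * (n - n / 20 + 1 - (n - n / 4)) := by omega
    have : (n : ℝ) ≤ 6 * (n - n / 20 + 1 - (n - n / 4) : ℕ) := by exact_mod_cast this
    linarith
  set a : ℝ := ((Finset.Icc (n - n / 4) (n - n / 20)).card : ℝ) with haeq
  have h1 := card_goodCount_eq_zero_mul_sq_le (α := Fin n) (lo := n - n / 4) (hi := n - n / 20)
    (T := T) (r := r) (by omega) (by omega) (by rw [Fintype.card_fin]; omega)
    (by rwa [Fintype.card_fin]) hη
    (univ.filter fun p : Perm (Fin n) × Perm (Fin n) =>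
      ¬ ∃ σ ∈ wordBall (genSet p.1 p.2) (n * r), σ ≠ 1 ∧ 4 * σ.support.card ≤ n) ?_
  · rw [Fintype.card_fin, show n - (n - n / 20) = n / 20 by omega, ← haeq] at h1
    have h2 := hmain a ha
    have hra : 0 < (r * a) ^ 2 := by
      have : (0 : ℝ) < n := by exact_mod_cast (by omega : 0 < n)
      have : (0 : ℝ) < r := by exact_mod_cast hr
      have : 0 < a := by linarith
      positivity
    refine le_of_mul_le_mul_right ?_ hra
    refine h1.trans ?_
    have := mul_le_mul_of_nonneg_left h2 (sq_nonneg (n.factorial : ℝ))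
    linarith
  · intro p hp i hi
    by_contra hne
    exact (Finset.mem_filter.1 hp).2 (exists_small_support_of_goodCount hi hne)

lemma exists_contraction_exponent {n : ℕ} (hn : 3 ≤ n) : ∃ J : ℕ,
    (15 / 16 : ℝ) ^ 2 ^ J ≤ 1 / n ∧ (2 : ℝ) ^ J ≤ 34 * Real.log n := by
  have hn0 : (0 : ℝ) < n := by exact_mod_cast (by omega : 0 < n)
  have hlog : 1 ≤ Real.log n := by
    rw [Real.le_log_iff_exp_le hn0]
    have : (3 : ℝ) ≤ n := by exact_mod_cast hn
    linarith [Real.exp_one_lt_d9]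
  set m := ⌈16 * Real.log n⌉₊ with hm
  have hm1 : 16 * Real.log n ≤ m := Nat.le_ceil _
  have hm2 : (m : ℝ) < 16 * Real.log n + 1 := Nat.ceil_lt_add_one (by linarith)
  have hm3 : 1 < m := by
    have : (1 : ℝ) < m := by linarith
    exact_mod_cast this
  refine ⟨Nat.clog 2 m, ?_, ?_⟩
  · have h1 : m ≤ 2 ^ Nat.clog 2 m := Nat.le_pow_clog (by norm_num) m
    have h2 : (15 / 16 : ℝ) ^ 2 ^ Nat.clog 2 m ≤ (15 / 16 : ℝ) ^ m :=
      pow_le_pow_of_le_one (by norm_num) (by norm_num) h1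
    have h3 : (15 / 16 : ℝ) ≤ Real.exp (-(1 / 16)) := by
      linarith [Real.add_one_le_exp (-(1 / 16) : ℝ)]
    calc _ ≤ (15 / 16 : ℝ) ^ m := h2
      _ ≤ Real.exp (-(1 / 16)) ^ m := pow_le_pow_left₀ (by norm_num) h3 m
      _ = Real.exp (m * -(1 / 16)) := (Real.exp_nat_mul _ _).symm
      _ ≤ Real.exp (-Real.log n) := Real.exp_le_exp.2 (by linarith)
      _ = 1 / n := by rw [Real.exp_neg, Real.exp_log hn0, one_div]
  · have h1 : 2 ^ (Nat.clog 2 m).pred < m := Nat.pow_pred_clog_lt_self (by norm_num) hm3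
    have h2 : 0 < Nat.clog 2 m := Nat.clog_pos (by norm_num) hm3
    obtain ⟨k, hk⟩ := Nat.exists_eq_succ_of_ne_zero h2.ne'
    rw [hk] at h1 ⊢
    have h3 : ((2 : ℝ)) ^ k ≤ m := by exact_mod_cast h1.le
    rw [Nat.succ_eq_add_one, pow_succ]
    linarith

lemma wordLength_bound {n r J : ℕ} {l : ℝ} (hn : 1 ≤ n) (hl : 1 ≤ l)
    (hJ : (2 : ℝ) ^ J ≤ 34 * l) (hr : 16 * (295936 * (r + 320 : ℝ)) ^ 2 ≤ l) :
    8 * ((n : ℝ) * ((4 * (4 ^ (J + 3) * (n * r + 2 * (16 * mixLength n)) +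
      2 * (16 * mixLength n)) : ℕ) : ℝ) ^ 2 + 1) ≤ (n : ℝ) ^ 3 * l ^ 5 := by
  set L := 4 * (4 ^ (J + 3) * (n * r + 2 * (16 * mixLength n)) + 2 * (16 * mixLength n)) with hL
  have hn' : (1 : ℝ) ≤ n := by exact_mod_cast hn
  have hmix : mixLength n ≤ 5 * n := by
    unfold mixLength
    have : Nat.log 2 n < n := Nat.log_lt_self 2 (by omega)
    omega
  have hmix1 : 1 ≤ mixLength n := by unfold mixLength; omega
  have h1 : L ≤ 256 * 4 ^ J * (n * (r + 320)) := by
    have h4 : 1 ≤ 4 ^ (J + 3) := Nat.one_le_pow _ _ (by norm_num)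
    have h5 : 2 * (16 * mixLength n) ≤ 4 ^ (J + 3) * (2 * (16 * mixLength n)) :=
      Nat.le_mul_of_pos_left _ h4
    calc L ≤ 4 * (4 ^ (J + 3) * (n * r + 2 * (16 * mixLength n)) +
          4 ^ (J + 3) * (2 * (16 * mixLength n))) := by rw [hL]; gcongr
      _ = 4 * 4 ^ (J + 3) * (n * r + 64 * mixLength n) := by ring
      _ ≤ 4 * 4 ^ (J + 3) * (n * r + 64 * (5 * n)) := by gcongr
      _ = _ := by ring
  have hL1 : 1 ≤ L := by
    rw [hL]; omega
  have h2 : (L : ℝ) ≤ 295936 * (r + 320 : ℝ) * (n * l ^ 2) := by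
    have h3 : (L : ℝ) ≤ 256 * 4 ^ J * (n * (r + 320)) := by exact_mod_cast h1
    have h4 : (4 : ℝ) ^ J ≤ (34 * l) ^ 2 := by
      calc (4 : ℝ) ^ J = (2 ^ J) ^ 2 := by rw [← pow_mul, mul_comm, pow_mul]; norm_num
        _ ≤ _ := pow_le_pow_left₀ (by positivity) hJ 2
    calc (L : ℝ) ≤ 256 * 4 ^ J * (n * (r + 320)) := h3
      _ ≤ 256 * (34 * l) ^ 2 * (n * (r + 320)) := by gcongr
      _ = _ := by ring
  have hL1' : (1 : ℝ) ≤ L := by exact_mod_cast hL1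
  have h6 : (1 : ℝ) ≤ n * (L : ℝ) ^ 2 := one_le_mul_of_one_le_of_one_le hn' (one_le_pow₀ hL1')
  calc 8 * ((n : ℝ) * (L : ℝ) ^ 2 + 1) ≤ 16 * (n * (L : ℝ) ^ 2) := by linarith
    _ ≤ 16 * (n * (295936 * (r + 320 : ℝ) * (n * l ^ 2)) ^ 2) := by gcongr
    _ = (n : ℝ) ^ 3 * l ^ 4 * (16 * (295936 * (r + 320 : ℝ)) ^ 2) := by ring
    _ ≤ (n : ℝ) ^ 3 * l ^ 4 * l := by gcongr
    _ = _ := by ring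

lemma card_sub_le_ncard {Ω : Type*} [Fintype Ω] {A : Set Ω} {s t : Finset Ω} {a b : ℝ}
    (h : ∀ p, p ∉ s → p ∉ t → p ∈ A) (hs : (s.card : ℝ) ≤ a) (ht : (t.card : ℝ) ≤ b) :
    (Fintype.card Ω : ℝ) - (a + b) ≤ A.ncard := by
  have h1 : (univ : Finset Ω) ⊆ A.toFinset ∪ (s ∪ t) := by
    intro p _
    rw [Finset.mem_union, Finset.mem_union, Set.mem_toFinset]
    by_cases hp : p ∈ s
    · exact Or.inr (Or.inl hp)
    · by_cases hp' : p ∈ t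
      · exact Or.inr (Or.inr hp')
      · exact Or.inl (h p hp hp')
  have h2 := (Finset.card_le_card h1).trans ((Finset.card_union_le _ _).trans
    (Nat.add_le_add_left (Finset.card_union_le _ _) _))
  rw [Finset.card_univ, ← Set.ncard_eq_toFinset_card'] at h2
  have h3 : (Fintype.card Ω : ℝ) ≤ A.ncard + (s.card + t.card) := by exact_mod_cast h2
  linarith

/-- **Random generators of the symmetric group: spectral gap.**
There exist absolute constants `c, C > 0` such that, with probability `1 - o(1)` for a
random pair `(g, h) ∈ Sym(n) × Sym(n)`, for every mean-zero `f : G → ℝ` one has the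
Rayleigh-quotient inequality
`∑_{x∈G} f(x)·(f(x) − (1/|S|)·∑_{s∈S} f(xs)) ≥ (1/(C·n³·(log n)^c))·∑_{x∈G} f(x)²`,
i.e. the spectral gap of the Cayley graph `Γ(G, S)` is at least `1/(C·n³·(log n)^c)`. -/
theorem random_generators_spectral_gap :
    ∃ c C : ℝ, 0 < c ∧ 0 < C ∧
      ∀ ε : ℝ, 0 < ε → ∃ N : ℕ, ∀ n : ℕ, N ≤ n →
        (1 - ε) * (Nat.factorial n : ℝ) ^ 2 ≤
          (Set.ncard {p : Perm (Fin n) × Perm (Fin n) |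
              ∀ f : Perm (Fin n) → ℝ,
                (∑ x ∈ grpFinset p.1 p.2, f x) = 0 →
                  (1 / (C * (n : ℝ) ^ 3 * Real.log n ^ c)) *
                      ∑ x ∈ grpFinset p.1 p.2, f x ^ 2 ≤
                    ∑ x ∈ grpFinset p.1 p.2,
                      f x * (f x - (1 / ((genSet p.1 p.2).card : ℝ)) *
                        ∑ s ∈ genSet p.1 p.2, f (x * s))} : ℝ) := by
  refine ⟨5, 1, by norm_num, by norm_num, fun ε hε => ?_⟩
  obtain ⟨r, N₁, h₁⟩ := exists_small_support_of_random (half_pos hε)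
  obtain ⟨N₂, h₂⟩ := exists_pairMixing_of_random (half_pos hε)
  obtain ⟨N₃, hN₃⟩ := exists_nat_gt (Real.exp (16 * (295936 * (r + 320 : ℝ)) ^ 2))
  refine ⟨N₁ + N₂ + N₃ + 23040000, fun n hn => ?_⟩
  have hn0 : (0 : ℝ) < n := by exact_mod_cast (by omega : 0 < n)
  have hr : 16 * (295936 * (r + 320 : ℝ)) ^ 2 ≤ Real.log n := by
    rw [Real.le_log_iff_exp_le hn0]
    exact hN₃.le.trans (by exact_mod_cast (by omega : N₃ ≤ n))
  have hlog : 1 ≤ Real.log n := by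
    have : (0 : ℝ) ≤ r := Nat.cast_nonneg r
    nlinarith
  obtain ⟨J, hJ, hJ2⟩ := exists_contraction_exponent (by omega : 3 ≤ n)
  have hL := wordLength_bound (by omega : 1 ≤ n) hlog hJ2 hr
  have hbad₁ := h₁ n (by omega)
  have hbad₂ := h₂ n (by omega)
  refine le_trans (le_of_eq ?_) (card_sub_le_ncard ?_ hbad₁ hbad₂)
  · rw [Fintype.card_prod, Fintype.card_perm, Fintype.card_fin, Nat.cast_mul]
    ring
  · intro p hp₁ hp₂
    rw [Finset.mem_filter, and_iff_right (Finset.mem_univ _), not_not] at hp₁ hp₂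
    obtain ⟨σ, hσS, hσ1, hσ⟩ := hp₁
    obtain ⟨ι, _, _, π, hπ, hD⟩ := hp₂
    intro f hf
    have h3 := threeCycle_mem_wordBall_of_mixing hπ (by omega) genSet_inv_mem hD
      hσS hσ hσ1 hJ
    have hP := poincare_of_threeCycles h3 f hf
    have hM : (0 : ℝ) < 1 * (n : ℝ) ^ 3 * Real.log n ^ (5 : ℝ) := by
      have : 0 < Real.log n := by linarith
      positivity
    have hM' : (1 : ℝ) * (n : ℝ) ^ 3 * Real.log n ^ (5 : ℝ) = (n : ℝ) ^ 3 * Real.log n ^ 5 := by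
      rw [one_mul, ← Real.rpow_natCast]; norm_num
    have hsq : 0 ≤ ∑ x ∈ grpFinset p.1 p.2, f x ^ 2 := Finset.sum_nonneg fun x _ => sq_nonneg _
    rw [one_div_mul_eq_div, div_le_iff₀ hM, hM', mul_comm]
    refine hP.trans (mul_le_mul_of_nonneg_right hL ?_)
    exact nonneg_of_mul_nonneg_right (hsq.trans hP) (by positivity)
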